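/- Let d ≥ 1 and let φ : ℕ → [0,∞] satisfy φ(0)=0 and φ nondecreasing (condition (N)), and assume either the repulsive condition (R) or the attractive condition (A) with normalisation (SL). Fix λ > λ₀. Then there exist δ ∈ (0,1/3) and positive constants c and ν, depending only on d, δ and λ, such that uniformly in x ∈ ℤ^d and in h ∈ ∂K_λ dual to x, P_λ^x( #^{cone}_{h,δ}(γ) < c‖x‖ ) ≤ e^{−ν‖x‖}, where #^{cone}_{h,δ}(γ) denotes the number of (h,δ)-cone points of the path γ. -/

import Mathlib

open scoped BigOperators ENNReal
open Filter Topology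

noncomputable section

namespace SIRW

abbrev Pt (d : ℕ) := Fin d → ℤ

variable {d : ℕ}

/-- A step of a nearest-neighbour walk: a vector of ℓ¹-norm one. -/
def IsStep (s : Pt d) : Prop := (∑ i, |s i|) = 1

/-- A nearest-neighbour path started at the origin, encoded by its list of steps. -/
def IsPath (γ : List (Pt d)) : Prop := ∀ s ∈ γ, IsStep s

/-- Position of the path after `k` steps (the path starts at the origin). -/
def pos (γ : List (Pt d)) (k : ℕ) : Pt d := (γ.take k).sum

/-- Displacement `D(γ) = γ(n) - γ(0)`. -/
def disp (γ : List (Pt d)) : Pt d := γ.sum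

/-- Local time of the path at the site `x`. -/
def locTime (γ : List (Pt d)) (x : Pt d) : ℕ :=
  ((Finset.range (γ.length + 1)).filter (fun k => pos γ k = x)).card

/-- The (finite) set of sites visited by the path. -/
def visited (γ : List (Pt d)) : Finset (Pt d) :=
  (Finset.range (γ.length + 1)).image (pos γ)

/-- Site potential `Φ(γ) = ∑_x φ(l_x(γ))`, for `φ : ℕ → [0,∞]` with `φ 0 = 0`. -/
def PotE (φ : ℕ → ℝ≥0∞) (γ : List (Pt d)) : ℝ≥0∞ :=
  ∑ x ∈ visited γ, φ (locTime γ x)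

/-- Site potential `Φ(γ) = ∑_x φ(l_x(γ))`, for real-valued `φ` with `φ 0 = 0`. -/
def PotR (φ : ℕ → ℝ) (γ : List (Pt d)) : ℝ :=
  ∑ x ∈ visited γ, φ (locTime γ x)

/-- `e^{-a}` for `a ∈ [0,∞]`, with `e^{-∞} = 0`. -/
def expNegE (a : ℝ≥0∞) : ℝ≥0∞ :=
  if a = ⊤ then 0 else ENNReal.ofReal (Real.exp (-a.toReal))

/-- `e^{a}` for `a ∈ [0,∞]`, with `e^{∞} = ∞`. -/
def expE (a : ℝ≥0∞) : ℝ≥0∞ :=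
  if a = ⊤ then ⊤ else ENNReal.ofReal (Real.exp a.toReal)

/-- Weight `W_λ(γ) = e^{-Φ(γ) - λ|γ|}` (extended-real-valued potential). -/
def wE (φ : ℕ → ℝ≥0∞) (lam : ℝ) (γ : List (Pt d)) : ℝ≥0∞ :=
  expNegE (PotE φ γ) * ENNReal.ofReal (Real.exp (-(lam * γ.length)))

/-- Weight `W_λ(γ) = e^{-Φ(γ) - λ|γ|}` (real-valued potential). -/
def wR (φ : ℕ → ℝ) (lam : ℝ) (γ : List (Pt d)) : ℝ≥0∞ :=
  ENNReal.ofReal (Real.exp (-PotR φ γ - lam * γ.length))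

/-- The set of `n`-step nearest-neighbour paths started at the origin. -/
def PathsN (d n : ℕ) : Set (List (Pt d)) := {γ | IsPath γ ∧ γ.length = n}

/-- Partition function `Z_n` (extended-real-valued potential). -/
def ZE (d : ℕ) (φ : ℕ → ℝ≥0∞) (n : ℕ) : ℝ≥0∞ :=
  ∑' γ : PathsN d n, expNegE (PotE φ (γ : List (Pt d)))

/-- Partition function `Z_n` (real-valued potential). -/
def ZR (d : ℕ) (φ : ℕ → ℝ) (n : ℕ) : ℝ≥0∞ :=
  ∑' γ : PathsN d n, ENNReal.ofReal (Real.exp (-PotR φ (γ : List (Pt d))))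

/-- Paths from `0` to `x`. -/
def Dpaths (x : Pt d) : Set (List (Pt d)) := {γ | IsPath γ ∧ disp γ = x}

/-- Paths from `0` to `x` hitting `x` only at their final point. -/
def Hpaths (x : Pt d) : Set (List (Pt d)) := {γ | IsPath γ ∧ disp γ = x ∧ locTime γ x = 1}

/-- Two-point function `D_λ(x)` (extended-real-valued potential). -/
def DEf (φ : ℕ → ℝ≥0∞) (lam : ℝ) (x : Pt d) : ℝ≥0∞ :=
  ∑' γ : Dpaths x, wE φ lam (γ : List (Pt d))

/-- Two-point function `H_λ(x)` (extended-real-valued potential). -/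
def HEf (φ : ℕ → ℝ≥0∞) (lam : ℝ) (x : Pt d) : ℝ≥0∞ :=
  ∑' γ : Hpaths x, wE φ lam (γ : List (Pt d))

/-- Two-point function `D_λ(x)` (real-valued potential). -/
def DRf (φ : ℕ → ℝ) (lam : ℝ) (x : Pt d) : ℝ≥0∞ :=
  ∑' γ : Dpaths x, wR φ lam (γ : List (Pt d))

/-- Two-point function `H_λ(x)` (real-valued potential). -/
def HRf (φ : ℕ → ℝ) (lam : ℝ) (x : Pt d) : ℝ≥0∞ :=
  ∑' γ : Hpaths x, wR φ lam (γ : List (Pt d))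

/-- Coercion of a lattice point to a real vector. -/
def ctR (x : Pt d) : Fin d → ℝ := fun i => (x i : ℝ)

/-- Componentwise floor `⌊M x⌋`. -/
def flr (M : ℝ) (x : Fin d → ℝ) : Pt d := fun i => ⌊M * x i⌋

/-- Euclidean scalar product on `ℝ^d`. -/
def inr (h x : Fin d → ℝ) : ℝ := ∑ i, h i * x i

/-- Euclidean norm on `ℝ^d`. -/
def nrm (x : Fin d → ℝ) : ℝ := Real.sqrt (∑ i, x i ^ 2)

/-- Wulff shape `K = {h : (h,x) ≤ ξ(x) ∀x}` associated with a norm `ξ`. -/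
def Kset (ξ : (Fin d → ℝ) → ℝ) : Set (Fin d → ℝ) := {h | ∀ x, inr h x ≤ ξ x}

/-- Weight `W_h(γ) = e^{-Φ(γ) + (h, D(γ))}` (extended-real-valued potential). -/
def wHE (φ : ℕ → ℝ≥0∞) (h : Fin d → ℝ) (γ : List (Pt d)) : ℝ≥0∞ :=
  expNegE (PotE φ γ) * ENNReal.ofReal (Real.exp (inr h (ctR (disp γ))))

/-- Partition function `Z_n^h` with drift `h` (extended-real-valued potential). -/
def ZHE (d : ℕ) (φ : ℕ → ℝ≥0∞) (h : Fin d → ℝ) (n : ℕ) : ℝ≥0∞ :=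
  ∑' γ : PathsN d n, wHE φ h (γ : List (Pt d))

/-- Weight `W_h(γ) = e^{-Φ(γ) + (h, D(γ))}` (real-valued potential). -/
def wHR (φ : ℕ → ℝ) (h : Fin d → ℝ) (γ : List (Pt d)) : ℝ≥0∞ :=
  ENNReal.ofReal (Real.exp (-PotR φ γ + inr h (ctR (disp γ))))

/-- Partition function `Z_n^h` with drift `h` (real-valued potential). -/
def ZHR (d : ℕ) (φ : ℕ → ℝ) (h : Fin d → ℝ) (n : ℕ) : ℝ≥0∞ :=
  ∑' γ : PathsN d n, wHR φ h (γ : List (Pt d))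

/-- Condition (SL) for an extended-real-valued potential: finiteness and sublinearity. -/
def SLE (φ : ℕ → ℝ≥0∞) : Prop :=
  (∀ n, φ n ≠ ⊤) ∧ Tendsto (fun n : ℕ => (φ n).toReal / n) atTop (𝓝 0)

/-- Forward cone `Y^>_δ(h) = {y : s_h(y) < δ ξ(y)}`, where `s_h(y) = ξ(y) - (h,y)`. -/
def Ygt (ξ : (Fin d → ℝ) → ℝ) (h : Fin d → ℝ) (δ : ℝ) : Set (Pt d) :=
  {y | ξ (ctR y) - inr h (ctR y) < δ * ξ (ctR y)}

/-- `γ(k)` is an `(h,δ)`-cone point of `γ`: the whole path lies in the union of the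
forward and backward cones of aperture `3δ` centred at `γ(k)`. -/
def IsConePt (ξ : (Fin d → ℝ) → ℝ) (h : Fin d → ℝ) (δ : ℝ) (γ : List (Pt d)) (k : ℕ) : Prop :=
  k ≤ γ.length ∧ ∀ j ≤ γ.length, j ≠ k →
    ((pos γ j - pos γ k) ∈ Ygt ξ h (3 * δ) ∨ (pos γ k - pos γ j) ∈ Ygt ξ h (3 * δ))

open scoped Classical in
/-- The number of `(h,δ)`-cone points of the path `γ`. -/
def coneCount (ξ : (Fin d → ℝ) → ℝ) (h : Fin d → ℝ) (δ : ℝ) (γ : List (Pt d)) : ℕ :=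
  ((Finset.range (γ.length + 1)).filter (fun k => IsConePt ξ h δ γ k)).card

/-- Unoriented edges traversed by the path `γ` started at the point `a`. -/
def pathEdges (a : Pt d) (γ : List (Pt d)) : Set (Sym2 (Pt d)) :=
  {e | ∃ k < γ.length, e = s(a + pos γ k, a + pos γ (k + 1))}

/-- Starting point of the `i`-th piece in the concatenation of the paths `γv 0, …, γv (m-1)`. -/
def famStart {m : ℕ} (γv : Fin m → List (Pt d)) (i : Fin m) : Pt d :=
  ∑ j ∈ Finset.univ.filter (fun j : Fin m => j < i), disp (γv j)

/-- The pieces `γv 0, …, γv (m-1)` of a concatenation are edge-disjoint. -/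
def EdgeDisjointFam {m : ℕ} (γv : Fin m → List (Pt d)) : Prop :=
  ∀ i j : Fin m, i ≠ j →
    Disjoint (pathEdges (famStart γv i) (γv i)) (pathEdges (famStart γv j) (γv j))

/-- Concatenation `γ₁ ∪ ⋯ ∪ γ_m` of paths (as step lists). -/
def concatFam {m : ℕ} (γv : Fin m → List (Pt d)) : List (Pt d) := (List.ofFn γv).flatten

/-- Perturbed weight `e^{-Φ(γ) - R(γ,g) + (g, D(γ))}`. -/
def wPert (φ : ℕ → ℝ≥0∞) (Rp : List (Pt d) → (Fin d → ℝ) → ℝ) (g : Fin d → ℝ)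
    (γ : List (Pt d)) : ℝ≥0∞ :=
  expNegE (PotE φ γ) * ENNReal.ofReal (Real.exp (-Rp γ g + inr g (ctR (disp γ))))

/-- Perturbed partition function `Z̃_n^g`. -/
def ZPert (d : ℕ) (φ : ℕ → ℝ≥0∞) (Rp : List (Pt d) → (Fin d → ℝ) → ℝ)
    (g : Fin d → ℝ) (n : ℕ) : ℝ≥0∞ :=
  ∑' γ : PathsN d n, wPert φ Rp g (γ : List (Pt d))

/-- The segment of `γ` of length `p` started at time `l` matches the pattern
`(u 0, …, u p)` up to a shift. -/
def patMatch (u : ℕ → Pt d) (p : ℕ) (γ : List (Pt d)) (l : ℕ) : Prop :=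
  ∀ j ≤ p, pos γ (l + j) - pos γ l = u j - u 0

open scoped Classical in
/-- Number of occurrences `N_η(γ)` of the pattern `η = (u 0, …, u p)` in `γ`. -/
def Npat (u : ℕ → Pt d) (p : ℕ) (γ : List (Pt d)) : ℕ :=
  ((Finset.range (γ.length + 1 - p)).filter (fun l => patMatch u p γ l)).card

/-- The gradient vector of `f : ℝ^d → ℝ` at `g`. -/
def gradVec (f : (Fin d → ℝ) → ℝ) (g : Fin d → ℝ) : Fin d → ℝ :=
  fun i => fderiv ℝ f g (Pi.single i 1)

end SIRW

namespace SIRW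

section PartA

variable {d : ℕ}

/-- Visits strictly before the end point. -/
def pre (α : List (Pt d)) (x : Pt d) : ℕ :=
  ((Finset.range α.length).filter (fun k => pos α k = x)).card

/-- Visits strictly after the starting point. -/
def pst (α : List (Pt d)) (x : Pt d) : ℕ :=
  ((Finset.range α.length).filter (fun k => pos α (k + 1) = x)).card

@[simp] lemma pos_zero (α : List (Pt d)) : pos α 0 = 0 := by simp [pos]

@[simp] lemma pos_length (α : List (Pt d)) : pos α α.length = disp α := by simp [pos, disp]

lemma pos_of_length_le (α : List (Pt d)) {k : ℕ} (h : α.length ≤ k) : pos α k = disp α := by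
  simp [pos, disp, List.take_of_length_le h]

lemma pos_append_left (α β : List (Pt d)) {k : ℕ} (h : k ≤ α.length) :
    pos (α ++ β) k = pos α k := by
  simp [pos, List.take_append_of_le_length h]

lemma pos_append_right (α β : List (Pt d)) (k : ℕ) :
    pos (α ++ β) (α.length + k) = disp α + pos β k := by
  simp [pos, disp, List.take_append, List.take_of_length_le]

lemma disp_append (α β : List (Pt d)) : disp (α ++ β) = disp α + disp β := by
  simp [disp]

@[simp] lemma disp_nil : disp ([] : List (Pt d)) = 0 := by simp [disp]

@[simp] lemma disp_cons (s : Pt d) (α : List (Pt d)) : disp (s :: α) = s + disp α := by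
  simp [disp]

lemma disp_take (α : List (Pt d)) (k : ℕ) : disp (α.take k) = pos α k := rfl

lemma pos_drop (α : List (Pt d)) (k j : ℕ) : pos α (k + j) = pos α k + pos (α.drop k) j := by
  simp [pos, List.take_add]

lemma pos_take (α : List (Pt d)) {k j : ℕ} (h : j ≤ k) : pos (α.take k) j = pos α j := by
  simp [pos, List.take_take, min_eq_left h]

lemma isPath_append {α β : List (Pt d)} : IsPath (α ++ β) ↔ IsPath α ∧ IsPath β := by
  simp only [IsPath, List.mem_append]
  constructor
  · intro h
    exact ⟨fun s hs => h s (Or.inl hs), fun s hs => h s (Or.inr hs)⟩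
  · rintro ⟨h1, h2⟩ s (hs | hs)
    · exact h1 s hs
    · exact h2 s hs

lemma isPath_cons {s : Pt d} {β : List (Pt d)} : IsPath (s :: β) ↔ IsStep s ∧ IsPath β := by
  simp [IsPath]

lemma IsPath.take {α : List (Pt d)} (h : IsPath α) (k : ℕ) : IsPath (α.take k) :=
  fun s hs => h s (List.mem_of_mem_take hs)

lemma IsPath.drop {α : List (Pt d)} (h : IsPath α) (k : ℕ) : IsPath (α.drop k) :=
  fun s hs => h s (List.mem_of_mem_drop hs)

lemma isPath_nil : IsPath ([] : List (Pt d)) := by simp [IsPath]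

lemma pre_eq_sum (α : List (Pt d)) (x : Pt d) :
    pre α x = ∑ k ∈ Finset.range α.length, if pos α k = x then 1 else 0 := by
  rw [pre, Finset.card_filter]

lemma pst_eq_sum (α : List (Pt d)) (x : Pt d) :
    pst α x = ∑ k ∈ Finset.range α.length, if pos α (k + 1) = x then 1 else 0 := by
  rw [pst, Finset.card_filter]

lemma loc_eq_sum (α : List (Pt d)) (x : Pt d) :
    locTime α x = ∑ k ∈ Finset.range (α.length + 1), if pos α k = x then 1 else 0 := by
  rw [locTime, Finset.card_filter]

lemma loc_eq_pre (α : List (Pt d)) (x : Pt d) :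
    locTime α x = pre α x + if disp α = x then 1 else 0 := by
  rw [loc_eq_sum, Finset.sum_range_succ, pre_eq_sum, pos_length]

lemma loc_eq_pst (α : List (Pt d)) (x : Pt d) :
    locTime α x = pst α x + if (0 : Pt d) = x then 1 else 0 := by
  rw [loc_eq_sum, Finset.sum_range_succ', pst_eq_sum, pos_zero]

lemma add_eq_iff_eq_sub' (a b x : Pt d) : a + b = x ↔ b = x - a := by
  constructor
  · rintro rfl; simp
  · rintro rfl; simp

lemma loc_append (α β : List (Pt d)) (x : Pt d) :
    locTime (α ++ β) x = pre α x + locTime β (x - disp α) := by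
  rw [loc_eq_sum, loc_eq_sum, pre_eq_sum, List.length_append, add_assoc, Finset.sum_range_add]
  congr 1
  · refine Finset.sum_congr rfl fun k hk => ?_
    rw [pos_append_left _ _ (Finset.mem_range.1 hk).le]
  · refine Finset.sum_congr rfl fun k hk => ?_
    rw [pos_append_right]; simp only [add_eq_iff_eq_sub']

lemma pre_append (α β : List (Pt d)) (x : Pt d) :
    pre (α ++ β) x = pre α x + pre β (x - disp α) := by
  rw [pre_eq_sum, pre_eq_sum, pre_eq_sum, List.length_append, Finset.sum_range_add]
  congr 1
  · refine Finset.sum_congr rfl fun k hk => ?_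
    rw [pos_append_left _ _ (Finset.mem_range.1 hk).le]
  · refine Finset.sum_congr rfl fun k hk => ?_
    rw [pos_append_right]; simp only [add_eq_iff_eq_sub']

lemma loc_append' (α β : List (Pt d)) (x : Pt d) :
    locTime (α ++ β) x = locTime α x + pst β (x - disp α) := by
  rw [loc_append, loc_eq_pst β, loc_eq_pre α]
  have : ((0 : Pt d) = x - disp α) ↔ disp α = x := by
    rw [eq_comm, sub_eq_zero, eq_comm]
  simp only [this]
  ring

lemma loc_pos_iff (α : List (Pt d)) (x : Pt d) :
    0 < locTime α x ↔ ∃ k ≤ α.length, pos α k = x := by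
  simp only [locTime, Finset.card_pos, Finset.Nonempty, Finset.mem_filter, Finset.mem_range,
    Nat.lt_succ_iff]

lemma pre_pos_iff (α : List (Pt d)) (x : Pt d) :
    0 < pre α x ↔ ∃ k < α.length, pos α k = x := by
  simp only [pre, Finset.card_pos, Finset.Nonempty, Finset.mem_filter, Finset.mem_range]

lemma pst_pos_iff (α : List (Pt d)) (x : Pt d) :
    0 < pst α x ↔ ∃ k < α.length, pos α (k + 1) = x := by
  simp only [pst, Finset.card_pos, Finset.Nonempty, Finset.mem_filter, Finset.mem_range]

/-- The potential of a general local time profile. -/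
def Phi (φ : ℕ → ℝ≥0∞) (f : Pt d → ℕ) : ℝ≥0∞ := ∑' x, φ (f x)

lemma PotE_eq {φ : ℕ → ℝ≥0∞} (h0 : φ 0 = 0) (γ : List (Pt d)) :
    PotE φ γ = Phi φ (locTime γ) := by
  rw [PotE, Phi, tsum_eq_sum]
  intro x hx
  have : locTime γ x = 0 := by
    by_contra h
    obtain ⟨k, hk, hkx⟩ := (loc_pos_iff γ x).1 (Nat.pos_of_ne_zero h)
    exact hx (Finset.mem_image.2 ⟨k, Finset.mem_range.2 (Nat.lt_succ_of_le hk), hkx⟩)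
  rw [this, h0]

lemma Phi_shift (φ : ℕ → ℝ≥0∞) (f : Pt d → ℕ) (a : Pt d) :
    Phi φ (fun x => f (x - a)) = Phi φ f :=
  (Equiv.subRight a).tsum_eq (fun x => φ (f x))

lemma Phi_mono {φ : ℕ → ℝ≥0∞} (hm : Monotone φ) {f g : Pt d → ℕ} (h : ∀ x, f x ≤ g x) :
    Phi φ f ≤ Phi φ g :=
  ENNReal.tsum_le_tsum fun x => hm (h x)

lemma Phi_super {φ : ℕ → ℝ≥0∞} (hs : ∀ l m : ℕ, φ l + φ m ≤ φ (l + m)) (f g : Pt d → ℕ) :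
    Phi φ f + Phi φ g ≤ Phi φ (fun x => f x + g x) := by
  rw [Phi, Phi, ← ENNReal.tsum_add]
  exact ENNReal.tsum_le_tsum fun x => hs _ _

lemma Phi_disj {φ : ℕ → ℝ≥0∞} (h0 : φ 0 = 0) {f g : Pt d → ℕ}
    (h : ∀ x, f x = 0 ∨ g x = 0) :
    Phi φ (fun x => f x + g x) = Phi φ f + Phi φ g := by
  rw [Phi, Phi, Phi, ← ENNReal.tsum_add]
  refine tsum_congr fun x => ?_
  rcases h x with h | h <;> simp [h, h0]

lemma Phi_single {φ : ℕ → ℝ≥0∞} (h0 : φ 0 = 0) (a : Pt d) :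
    Phi φ (fun x => if a = x then 1 else 0) = φ 1 := by
  rw [Phi, tsum_eq_single a]
  · simp
  · intro b hb; simp [Ne.symm hb, h0]

lemma Phi_zero {φ : ℕ → ℝ≥0∞} (h0 : φ 0 = 0) : Phi φ (fun _ : Pt d => 0) = 0 := by
  simp [Phi, h0]

lemma expNegE_zero : expNegE 0 = 1 := by simp [expNegE]

lemma expNegE_add (a b : ℝ≥0∞) : expNegE (a + b) = expNegE a * expNegE b := by
  unfold expNegE
  by_cases ha : a = ⊤
  · simp [ha]
  by_cases hb : b = ⊤
  · simp [hb]
  rw [if_neg ha, if_neg hb, if_neg (by simp [ha, hb]), ← ENNReal.ofReal_mul (Real.exp_nonneg _),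
    ← Real.exp_add, ENNReal.toReal_add ha hb]
  congr 2; ring

lemma expNegE_anti {a b : ℝ≥0∞} (h : a ≤ b) : expNegE b ≤ expNegE a := by
  unfold expNegE
  by_cases hb : b = ⊤
  · simp [hb]
  have ha : a ≠ ⊤ := ne_top_of_le_ne_top hb h
  rw [if_neg ha, if_neg hb]
  apply ENNReal.ofReal_le_ofReal
  apply Real.exp_le_exp.2
  have := ENNReal.toReal_mono hb h
  linarith

lemma expNegE_le_one (a : ℝ≥0∞) : expNegE a ≤ 1 := by
  rw [← expNegE_zero]; exact expNegE_anti bot_le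

lemma expNegE_ne_top (a : ℝ≥0∞) : expNegE a ≠ ⊤ :=
  ne_top_of_le_ne_top ENNReal.one_ne_top (expNegE_le_one a)

lemma expNegE_ne_zero {a : ℝ≥0∞} (h : a ≠ ⊤) : expNegE a ≠ 0 := by
  simp [expNegE, h, Real.exp_pos]

/-- `e^{-l n}`. -/
def eL (l : ℝ) (n : ℕ) : ℝ≥0∞ := ENNReal.ofReal (Real.exp (-(l * n)))

lemma eL_add (l : ℝ) (m n : ℕ) : eL l (m + n) = eL l m * eL l n := by
  rw [eL, eL, eL, ← ENNReal.ofReal_mul (Real.exp_nonneg _), ← Real.exp_add]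
  congr 2; push_cast; ring

lemma eL_zero (l : ℝ) : eL l 0 = 1 := by simp [eL]

lemma eL_ne_top (l : ℝ) (n : ℕ) : eL l n ≠ ⊤ := ENNReal.ofReal_ne_top

lemma eL_ne_zero (l : ℝ) (n : ℕ) : eL l n ≠ 0 := by simp [eL, Real.exp_pos]

lemma wE_eq {φ : ℕ → ℝ≥0∞} (h0 : φ 0 = 0) (lam : ℝ) (γ : List (Pt d)) :
    wE φ lam γ = expNegE (Phi φ (locTime γ)) * eL lam γ.length := by
  rw [wE, PotE_eq h0, eL]

/-- ℓ¹-norm on the lattice. -/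
def l1 (y : Pt d) : ℕ := ∑ i, (y i).natAbs

@[simp] lemma l1_zero : l1 (0 : Pt d) = 0 := by simp [l1]

lemma l1_eq_zero {y : Pt d} : l1 y = 0 ↔ y = 0 := by
  simp [l1, Finset.sum_eq_zero_iff, funext_iff]

lemma l1_add (a b : Pt d) : l1 (a + b) ≤ l1 a + l1 b := by
  rw [l1, l1, l1, ← Finset.sum_add_distrib]
  exact Finset.sum_le_sum fun i _ => Int.natAbs_add_le _ _

lemma l1_neg (a : Pt d) : l1 (-a) = l1 a := by simp [l1]

lemma l1_sub_comm (a b : Pt d) : l1 (a - b) = l1 (b - a) := by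
  rw [← l1_neg, neg_sub]

lemma l1_sub_le (a b c : Pt d) : l1 (a - c) ≤ l1 (a - b) + l1 (b - c) := by
  have := l1_add (a - b) (b - c)
  simpa using this

lemma isStep_iff {s : Pt d} : IsStep s ↔ l1 s = 1 := by
  unfold IsStep l1
  rw [← Nat.cast_inj (R := ℤ)]
  push_cast
  simp

lemma l1_disp {α : List (Pt d)} (h : IsPath α) : l1 (disp α) ≤ α.length := by
  induction α with
  | nil => simp
  | cons s α ih =>
    rw [isPath_cons] at h
    have h1 := isStep_iff.1 h.1
    have := l1_add s (disp α)
    have := ih h.2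
    simp only [disp_cons, List.length_cons]; omega

lemma l1_pos {α : List (Pt d)} (h : IsPath α) (k : ℕ) : l1 (pos α k) ≤ k := by
  have := l1_disp (h.take k)
  rw [disp_take] at this
  exact this.trans (by simp)

lemma pos_succ (α : List (Pt d)) {k : ℕ} (hk : k < α.length) :
    pos α (k + 1) = pos α k + α[k] := by
  rw [pos, pos, List.take_add_one, List.sum_append]
  simp [hk]

lemma pos_succ_step {α : List (Pt d)} (h : IsPath α) {k : ℕ} (hk : k < α.length) :
    ∃ s, IsStep s ∧ pos α (k + 1) = pos α k + s :=
  ⟨α[k], h _ (List.getElem_mem hk), pos_succ α hk⟩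

/-- Indicator of being a path. -/
def pw (γ : List (Pt d)) : ℝ≥0∞ := open scoped Classical in if IsPath γ then 1 else 0

lemma pw_of {γ : List (Pt d)} (h : IsPath γ) : pw γ = 1 := by simp [pw, h]

/-- Sum over lists of a multiplicative weight. -/
lemma tsum_list_prod_le {α : Type*} [Countable α] (β : α → ℝ≥0∞) (S : ℝ≥0∞)
    (hS : 1 + (∑' a, β a) * S ≤ S) :
    ∑' l : List α, (l.map β).prod ≤ S := by
  classical
  have key : ∀ N : ℕ, ∑' l : List α, (if l.length ≤ N then (l.map β).prod else 0) ≤ S := by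
    intro N
    induction N with
    | zero =>
      rw [tsum_eq_single ([] : List α)]
      · simpa using le_trans (le_add_right le_rfl) hS
      · intro l hl
        have : ¬ l.length ≤ 0 := by simpa using hl
        simp [this]
    | succ N ih =>
      let e : Unit ⊕ (α × List α) ≃ List α :=
        { toFun := fun o => match o with
            | Sum.inl _ => []
            | Sum.inr (a, l) => a :: l
          invFun := fun l => match l with
            | [] => Sum.inl ()
            | a :: l => Sum.inr (a, l)
          left_inv := by rintro (_ | ⟨a, l⟩) <;> rfl
          right_inv := by rintro (_ | ⟨a, l⟩) <;> rfl }
      rw [← e.tsum_eq, Summable.tsum_sum ENNReal.summable ENNReal.summable]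
      have h1 : (∑' x : α × List α, (if (e (Sum.inr x)).length ≤ N + 1 then
          ((e (Sum.inr x)).map β).prod else 0)) =
          (∑' a, β a) * ∑' l : List α, (if l.length ≤ N then (l.map β).prod else 0) := by
        rw [← ENNReal.tsum_mul_right, ENNReal.tsum_prod']
        refine tsum_congr fun a => ?_
        rw [← ENNReal.tsum_mul_left]
        refine tsum_congr fun l => ?_
        have : e (Sum.inr (a, l)) = a :: l := rfl
        rw [this]
        by_cases h : l.length ≤ N <;> simp [h]
      rw [h1]
      have : ∀ i, e (Sum.inl i) = [] := fun _ => rfl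
      simp only [this, tsum_fintype, Finset.univ_unique, Finset.sum_const, Finset.card_singleton, one_smul]
      simp only [List.length_nil, zero_le, if_true, List.map_nil, List.prod_nil]
      refine le_trans ?_ hS
      gcongr
  rw [ENNReal.tsum_eq_iSup_sum]
  refine iSup_le fun s => ?_
  refine le_trans ?_ (key (s.sup List.length))
  refine le_trans ?_ (ENNReal.sum_le_tsum s)
  refine Finset.sum_le_sum fun l hl => ?_
  rw [if_pos (Finset.le_sup (f := List.length) hl)]

end PartA

end SIRW

namespace SIRW

section PartB

variable {d : ℕ}

/-- Decoupling package: everything that is needed about the potential. -/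
structure Good (d : ℕ) (φ : ℕ → ℝ≥0∞) (lam : ℝ) (ψ : List (Pt d) → ℝ≥0∞) (c0 : ℝ) (A : ℝ≥0∞) :
    Prop where
  h0 : φ 0 = 0
  mono : Monotone φ
  fin1 : φ 1 ≠ ⊤
  dec : ∀ (f : Pt d → ℕ) (η : List (Pt d)) (a : Pt d),
    expNegE (Phi φ (fun x => f x + locTime η (x - a))) ≤ expNegE (Phi φ f) * ψ η
  c0pos : 0 < c0
  Atop : A ≠ ⊤
  sum : ∑' η : List (Pt d), pw η * (ψ η * eL (lam - c0) η.length) ≤ A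

lemma steps_finite (d : ℕ) : {s : Pt d | IsStep s}.Finite := by
  apply Set.Finite.subset (Fintype.piFinset (fun _ : Fin d => Finset.Icc (-1 : ℤ) 1)).finite_toSet
  intro s hs
  have hs : (∑ i, |s i|) = 1 := hs
  simp only [Finset.mem_coe, Fintype.mem_piFinset, Finset.mem_Icc]
  intro i
  have : |s i| ≤ ∑ i, |s i| := Finset.single_le_sum (f := fun i => |s i|) (fun j _ => abs_nonneg _) (Finset.mem_univ i)
  rw [hs] at this
  exact abs_le.1 this

/-- The finite set of steps. -/
def stepsF (d : ℕ) : Finset (Pt d) := (steps_finite d).toFinset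

lemma mem_stepsF {s : Pt d} : s ∈ stepsF d ↔ IsStep s := by simp [stepsF]

/-- The finite set of paths of length `n`. -/
def pathsF (d : ℕ) : ℕ → Finset (List (Pt d))
  | 0 => {[]}
  | n + 1 => Finset.image₂ List.cons (stepsF d) (pathsF d n)

lemma mem_pathsF {n : ℕ} {γ : List (Pt d)} : γ ∈ pathsF d n ↔ IsPath γ ∧ γ.length = n := by
  induction n generalizing γ with
  | zero =>
    simp only [pathsF, Finset.mem_singleton, List.length_eq_zero_iff]
    constructor
    · rintro rfl; exact ⟨isPath_nil, rfl⟩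
    · exact fun h => h.2
  | succ n ih =>
    simp only [pathsF, Finset.mem_image₂, mem_stepsF, ih]
    constructor
    · rintro ⟨s, hs, t, ht, rfl⟩
      exact ⟨isPath_cons.2 ⟨hs, ht.1⟩, by simp [ht.2]⟩
    · rintro ⟨h1, h2⟩
      cases γ with
      | nil => simp at h2
      | cons s t =>
        rw [isPath_cons] at h1
        exact ⟨s, h1.1, t, ⟨h1.2, by simpa using h2⟩, rfl⟩

lemma card_pathsF (d n : ℕ) : (pathsF d n).card = (stepsF d).card ^ n := by
  induction n with
  | zero => simp [pathsF]
  | succ n ih =>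
    rw [pathsF, Finset.card_image₂ (fun a b => ?_), ih, pow_succ, mul_comm]
    rintro c e h
    simpa using h

lemma ZE_eq (φ : ℕ → ℝ≥0∞) (n : ℕ) :
    ZE d φ n = ∑ γ ∈ pathsF d n, expNegE (PotE φ γ) := by
  rw [ZE]
  have : PathsN d n = ↑(pathsF d n) := by
    ext γ; simp [PathsN, mem_pathsF]
  rw [this]
  exact Finset.tsum_subtype (pathsF d n) (fun γ => expNegE (PotE φ γ))

lemma ZE_ne_top (φ : ℕ → ℝ≥0∞) (n : ℕ) : ZE d φ n ≠ ⊤ := by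
  rw [ZE_eq]
  exact (ENNReal.sum_lt_top.2 fun γ _ => (expNegE_ne_top _).lt_top).ne

lemma tsum_list_len (F : List (Pt d) → ℝ≥0∞) :
    ∑' η : List (Pt d), pw η * F η = ∑' n : ℕ, ∑ η ∈ pathsF d n, F η := by
  classical
  have h1 : ∀ n : ℕ, ∑ η ∈ pathsF d n, F η =
      ∑' η : List (Pt d), if η.length = n then pw η * F η else 0 := by
    intro n
    rw [tsum_eq_sum (s := pathsF d n)]
    · refine Finset.sum_congr rfl fun η hη => ?_
      rw [mem_pathsF] at hη
      rw [if_pos hη.2, pw_of hη.1, one_mul]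
    · intro η hη
      rw [mem_pathsF] at hη
      by_cases h : η.length = n
      · have : ¬ IsPath η := fun h' => hη ⟨h', h⟩
        simp [pw, this]
      · simp [h]
  simp_rw [h1]
  rw [ENNReal.tsum_comm]
  refine tsum_congr fun η => ?_
  rw [tsum_eq_single η.length]
  · simp
  · intro n hn; simp [Ne.symm hn]

lemma Z_sum_ne_top (φ : ℕ → ℝ≥0∞) (lam0 l : ℝ)
    (hlam0 : Filter.Tendsto (fun n : ℕ => Real.log (ZE d φ n).toReal / n) Filter.atTop
      (nhds lam0)) (hl : lam0 < l) :
    ∑' n : ℕ, ZE d φ n * eL l n ≠ ⊤ := by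
  obtain ⟨m, hm1, hm2⟩ := exists_between hl
  have hev : ∀ᶠ n : ℕ in atTop, (ZE d φ n).toReal ≤ Real.exp (m * n) := by
    filter_upwards [hlam0.eventually_lt_const hm1, eventually_gt_atTop 0] with n hn hn0
    have hn0' : (0 : ℝ) < n := by exact_mod_cast hn0
    rw [div_lt_iff₀ hn0'] at hn
    rcases (ENNReal.toReal_nonneg (a := ZE d φ n)).eq_or_lt with h | h
    · rw [← h]; exact (Real.exp_pos _).le
    · rw [← Real.exp_log h]; exact Real.exp_le_exp.2 hn.le
  have hs : Summable (fun n : ℕ => (ZE d φ n).toReal * Real.exp (-(l * n))) := by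
    have hg : Summable (fun n : ℕ => Real.exp (-(l - m)) ^ n) := by
      apply summable_geometric_of_lt_one (Real.exp_nonneg _)
      rw [Real.exp_lt_one_iff]; linarith
    apply Summable.of_norm_bounded_eventually_nat hg
    filter_upwards [hev] with n hn
    rw [Real.norm_of_nonneg (by positivity), ← Real.exp_nat_mul]
    calc _ ≤ Real.exp (m * n) * Real.exp (-(l * n)) := by gcongr
      _ = _ := by rw [← Real.exp_add]; congr 1; ring
  have := hs.tsum_ofReal_ne_top
  convert this using 4 with n
  rw [ENNReal.ofReal_mul ENNReal.toReal_nonneg, ENNReal.ofReal_toReal (ZE_ne_top φ n), eL]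

lemma good_rep (φ : ℕ → ℝ≥0∞) (hN0 : φ 0 = 0) (hNmono : Monotone φ) (h1 : φ 1 ≠ ⊤)
    (hs : ∀ l m : ℕ, φ l + φ m ≤ φ (l + m)) (lam0 lam : ℝ)
    (hlam0 : Filter.Tendsto (fun n : ℕ => Real.log (ZE d φ n).toReal / n) Filter.atTop
      (nhds lam0)) (hlam : lam0 < lam) :
    ∃ ψ c0 A, Good d φ lam ψ c0 A := by
  refine ⟨fun η => expNegE (PotE φ η), (lam - lam0) / 2,
    ∑' n : ℕ, ZE d φ n * eL (lam - (lam - lam0) / 2) n, hN0, hNmono, h1, ?_, by linarith,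
    Z_sum_ne_top φ lam0 _ hlam0 (by linarith), ?_⟩
  · intro f η a
    rw [PotE_eq hN0, ← Phi_shift φ (locTime η) a, ← expNegE_add]
    exact expNegE_anti (Phi_super hs _ _)
  · rw [tsum_list_len]
    refine ENNReal.tsum_le_tsum fun n => ?_
    rw [ZE_eq, Finset.sum_mul]
    refine Finset.sum_le_sum fun η hη => ?_
    rw [(mem_pathsF.1 hη).2]

lemma good_att (φ : ℕ → ℝ≥0∞) (hN0 : φ 0 = 0) (hNmono : Monotone φ) (h1 : φ 1 ≠ ⊤) (lam : ℝ)
    (hD : 0 < (stepsF d).card)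
    (hlam : Real.log (stepsF d).card < lam) :
    ∃ ψ c0 A, Good d φ lam ψ c0 A := by
  set D := (stepsF d).card with hDdef
  have hD' : (0 : ℝ) < D := by exact_mod_cast hD
  set c0 := (lam - Real.log D) / 2 with hc0
  set q : ℝ := D * Real.exp (-(lam - c0)) with hq
  have hq0 : 0 < q := by positivity
  have hq1 : q < 1 := by
    rw [hq]
    nth_rewrite 1 [← Real.exp_log hD']
    rw [← Real.exp_add, Real.exp_lt_one_iff, hc0]; linarith
  refine ⟨fun η => 1, c0, ENNReal.ofReal (1 / (1 - q)), hN0, hNmono, h1, ?_,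
    by rw [hc0]; linarith, ENNReal.ofReal_ne_top, ?_⟩
  · intro f η a
    rw [mul_one]
    exact expNegE_anti (Phi_mono hNmono fun x => Nat.le_add_right _ _)
  · rw [tsum_list_len]
    have : ∀ n : ℕ, ∑ η ∈ pathsF d n, 1 * eL (lam - c0) η.length = ENNReal.ofReal (q ^ n) := by
      intro n
      have : ∀ η ∈ pathsF d n, 1 * eL (lam - c0) η.length = eL (lam - c0) n := by
        intro η hη; rw [(mem_pathsF.1 hη).2, one_mul]
      rw [Finset.sum_congr rfl this, Finset.sum_const, card_pathsF, nsmul_eq_mul, hq, mul_pow,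
        ENNReal.ofReal_mul (by positivity), eL, ← Real.exp_nat_mul]
      congr 1
      · rw [ENNReal.ofReal_pow hD'.le]; simp [hDdef]
      · congr 2; ring
    simp_rw [this]
    rw [← ENNReal.ofReal_tsum_of_nonneg (fun n => by positivity)
      (summable_geometric_of_lt_one hq0.le hq1), tsum_geometric_of_lt_one hq0.le hq1, one_div]

end PartB

end SIRW

namespace SIRW

section PartB2

variable {d : ℕ}

/-- The box of radius `r`. -/
def boxF (d r : ℕ) : Finset (Pt d) := Fintype.piFinset fun _ => Finset.Icc (-(r : ℤ)) r

lemma natAbs_le_l1 (y : Pt d) (i : Fin d) : (y i).natAbs ≤ l1 y :=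
  Finset.single_le_sum (f := fun i => (y i).natAbs) (fun _ _ => Nat.zero_le _) (Finset.mem_univ i)

lemma mem_boxF_of {r : ℕ} {y : Pt d} (h : l1 y ≤ r) : y ∈ boxF d r := by
  simp only [boxF, Fintype.mem_piFinset, Finset.mem_Icc]
  intro i
  have := natAbs_le_l1 y i
  omega

lemma card_boxF (d r : ℕ) : (boxF d r).card = (2 * r + 1) ^ d := by
  simp [boxF]
  congr 1
  omega

lemma isPath_neg {β : List (Pt d)} (h : IsPath β) : IsPath (β.map (fun s => -s)) := by
  intro s hs
  obtain ⟨t, ht, rfl⟩ := List.mem_map.1 hs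
  rw [isStep_iff, l1_neg, ← isStep_iff]; exact h t ht

lemma disp_neg (β : List (Pt d)) : disp (β.map (fun s => -s)) = - disp β := by
  induction β with
  | nil => simp
  | cons s β ih => simp only [List.map_cons, disp_cons, ih]; abel

/-- Concatenations of `q` loops. -/
def loopsC (Lp : Finset (List (Pt d))) : ℕ → Finset (List (Pt d))
  | 0 => {[]}
  | q + 1 => Finset.image₂ (fun a b => a ++ b) Lp (loopsC Lp q)

lemma loopsC_spec (Lp : Finset (List (Pt d))) (n : ℕ)
    (hL : ∀ α ∈ Lp, IsPath α ∧ α.length = n ∧ disp α = 0) (q : ℕ) :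
    (loopsC Lp q).card = Lp.card ^ q ∧ ∀ γ ∈ loopsC Lp q, IsPath γ ∧ γ.length = q * n ∧
      ∀ k, l1 (pos γ k) ≤ n := by
  induction q with
  | zero =>
    simp [loopsC, isPath_nil, pos]
  | succ q ih =>
    obtain ⟨ih1, ih2⟩ := ih
    constructor
    · rw [loopsC, Finset.card_image₂_iff.2, ih1, pow_succ, mul_comm]
      rintro ⟨a, b⟩ hab ⟨a', b'⟩ hab' heq
      simp only [Set.mem_prod, Finset.mem_coe] at hab hab'
      have := List.append_inj heq (by rw [(hL _ hab.1).2.1, (hL _ hab'.1).2.1])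
      simpa using this
    · intro γ hγ
      obtain ⟨a, ha, b, hb, rfl⟩ := Finset.mem_image₂.1 hγ
      obtain ⟨a1, a2, a3⟩ := hL a ha
      obtain ⟨b1, b2, b3⟩ := ih2 b hb
      refine ⟨isPath_append.2 ⟨a1, b1⟩, by simp [a2, b2]; ring, fun k => ?_⟩
      rcases le_total k a.length with h | h
      · rw [pos_append_left _ _ h]
        exact (l1_pos a1 k).trans (h.trans a2.le)
      · obtain ⟨j, rfl⟩ := Nat.exists_eq_add_of_le h
        rw [pos_append_right, a3, zero_add]
        exact b3 j

lemma PotE_le_box {φ : ℕ → ℝ≥0∞} (hm : Monotone φ) (γ : List (Pt d)) (r : ℕ)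
    (h : ∀ k, l1 (pos γ k) ≤ r) : PotE φ γ ≤ (boxF d r).card * φ (γ.length + 1) := by
  have hsub : visited γ ⊆ boxF d r := by
    intro x hx
    simp only [visited, Finset.mem_image] at hx
    obtain ⟨k, _, rfl⟩ := hx
    exact mem_boxF_of (h k)
  calc PotE φ γ ≤ ∑ x ∈ visited γ, φ (γ.length + 1) := by
        refine Finset.sum_le_sum fun x _ => hm ?_
        refine (Finset.card_filter_le _ _).trans (by simp)
    _ ≤ ∑ x ∈ boxF d r, φ (γ.length + 1) := Finset.sum_le_sum_of_subset hsub
    _ = _ := by simp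

lemma stepsF_card_pos (hd : 1 ≤ d) : 0 < (stepsF d).card := by
  rw [Finset.card_pos]
  refine ⟨Pi.single ⟨0, hd⟩ 1, mem_stepsF.2 ?_⟩
  rw [isStep_iff, l1, Finset.sum_eq_single ⟨0, hd⟩]
  · simp
  · intro b _ hb; simp [Pi.single_eq_of_ne hb]
  · simp

lemma loops_bound (φ : ℕ → ℝ≥0∞) (hNmono : Monotone φ) (hSL : SLE φ) (lam0 : ℝ)
    (hD : 0 < (stepsF d).card)
    (hlam0 : Filter.Tendsto (fun n : ℕ => Real.log (ZE d φ n).toReal / n) Filter.atTop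
      (nhds lam0)) (m : ℕ) (hm : 0 < m) :
    Real.log (stepsF d).card - Real.log ((2 * m + 1) ^ d) / m ≤ lam0 := by
  classical
  set D := (stepsF d).card with hDd
  obtain ⟨y, hy, hyc⟩ : ∃ y ∈ boxF d m, D ^ m ≤ (2 * m + 1) ^ d *
      ((pathsF d m).filter (fun α => disp α = y)).card := by
    by_contra hcon
    push Not at hcon
    have hmaps : ∀ α ∈ pathsF d m, disp α ∈ boxF d m := fun α hα => by
      obtain ⟨h1, h2⟩ := mem_pathsF.1 hα
      exact mem_boxF_of ((l1_disp h1).trans h2.le)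
    have hsum := Finset.card_eq_sum_card_fiberwise hmaps
    rw [card_pathsF] at hsum
    have hne : (boxF d m).Nonempty := by
      rw [← Finset.card_pos, card_boxF]; positivity
    have := Finset.sum_lt_sum_of_nonempty hne hcon
    rw [← Finset.mul_sum, ← hsum, Finset.sum_const, card_boxF, smul_eq_mul] at this
    exact lt_irrefl _ this
  set F := (pathsF d m).filter (fun α => disp α = y) with hF
  have hFpos : 0 < F.card := by
    rcases Nat.eq_zero_or_pos F.card with h | h
    · rw [h, mul_zero] at hyc
      have : 0 < D ^ m := by positivity
      omega
    · exact h
  set Lp := Finset.image₂ (fun α β => α ++ β.map (fun s : Pt d => -s)) F F with hLp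
  have hFm : ∀ α ∈ F, IsPath α ∧ α.length = m ∧ disp α = y := by
    intro α hα
    rw [hF, Finset.mem_filter, mem_pathsF] at hα
    exact ⟨hα.1.1, hα.1.2, hα.2⟩
  have hLcard : Lp.card = F.card * F.card := by
    rw [hLp, Finset.card_image₂_iff.2]
    rintro ⟨a, b⟩ hab ⟨a', b'⟩ hab' heq
    simp only [Set.mem_prod, Finset.mem_coe] at hab hab'
    have := List.append_inj heq (by rw [(hFm _ hab.1).2.1, (hFm _ hab'.1).2.1])
    have h2 := (List.map_injective_iff.2 (neg_injective (G := Pt d))) this.2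
    exact Prod.ext this.1 h2
  have hLm : ∀ α ∈ Lp, IsPath α ∧ α.length = 2 * m ∧ disp α = 0 := by
    intro α hα
    obtain ⟨a, ha, b, hb, rfl⟩ := Finset.mem_image₂.1 hα
    obtain ⟨a1, a2, a3⟩ := hFm a ha
    obtain ⟨b1, b2, b3⟩ := hFm b hb
    refine ⟨isPath_append.2 ⟨a1, isPath_neg b1⟩, by simp [a2, b2]; ring, ?_⟩
    rw [disp_append, disp_neg, a3, b3, add_neg_cancel]
  set b := (boxF d (2 * m)).card with hb
  -- lower bound on Z
  have hZ : ∀ q : ℕ, 0 < q → Real.log F.card / m - b * ((φ (q * (2 * m) + 1)).toReal /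
      ((q * (2 * m) : ℕ) : ℝ)) ≤
      Real.log (ZE d φ (q * (2 * m))).toReal / ((q * (2 * m) : ℕ) : ℝ) := by
    intro q hq
    obtain ⟨hc, hs⟩ := loopsC_spec Lp (2 * m) hLm q
    have hnpos : (0 : ℝ) < ((q * (2 * m) : ℕ) : ℝ) := by
      have : 0 < q * (2 * m) := by positivity
      exact_mod_cast this
    have hfin := hSL.1 (q * (2 * m) + 1)
    have h1 : ((F.card * F.card) ^ q : ℕ) * expNegE (b * φ (q * (2 * m) + 1)) ≤
        ZE d φ (q * (2 * m)) := by
      rw [ZE_eq, ← hLcard, ← hc, ← nsmul_eq_mul, ← Finset.sum_const]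
      refine (Finset.sum_le_sum fun γ hγ => ?_).trans
        (Finset.sum_le_sum_of_subset (s := loopsC Lp q) fun γ hγ => ?_)
      · obtain ⟨g1, g2, g3⟩ := hs γ hγ
        have := PotE_le_box hNmono γ (2 * m) g3
        rw [g2] at this
        exact expNegE_anti this
      · obtain ⟨g1, g2, g3⟩ := hs γ hγ
        exact mem_pathsF.2 ⟨g1, g2⟩
    have h2 := ENNReal.toReal_mono (ZE_ne_top φ _) h1
    have hbt : (b : ℝ≥0∞) * φ (q * (2 * m) + 1) ≠ ⊤ := ENNReal.mul_ne_top (by simp) hfin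
    rw [ENNReal.toReal_mul, expNegE, if_neg hbt, ENNReal.toReal_ofReal (Real.exp_nonneg _),
      ENNReal.toReal_mul, ENNReal.toReal_natCast, ENNReal.toReal_natCast] at h2
    have hFr : (0 : ℝ) < F.card := by exact_mod_cast hFpos
    have h3 := Real.log_le_log (by push_cast; positivity) h2
    rw [Real.log_mul (by push_cast; positivity) (Real.exp_ne_zero _), Real.log_exp] at h3
    push_cast at h3
    rw [Real.log_pow, Real.log_mul hFr.ne' hFr.ne'] at h3
    rw [le_div_iff₀ hnpos]
    have hm' : (m : ℝ) ≠ 0 := by positivity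
    have hq' : (q : ℝ) ≠ 0 := by positivity
    refine le_trans (le_of_eq ?_) h3
    push_cast
    field_simp
    ring
  have hsub : Tendsto (fun q : ℕ => q * (2 * m)) atTop atTop :=
    tendsto_id.atTop_mul_const' (by positivity)
  have hT1 := hlam0.comp hsub
  have hSL2 : Tendsto (fun n : ℕ => (φ (n + 1)).toReal / (n : ℝ)) atTop (𝓝 0) := by
    have h1 := hSL.2.comp (tendsto_add_atTop_nat 1)
    have h2 : Tendsto (fun n : ℕ => ((n : ℝ) + 1) / n) atTop (𝓝 1) := by
      have : Tendsto (fun n : ℕ => 1 + 1 / (n : ℝ)) atTop (𝓝 (1 + 0)) :=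
        tendsto_const_nhds.add tendsto_one_div_atTop_nhds_zero_nat
      rw [add_zero] at this
      refine this.congr' ?_
      filter_upwards [eventually_gt_atTop 0] with n hn
      have : (n : ℝ) ≠ 0 := by positivity
      field_simp
    have h3 := h1.mul h2
    rw [zero_mul] at h3
    refine h3.congr' ?_
    filter_upwards [eventually_gt_atTop 0] with n hn
    have : (n : ℝ) ≠ 0 := by positivity
    have : (n : ℝ) + 1 ≠ 0 := by positivity
    simp only [Function.comp]
    push_cast
    field_simp
  have hT2 := ((hSL2.comp hsub).const_mul (b : ℝ)).const_sub (Real.log F.card / m)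
  rw [mul_zero, sub_zero] at hT2
  have hle : Real.log F.card / m ≤ lam0 := by
    refine le_of_tendsto_of_tendsto hT2 hT1 ?_
    filter_upwards [eventually_gt_atTop 0] with q hq
    exact hZ q hq
  refine le_trans ?_ hle
  have hm' : (0 : ℝ) < m := by positivity
  have hFr : (0 : ℝ) < F.card := by exact_mod_cast hFpos
  have hDr : (0 : ℝ) < D := by exact_mod_cast hD
  have : (D : ℝ) ^ m ≤ (2 * m + 1) ^ d * F.card := by exact_mod_cast hyc
  have h3 := Real.log_le_log (by positivity) this
  rw [Real.log_mul (by positivity) hFr.ne', Real.log_pow] at h3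
  rw [le_div_iff₀ hm', sub_mul, div_mul_cancel₀ _ hm'.ne']
  linarith

lemma log_card_le (φ : ℕ → ℝ≥0∞) (hNmono : Monotone φ) (hSL : SLE φ) (lam0 : ℝ)
    (hD : 0 < (stepsF d).card)
    (hlam0 : Filter.Tendsto (fun n : ℕ => Real.log (ZE d φ n).toReal / n) Filter.atTop
      (nhds lam0)) :
    Real.log (stepsF d).card ≤ lam0 := by
  have hT : Tendsto (fun m : ℕ => Real.log (stepsF d).card -
      Real.log ((2 * (m : ℝ) + 1) ^ d) / m) atTop (𝓝 (Real.log (stepsF d).card - 0)) := by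
    refine Tendsto.const_sub _ ?_
    have h1 : Tendsto (fun m : ℕ => 2 * (m : ℝ) + 1) atTop atTop :=
      tendsto_atTop_add_const_right _ _
        (tendsto_natCast_atTop_atTop.const_mul_atTop (by norm_num))
    have h2 : Tendsto (fun x : ℝ => Real.log x / x) atTop (𝓝 0) :=
      Real.isLittleO_log_id_atTop.tendsto_div_nhds_zero
    have h3 := (h2.comp h1).const_mul (d : ℝ)
    have h4 : Tendsto (fun n : ℕ => 2 + 1 / (n : ℝ)) atTop (𝓝 (2 + 0)) :=
        tendsto_const_nhds.add tendsto_one_div_atTop_nhds_zero_nat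
    have h5 := h3.mul h4
    rw [mul_zero, zero_mul] at h5
    refine h5.congr' ?_
    filter_upwards [eventually_gt_atTop 0] with n hn
    have : (n : ℝ) ≠ 0 := by positivity
    have : 2 * (n : ℝ) + 1 ≠ 0 := by positivity
    simp only [Function.comp, Real.log_pow]
    field_simp
  rw [sub_zero] at hT
  refine le_of_tendsto hT ?_
  filter_upwards [eventually_gt_atTop 0] with m hm
  exact loops_bound φ hNmono hSL lam0 hD hlam0 m hm

/-- The decoupling package holds in all cases. -/
lemma good_exists (hd : 1 ≤ d) (φ : ℕ → ℝ≥0∞)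
    (hN0 : φ 0 = 0) (hNmono : Monotone φ)
    (hcase : (∀ l m : ℕ, φ l + φ m ≤ φ (l + m)) ∨
      ((∀ l m : ℕ, φ (l + m) ≤ φ l + φ m) ∧ SLE φ))
    (h1 : φ 1 ≠ ⊤) (lam0 : ℝ)
    (hlam0 : Filter.Tendsto (fun n : ℕ => Real.log (ZE d φ n).toReal / n) Filter.atTop
      (nhds lam0))
    (lam : ℝ) (hlam : lam0 < lam) : ∃ ψ c0 A, Good d φ lam ψ c0 A := by
  rcases hcase with h | ⟨_, h⟩
  · exact good_rep φ hN0 hNmono h1 h lam0 lam hlam0 hlam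
  · exact good_att φ hN0 hNmono h1 lam (stepsF_card_pos hd)
      ((log_card_le φ hNmono h lam0 (stepsF_card_pos hd) hlam0).trans_lt hlam)

end PartB2

end SIRW

namespace SIRW

section PartC

variable {d : ℕ}

lemma tsum_le_of_injOn {α β : Type*} (S : Set α) (w : α → ℝ≥0∞) (g : α → β) (hg : Set.InjOn g S)
    (v : β → ℝ≥0∞) (h : ∀ a ∈ S, w a ≤ v (g a)) : ∑' a : S, w a ≤ ∑' b, v b := by
  calc ∑' a : S, w a ≤ ∑' a : S, v (g a) := ENNReal.tsum_le_tsum fun a => h a a.2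
    _ ≤ ∑' b, v b := ENNReal.tsum_comp_le_tsum_of_injective
        (f := fun a : S => g a) (fun a b hab => Subtype.ext (hg a.2 b.2 hab)) v

lemma tsum_prod_mul {α β : Type*} (f : α → ℝ≥0∞) (g : β → ℝ≥0∞) :
    ∑' p : α × β, f p.1 * g p.2 = (∑' a, f a) * ∑' b, g b := by
  rw [ENNReal.tsum_prod (f := fun a b => f a * g b), ← ENNReal.tsum_mul_right]
  refine tsum_congr fun a => ?_
  rw [ENNReal.tsum_mul_left]

lemma mem_Hpaths {y : Pt d} {γ : List (Pt d)} :
    γ ∈ Hpaths y ↔ IsPath γ ∧ disp γ = y ∧ ∀ k < γ.length, pos γ k ≠ y := by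
  have hp := pre_pos_iff γ y
  constructor
  · rintro ⟨h1, h2, h3⟩
    refine ⟨h1, h2, fun k hk he => ?_⟩
    rw [loc_eq_pre, if_pos h2] at h3
    have : 0 < pre γ y := hp.2 ⟨k, hk, he⟩
    omega
  · rintro ⟨h1, h2, h3⟩
    refine ⟨h1, h2, ?_⟩
    rw [loc_eq_pre, if_pos h2]
    have : ¬ 0 < pre γ y := fun h => by
      obtain ⟨k, hk, he⟩ := hp.1 h
      exact h3 k hk he
    omega

lemma pre_eq_zero_of_H {y : Pt d} {γ : List (Pt d)} (h : γ ∈ Hpaths y) : pre γ y = 0 := by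
  obtain ⟨h1, h2, h3⟩ := h
  rw [loc_eq_pre, if_pos h2] at h3
  omega

/-- The indicator of `Hpaths y` times the weight. -/
def wH (φ : ℕ → ℝ≥0∞) (lam : ℝ) (y : Pt d) (γ : List (Pt d)) : ℝ≥0∞ :=
  (Hpaths y).indicator (wE φ lam) γ

lemma HEf_eq (φ : ℕ → ℝ≥0∞) (lam : ℝ) (y : Pt d) : HEf φ lam y = ∑' γ, wH φ lam y γ :=
  tsum_subtype (Hpaths y) (wE φ lam)

lemma wH_of {φ : ℕ → ℝ≥0∞} {lam : ℝ} {y : Pt d} {γ : List (Pt d)} (h : γ ∈ Hpaths y) :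
    wH φ lam y γ = wE φ lam γ := Set.indicator_of_mem h _

/-- `e^{φ(1)}`. -/
def E1 (φ : ℕ → ℝ≥0∞) : ℝ≥0∞ := (expNegE (φ 1))⁻¹

section
variable {φ : ℕ → ℝ≥0∞} {lam : ℝ} {ψ : List (Pt d) → ℝ≥0∞} {c0 : ℝ} {A : ℝ≥0∞}

lemma Good.E1_ne_top (G : Good d φ lam ψ c0 A) : E1 φ ≠ ⊤ :=
  ENNReal.inv_ne_top.2 (expNegE_ne_zero G.fin1)

lemma Good.E1_mul (G : Good d φ lam ψ c0 A) : E1 φ * expNegE (φ 1) = 1 :=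
  ENNReal.inv_mul_cancel (expNegE_ne_zero G.fin1) (expNegE_ne_top _)

lemma one_le_E1 (φ : ℕ → ℝ≥0∞) : 1 ≤ E1 φ := by
  rw [E1, ENNReal.one_le_inv]; exact expNegE_le_one _

lemma Good.psi_nil (G : Good d φ lam ψ c0 A) : 1 ≤ E1 φ * ψ [] := by
  have := G.dec (fun _ => 0) [] 0
  have h1 : (fun x : Pt d => 0 + locTime ([] : List (Pt d)) (x - 0)) =
      fun x => if (0 : Pt d) = x then 1 else 0 := by
    funext x
    rw [loc_eq_pst]
    simp [pst]
  rw [h1, Phi_single G.h0, Phi_zero G.h0, expNegE_zero, one_mul] at this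
  calc 1 = E1 φ * expNegE (φ 1) := G.E1_mul.symm
    _ ≤ _ := mul_le_mul_right this _

/-- e^{-Φ(pre α)} compared to the weight of an `H`-path. -/
lemma Good.pre_H (G : Good d φ lam ψ c0 A) {y : Pt d} {α : List (Pt d)} (h : α ∈ Hpaths y) :
    expNegE (Phi φ (locTime α)) = expNegE (Phi φ (pre α)) * expNegE (φ 1) := by
  have h1 : (locTime α) = fun x => pre α x + if y = x then 1 else 0 := by
    funext x
    rw [loc_eq_pre, h.2.1]
  rw [h1, Phi_disj G.h0, Phi_single G.h0, expNegE_add]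
  intro x
  by_cases hx : y = x
  · left; rw [← hx]; exact pre_eq_zero_of_H h
  · right; simp [hx]

lemma Good.pre_H' (G : Good d φ lam ψ c0 A) {y : Pt d} {α : List (Pt d)} (h : α ∈ Hpaths y) :
    expNegE (Phi φ (pre α)) = E1 φ * expNegE (Phi φ (locTime α)) := by
  rw [G.pre_H h, mul_comm, mul_assoc, mul_comm (expNegE (φ 1)), G.E1_mul, mul_one]

lemma eL_mono {l l' : ℝ} (h : l' ≤ l) (n : ℕ) : eL l n ≤ eL l' n := by
  apply ENNReal.ofReal_le_ofReal
  apply Real.exp_le_exp.2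
  have : (0 : ℝ) ≤ n := by positivity
  nlinarith

lemma Good.sum' (G : Good d φ lam ψ c0 A) :
    ∑' η, pw η * (ψ η * eL lam η.length) ≤ A := by
  refine le_trans (ENNReal.tsum_le_tsum fun η => ?_) G.sum
  gcongr
  exact eL_mono (by linarith [G.c0pos]) _

lemma Good.wE_le (G : Good d φ lam ψ c0 A) (γ : List (Pt d)) :
    wE φ lam γ ≤ ψ γ * eL lam γ.length := by
  rw [wE_eq G.h0]
  gcongr
  have := G.dec (fun _ => 0) γ 0
  simpa [Phi_zero G.h0, expNegE_zero] using this

lemma Good.HEf_le (G : Good d φ lam ψ c0 A) (y : Pt d) :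
    HEf φ lam y ≤ eL c0 (l1 y) * A := by
  rw [HEf_eq]
  refine le_trans (ENNReal.tsum_le_tsum (g := fun γ => eL c0 (l1 y) *
    (pw γ * (ψ γ * eL (lam - c0) γ.length))) fun γ => ?_) ?_
  · by_cases h : γ ∈ Hpaths y
    · rw [wH_of h, pw_of h.1, one_mul]
      refine (G.wE_le γ).trans ?_
      have h1 : l1 y ≤ γ.length := by rw [← h.2.1]; exact l1_disp h.1
      rw [mul_left_comm]
      gcongr
      rw [eL, eL, eL, ← ENNReal.ofReal_mul (Real.exp_nonneg _), ← Real.exp_add]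
      apply ENNReal.ofReal_le_ofReal
      apply Real.exp_le_exp.2
      have h2 : (l1 y : ℝ) ≤ γ.length := by exact_mod_cast h1
      nlinarith [G.c0pos]
    · simp [wH, h]
  · rw [ENNReal.tsum_mul_left]
    gcongr
    exact G.sum

lemma Good.HEf_ne_top (G : Good d φ lam ψ c0 A) (y : Pt d) : HEf φ lam y ≠ ⊤ :=
  ne_top_of_le_ne_top (ENNReal.mul_ne_top (eL_ne_top _ _) G.Atop) (G.HEf_le y)

/-- The constant in the Harnack type inequality. -/
def CH (φ : ℕ → ℝ≥0∞) (lam : ℝ) (A : ℝ≥0∞) : ℝ≥0∞ := E1 φ * (eL lam 1)⁻¹ + E1 φ * A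

lemma Good.CH_ne_top (G : Good d φ lam ψ c0 A) : CH φ lam A ≠ ⊤ := by
  refine ENNReal.add_ne_top.2 ⟨ENNReal.mul_ne_top G.E1_ne_top
    (ENNReal.inv_ne_top.2 (eL_ne_zero _ _)), ENNReal.mul_ne_top G.E1_ne_top G.Atop⟩

lemma exists_first {P : ℕ → Prop} {n : ℕ} (h : ∃ k ≤ n, P k) :
    ∃ k ≤ n, P k ∧ ∀ j < k, ¬ P j := by
  classical
  obtain ⟨k, hk, hP⟩ := h
  have hex : ∃ k, P k := ⟨k, hP⟩
  exact ⟨Nat.find hex, (Nat.find_min' hex hP).trans hk, Nat.find_spec hex,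
    fun j hj => Nat.find_min hex hj⟩

lemma Good.split_le (G : Good d φ lam ψ c0 A) {y : Pt d} {α η : List (Pt d)} (h : α ∈ Hpaths y) :
    wE φ lam (α ++ η) ≤ wE φ lam α * (E1 φ * (ψ η * eL lam η.length)) := by
  have h1 : (locTime (α ++ η)) = fun x => pre α x + locTime η (x - disp α) := by
    funext x; exact loc_append α η x
  rw [wE_eq G.h0, wE_eq G.h0, h1, List.length_append, eL_add]
  calc _ ≤ expNegE (Phi φ (pre α)) * ψ η * (eL lam α.length * eL lam η.length) := by
        gcongr; exact G.dec _ _ _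
    _ = _ := by rw [G.pre_H' h]; ring

lemma Good.harnack (G : Good d φ lam ψ c0 A) (y e : Pt d) (he : IsStep e) :
    HEf φ lam y ≤ CH φ lam A * HEf φ lam (y + e) := by
  classical
  set S1 : Set (List (Pt d)) := {γ | γ ∈ Hpaths y ∧ ∀ k ≤ γ.length, pos γ k ≠ y + e}
  set S2 : Set (List (Pt d)) := {γ | γ ∈ Hpaths y ∧ ∃ k ≤ γ.length, pos γ k = y + e}
  have hsplit : HEf φ lam y ≤ ∑' γ : S1, wE φ lam (γ : List (Pt d)) + ∑' γ : S2, wE φ lam (γ : List (Pt d)) := by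
    rw [HEf_eq, tsum_subtype S1, tsum_subtype S2, ← ENNReal.tsum_add]
    refine ENNReal.tsum_le_tsum fun γ => ?_
    by_cases h : γ ∈ Hpaths y
    · rw [wH_of h]
      by_cases h2 : ∃ k ≤ γ.length, pos γ k = y + e
      · rw [Set.indicator_of_mem (show γ ∈ S2 from ⟨h, h2⟩)]; exact le_add_self
      · have h1 : γ ∈ S1 := ⟨h, fun k hk hh => h2 ⟨k, hk, hh⟩⟩
        rw [Set.indicator_of_mem h1]; exact le_self_add
    · simp [wH, h]
  have hp1 : ∑' γ : S1, wE φ lam (γ : List (Pt d)) ≤ E1 φ * (eL lam 1)⁻¹ * HEf φ lam (y + e) := by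
    rw [HEf_eq, ← ENNReal.tsum_mul_left]
    refine tsum_le_of_injOn S1 _ (fun γ => γ ++ [e]) (fun a _ b _ h => ?_) _ ?_
    · exact List.append_cancel_right h
    · rintro γ ⟨h1, h2⟩
      have hm : γ ++ [e] ∈ Hpaths (y + e) := by
        rw [mem_Hpaths]
        refine ⟨isPath_append.2 ⟨h1.1, by simpa [IsPath] using he⟩, ?_, ?_⟩
        · rw [disp_append, h1.2.1, disp_cons]; simp
        · intro k hk
          rw [List.length_append, List.length_singleton] at hk
          rw [pos_append_left _ _ (by omega)]
          exact h2 k (by omega)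
      have hpre : (pre (γ ++ [e])) = locTime γ := by
        funext x
        rw [pre_append, loc_eq_pre, h1.2.1]
        congr 1
        simp only [pre, List.length_singleton, Finset.range_one, Finset.filter_singleton, pos_zero]
        by_cases hx : y = x
        · simp [hx]
        · rw [if_neg, if_neg hx]; · simp
          intro h0; exact hx (sub_eq_zero.1 h0.symm).symm
      rw [wH_of hm, wE_eq G.h0, wE_eq G.h0, ← hpre, G.pre_H' hm, List.length_append,
        List.length_singleton, eL_add]
      apply le_of_eq
      calc _ = E1 φ * (expNegE (Phi φ (locTime (γ ++ [e]))) * eL lam γ.length) *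
            ((eL lam 1)⁻¹ * eL lam 1) := by
              rw [ENNReal.inv_mul_cancel (eL_ne_zero _ _) (eL_ne_top _ _)]; ring
        _ = _ := by ring
  have hp2 : ∑' γ : S2, wE φ lam (γ : List (Pt d)) ≤ E1 φ * A * HEf φ lam (y + e) := by
    have hf : ∀ γ : List (Pt d), ∃ k, γ ∈ S2 → k ≤ γ.length ∧ pos γ k = y + e ∧
        ∀ j < k, pos γ j ≠ y + e := by
      intro γ
      by_cases h : γ ∈ S2
      · obtain ⟨k, hk⟩ := exists_first h.2
        exact ⟨k, fun _ => hk⟩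
      · exact ⟨0, fun h' => absurd h' h⟩
    choose κ hκ using hf
    calc ∑' γ : S2, wE φ lam (γ : List (Pt d)) ≤ ∑' p : List (Pt d) × List (Pt d),
          wH φ lam (y + e) p.1 * (E1 φ * (pw p.2 * (ψ p.2 * eL lam p.2.length))) := by
          refine tsum_le_of_injOn S2 _ (fun γ => (γ.take (κ γ), γ.drop (κ γ)))
            (fun a _ b _ h => ?_) _ ?_
          · simp only [Prod.mk.injEq] at h
            rw [← List.take_append_drop (κ a) a, ← List.take_append_drop (κ b) b, h.1, h.2]
          · intro γ hγ
            obtain ⟨k1, k2, k3⟩ := hκ γ hγ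
            have hm : γ.take (κ γ) ∈ Hpaths (y + e) := by
              rw [mem_Hpaths]
              refine ⟨hγ.1.1.take _, k2, fun j hj => ?_⟩
              rw [List.length_take, lt_min_iff] at hj
              rw [pos_take _ hj.1.le]
              exact k3 j hj.1
            simp only
            rw [wH_of hm, pw_of (hγ.1.1.drop _), one_mul]
            conv_lhs => rw [← List.take_append_drop (κ γ) γ]
            exact G.split_le hm
      _ = HEf φ lam (y + e) * (E1 φ * ∑' η, pw η * (ψ η * eL lam η.length)) := by
          rw [tsum_prod_mul (wH φ lam (y + e))
            (fun η => E1 φ * (pw η * (ψ η * eL lam η.length))), HEf_eq, ENNReal.tsum_mul_left]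
      _ ≤ HEf φ lam (y + e) * (E1 φ * A) := by gcongr; exact G.sum'
      _ = _ := by ring
  calc _ ≤ _ := hsplit
    _ ≤ _ := add_le_add hp1 hp2
    _ = _ := by rw [CH]; ring

/-- The unit step towards `y` in direction `i`. -/
def sgs (y : Pt d) (i : Fin d) : Pt d := Pi.single i (Int.sign (y i))

lemma sgs_step {y : Pt d} {i : Fin d} (h : y i ≠ 0) : IsStep (sgs y i) := by
  rw [isStep_iff, l1, Finset.sum_eq_single i]
  · simp [sgs, Int.natAbs_sign_of_ne_zero h]
  · intro b _ hb; simp [sgs, Pi.single_eq_of_ne hb]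
  · simp

lemma l1_sub_sgs {y : Pt d} {i : Fin d} (h : y i ≠ 0) : l1 (y - sgs y i) + 1 = l1 y := by
  classical
  rw [l1, l1, ← Finset.add_sum_erase _ _ (Finset.mem_univ i),
    ← Finset.add_sum_erase _ (fun i => (y i).natAbs) (Finset.mem_univ i)]
  have h1 : ∑ x ∈ Finset.univ.erase i, ((y - sgs y i) x).natAbs =
      ∑ x ∈ Finset.univ.erase i, (y x).natAbs := by
    refine Finset.sum_congr rfl fun j hj => ?_
    simp [sgs, Pi.single_eq_of_ne (Finset.ne_of_mem_erase hj)]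
  rw [h1]
  have h2 : ((y - sgs y i) i).natAbs + 1 = (y i).natAbs := by
    simp only [sgs, Pi.sub_apply, Pi.single_eq_same]
    rcases lt_or_gt_of_ne h with h | h
    · rw [Int.sign_eq_neg_one_of_neg h]; omega
    · rw [Int.sign_eq_one_of_pos h]; omega
  omega

lemma exists_ne_of_l1 {y : Pt d} (h : l1 y ≠ 0) : ∃ i, y i ≠ 0 := by
  by_contra hc
  push Not at hc
  exact h (l1_eq_zero.2 (funext hc))

lemma Good.harnack' (G : Good d φ lam ψ c0 A) (n : ℕ) (y z : Pt d) (h : l1 (z - y) = n) :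
    HEf φ lam y ≤ CH φ lam A ^ n * HEf φ lam z := by
  induction n generalizing y with
  | zero =>
    have : z = y := sub_eq_zero.1 (l1_eq_zero.1 h)
    simp [this]
  | succ n ih =>
    obtain ⟨i, hi⟩ := exists_ne_of_l1 (y := z - y) (by omega)
    have h1 := l1_sub_sgs hi
    have h2 := G.harnack y _ (sgs_step hi)
    have h3 := ih (y + sgs (z - y) i) (by rw [← sub_sub]; omega)
    calc _ ≤ _ := h2
      _ ≤ CH φ lam A * (CH φ lam A ^ n * HEf φ lam z) := by gcongr
      _ = _ := by ring

lemma nil_mem_H : ([] : List (Pt d)) ∈ Hpaths (0 : Pt d) := by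
  rw [mem_Hpaths]; simp [isPath_nil]

lemma Good.HEf_ne_zero (G : Good d φ lam ψ c0 A) (y : Pt d) : HEf φ lam y ≠ 0 := by
  have h0 : HEf φ lam (0 : Pt d) ≠ 0 := by
    rw [HEf_eq]
    intro h
    have := ENNReal.tsum_eq_zero.1 h []
    rw [wH_of nil_mem_H, wE_eq G.h0, G.pre_H nil_mem_H] at this
    have hp : pre ([] : List (Pt d)) = fun _ => 0 := by funext x; simp [pre]
    rw [hp, Phi_zero G.h0] at this
    simp [expNegE_zero, eL_ne_zero, expNegE_ne_zero G.fin1] at this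
  intro h
  have := G.harnack' _ 0 y rfl
  rw [h, mul_zero] at this
  exact h0 (le_antisymm this bot_le)

/-- `-log H(y)`. -/
def lg (φ : ℕ → ℝ≥0∞) (lam : ℝ) (y : Pt d) : ℝ := -Real.log (HEf φ lam y).toReal

lemma Good.HEf_eq_exp (G : Good d φ lam ψ c0 A) (y : Pt d) :
    HEf φ lam y = ENNReal.ofReal (Real.exp (- lg φ lam y)) := by
  rw [lg, neg_neg, Real.exp_log (ENNReal.toReal_pos (G.HEf_ne_zero y) (G.HEf_ne_top y)),
    ENNReal.ofReal_toReal (G.HEf_ne_top y)]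

lemma Good.lg_lip (G : Good d φ lam ψ c0 A) : ∃ C : ℝ, 0 ≤ C ∧
    ∀ y z : Pt d, lg φ lam z ≤ lg φ lam y + C * l1 (z - y) := by
  have hC1 : 1 ≤ (CH φ lam A + 1) := le_add_self
  have hCt : CH φ lam A + 1 ≠ ⊤ := ENNReal.add_ne_top.2 ⟨G.CH_ne_top, ENNReal.one_ne_top⟩
  refine ⟨Real.log (CH φ lam A + 1).toReal, Real.log_nonneg ?_, fun y z => ?_⟩
  · have := ENNReal.toReal_mono hCt hC1
    simpa using this
  · have h1 := G.harnack' _ y z rfl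
    have h2 : HEf φ lam y ≤ (CH φ lam A + 1) ^ (l1 (z - y)) * HEf φ lam z := by
      refine h1.trans ?_
      gcongr
      exact le_self_add
    have h3 := ENNReal.toReal_mono (ENNReal.mul_ne_top (ENNReal.pow_ne_top hCt)
      (G.HEf_ne_top z)) h2
    rw [ENNReal.toReal_mul, ENNReal.toReal_pow] at h3
    have hy := ENNReal.toReal_pos (G.HEf_ne_zero y) (G.HEf_ne_top y)
    have hz := ENNReal.toReal_pos (G.HEf_ne_zero z) (G.HEf_ne_top z)
    have hc : 0 < (CH φ lam A + 1).toReal :=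
      ENNReal.toReal_pos (zero_lt_one.trans_le hC1).ne' hCt
    have h4 := Real.log_le_log hy h3
    rw [Real.log_mul (by positivity) hz.ne', Real.log_pow] at h4
    simp only [lg]
    linarith

lemma Good.lg_ge (G : Good d φ lam ψ c0 A) : ∃ B : ℝ, ∀ y : Pt d, c0 * l1 y - B ≤ lg φ lam y := by
  refine ⟨Real.log A.toReal, fun y => ?_⟩
  have h1 := G.HEf_le y
  have h3 := ENNReal.toReal_mono (ENNReal.mul_ne_top (eL_ne_top _ _) G.Atop) h1
  rw [ENNReal.toReal_mul, eL, ENNReal.toReal_ofReal (Real.exp_nonneg _)] at h3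
  have hy := ENNReal.toReal_pos (G.HEf_ne_zero y) (G.HEf_ne_top y)
  have hA : A.toReal ≠ 0 := by
    intro h0
    rw [h0, mul_zero] at h3
    linarith
  have h4 := Real.log_le_log hy h3
  rw [Real.log_mul (Real.exp_ne_zero _) hA, Real.log_exp] at h4
  simp only [lg]
  linarith

end

end PartC

end SIRW

namespace SIRW

section PartD

variable {d : ℕ}

/-- What is needed about the Lyapunov exponent restricted to the lattice. -/
structure Lyap (d : ℕ) (φ : ℕ → ℝ≥0∞) (lam : ℝ) (X : Pt d → ℝ) (c1 C1 : ℝ) : Prop where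
  c1pos : 0 < c1
  C1one : 1 ≤ C1
  lower : ∀ y, c1 * l1 y ≤ X y
  upper : ∀ y, X y ≤ C1 * l1 y
  lip : ∀ y z, X z ≤ X y + C1 * l1 (z - y)
  unif : ∀ ε : ℝ, 0 < ε → ∃ B : ℝ, ∀ y, |lg φ lam y - X y| ≤ ε * l1 y + B

/-- real ℓ¹ norm -/
def rl1 (x : Fin d → ℝ) : ℝ := ∑ i, |x i|

lemma l1_cast (y : Pt d) : (l1 y : ℝ) = ∑ i, |(y i : ℝ)| := by
  rw [l1]; push_cast
  refine Finset.sum_congr rfl fun i _ => ?_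
  rw [Nat.cast_natAbs, Int.cast_abs]

lemma l1_flr_sub (M : ℝ) (hM : 0 ≤ M) (x y : Fin d → ℝ) :
    (l1 (flr M x - flr M y) : ℝ) ≤ M * rl1 (x - y) + d := by
  rw [l1_cast]
  have : M * rl1 (x - y) + d = ∑ i : Fin d, (M * |x i - y i| + 1) := by
    rw [Finset.sum_add_distrib, rl1, Finset.mul_sum]; simp
  rw [this]
  refine Finset.sum_le_sum fun i _ => ?_
  simp only [flr, Pi.sub_apply]
  push_cast
  have h1 := Int.floor_le (M * x i)
  have h2 := Int.lt_floor_add_one (M * x i)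
  have h3 := Int.floor_le (M * y i)
  have h4 := Int.lt_floor_add_one (M * y i)
  rw [← abs_of_nonneg hM, ← abs_mul, mul_sub, abs_of_nonneg hM]
  have h5 := le_abs_self (M * x i - M * y i)
  have h6 := neg_abs_le (M * x i - M * y i)
  rw [abs_le]; constructor <;> linarith

lemma flr_smul (M r : ℝ) (x : Fin d → ℝ) : flr M (r • x) = flr (M * r) x := by
  funext i; simp [flr, mul_assoc]

lemma flr_one (y : Pt d) : flr 1 (ctR y) = y := by
  funext i; simp [flr, ctR]

lemma flr_div (M : ℝ) (hM : M ≠ 0) (y : Pt d) : flr M (M⁻¹ • ctR y) = y := by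
  rw [flr_smul, mul_inv_cancel₀ hM, flr_one]

lemma flr_nat (M : ℕ) (y : Pt d) : flr (M : ℝ) (ctR y) = M • y := by
  funext i
  simp only [flr, ctR, Pi.smul_apply]
  have : (M : ℝ) * (y i : ℝ) = ((M • y i : ℤ) : ℝ) := by simp
  rw [this, Int.floor_intCast]

lemma l1_nsmul (M : ℕ) (y : Pt d) : l1 (M • y) = M * l1 y := by
  rw [l1, l1, Finset.mul_sum]
  refine Finset.sum_congr rfl fun i _ => ?_
  simp [Int.natAbs_mul]

lemma ctR_sub (y z : Pt d) : ctR (y - z) = ctR y - ctR z := by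
  funext i; simp [ctR]

lemma rl1_ctR (y : Pt d) : rl1 (ctR y) = l1 y := by rw [l1_cast]; rfl

section
variable {φ : ℕ → ℝ≥0∞} {lam : ℝ} {ψ : List (Pt d) → ℝ≥0∞} {c0 : ℝ} {A : ℝ≥0∞}

lemma lyap_exists (G : Good d φ lam ψ c0 A) (ξ : (Fin d → ℝ) → ℝ)
    (hξ : ∀ x : Fin d → ℝ,
      Filter.Tendsto (fun M : ℝ => -Real.log (HEf φ lam (flr M x)).toReal / M)
        Filter.atTop (nhds (ξ x))) :
    ∃ c1 C1, Lyap d φ lam (fun y => ξ (ctR y)) c1 C1 := by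
  obtain ⟨C, hC0, hC⟩ := G.lg_lip
  obtain ⟨B, hB⟩ := G.lg_ge
  have hξ' : ∀ x, Tendsto (fun M : ℝ => lg φ lam (flr M x) / M) atTop (𝓝 (ξ x)) := hξ
  -- Lipschitz
  have hlip : ∀ x y, ξ x ≤ ξ y + C * rl1 (x - y) := by
    intro x y
    have h1 : Tendsto (fun M : ℝ => lg φ lam (flr M y) / M + C * (rl1 (x - y) + d / M)) atTop
        (𝓝 (ξ y + C * (rl1 (x - y) + 0))) := by
      refine (hξ' y).add ((tendsto_const_nhds.add ?_).const_mul C)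
      exact tendsto_const_nhds.div_atTop tendsto_id
    rw [add_zero] at h1
    refine le_of_tendsto_of_tendsto (hξ' x) h1 ?_
    filter_upwards [eventually_gt_atTop 0] with M hM
    have h2 := hC (flr M y) (flr M x)
    have h3 := l1_flr_sub M hM.le x y
    rw [div_le_iff₀ hM, add_mul, div_mul_cancel₀ _ hM.ne']
    have h4 : C * (rl1 (x - y) + d / M) * M = C * (M * rl1 (x - y) + d) := by
      field_simp
    rw [h4]
    nlinarith
  have hhom : ∀ (r : ℝ) (x : Fin d → ℝ), 0 < r → ξ (r • x) = r * ξ x := by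
    intro r x hr
    have h1 := hξ' (r • x)
    have h2 : Tendsto (fun M : ℝ => r * (lg φ lam (flr (M * r) x) / (M * r))) atTop
        (𝓝 (r * ξ x)) :=
      ((hξ' x).comp (tendsto_id.atTop_mul_const hr)).const_mul r
    refine tendsto_nhds_unique h1 (h2.congr' ?_)
    filter_upwards [eventually_gt_atTop 0] with M hM
    rw [flr_smul]
    field_simp
  have hnat : ∀ y : Pt d, Tendsto (fun M : ℕ => lg φ lam (M • y) / M) atTop (𝓝 (ξ (ctR y))) := by
    intro y
    have := (hξ' (ctR y)).comp (tendsto_natCast_atTop_atTop (R := ℝ))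
    refine this.congr fun M => ?_
    simp only [Function.comp, flr_nat]
  have hlow : ∀ y : Pt d, c0 * l1 y ≤ ξ (ctR y) := by
    intro y
    have h1 : Tendsto (fun M : ℕ => c0 * l1 y - B / M) atTop (𝓝 (c0 * l1 y - 0)) :=
      tendsto_const_nhds.sub (tendsto_const_nhds.div_atTop tendsto_natCast_atTop_atTop)
    rw [sub_zero] at h1
    refine le_of_tendsto_of_tendsto h1 (hnat y) ?_
    filter_upwards [eventually_gt_atTop 0] with M hM
    have hM' : (0 : ℝ) < M := by exact_mod_cast hM
    rw [le_div_iff₀ hM', sub_mul, div_mul_cancel₀ _ hM'.ne']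
    have := hB (M • y)
    rw [l1_nsmul] at this
    push_cast at this
    linarith
  have h00 : ξ (ctR (0 : Pt d)) = 0 := by
    have h1 := hnat 0
    simp only [smul_zero] at h1
    exact tendsto_nhds_unique h1 (tendsto_const_nhds.div_atTop tendsto_natCast_atTop_atTop)
  have hlipL : ∀ y z : Pt d, ξ (ctR z) ≤ ξ (ctR y) + C * l1 (z - y) := by
    intro y z
    have := hlip (ctR z) (ctR y)
    rwa [← ctR_sub, rl1_ctR] at this
  have hup : ∀ y : Pt d, ξ (ctR y) ≤ C * l1 y := by
    intro y
    have := hlipL 0 y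
    rwa [h00, sub_zero, zero_add] at this
  refine ⟨c0, C + 1, G.c0pos, by linarith, hlow, fun y => ?_, fun y z => ?_, fun ε hε => ?_⟩
  · have := hup y
    have h2 : (0 : ℝ) ≤ l1 y := by positivity
    linarith
  · have := hlipL y z
    have h2 : (0 : ℝ) ≤ l1 (z - y) := by positivity
    linarith
  · -- uniformity
    set ε' := ε / (2 * C + 1) with hε'
    have hε'pos : 0 < ε' := by positivity
    have hcpt : IsCompact {x : Fin d → ℝ | rl1 x = 1} := by
      apply Metric.isCompact_of_isClosed_isBounded
      · exact isClosed_eq (by unfold rl1; fun_prop) continuous_const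
      · refine (Metric.isBounded_closedBall (x := (0 : Fin d → ℝ)) (r := 1)).subset fun x hx => ?_
        rw [mem_closedBall_zero_iff, pi_norm_le_iff_of_nonneg zero_le_one]
        intro i
        rw [Real.norm_eq_abs]
        have hx : rl1 x = 1 := hx
        rw [← hx]
        exact Finset.single_le_sum (f := fun i => |x i|) (fun _ _ => abs_nonneg _)
          (Finset.mem_univ i)
    obtain ⟨t, ht, htc⟩ := hcpt.elim_nhds_subcover (fun z => {x | rl1 (x - z) < ε'})
      (fun z _ => by
        refine IsOpen.mem_nhds (isOpen_lt (by unfold rl1; fun_prop) continuous_const) ?_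
        simp [rl1, hε'pos])
    have hev : ∀ᶠ M : ℝ in atTop, ∀ z ∈ t, |lg φ lam (flr M z) / M - ξ z| < ε' := by
      rw [Filter.eventually_all_finset]
      intro z _
      have := (hξ' z).eventually (Metric.ball_mem_nhds _ hε'pos)
      filter_upwards [this] with M hM
      simpa [Real.dist_eq] using hM
    obtain ⟨M0, hM0⟩ := eventually_atTop.1 hev
    refine ⟨2 * C * d + (|lg φ lam (0 : Pt d)| + 2 * C * |M0|), fun y => ?_⟩
    have hl0 : (0 : ℝ) ≤ l1 y := by positivity
    have hd0 : (0 : ℝ) ≤ d := by positivity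
    rcases lt_or_ge (l1 y : ℝ) M0 with hlt | hge
    · have h1 := hC 0 y
      have h2 := hC y 0
      rw [l1_sub_comm] at h2
      rw [sub_zero] at h1 h2
      have h3 := hup y
      have h4 := hlow y
      have h5 : 0 ≤ c0 * l1 y := mul_nonneg G.c0pos.le hl0
      have h6 := le_abs_self (lg φ lam (0 : Pt d))
      have h7 := neg_abs_le (lg φ lam (0 : Pt d))
      have h8 : C * l1 y ≤ C * |M0| := by
        gcongr; exact hlt.le.trans (le_abs_self _)
      have h9 : 0 ≤ ε * l1 y := by positivity
      have h10 : 0 ≤ 2 * C * d := by positivity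
      rw [abs_le]
      constructor <;> linarith
    · rcases Nat.eq_zero_or_pos (l1 y) with hz | hpos
      · have : y = 0 := l1_eq_zero.1 hz
        subst this
        rw [h00]
        simp only [sub_zero, l1_zero]
        have h10 : 0 ≤ 2 * C * d := by positivity
        have h11 : 0 ≤ 2 * C * |M0| := by positivity
        push_cast
        linarith
      · obtain ⟨M, hMdef⟩ : ∃ M : ℝ, M = (l1 y : ℝ) := ⟨_, rfl⟩
        rw [← hMdef] at hge ⊢
        have hMpos : 0 < M := by rw [hMdef]; exact_mod_cast hpos
        set x := M⁻¹ • ctR y with hx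
        have hx1 : rl1 x = 1 := by
          have : rl1 x = M⁻¹ * rl1 (ctR y) := by
            rw [hx, rl1, rl1, Finset.mul_sum]
            refine Finset.sum_congr rfl fun i _ => ?_
            rw [Pi.smul_apply, smul_eq_mul, abs_mul, abs_of_pos (inv_pos.2 hMpos)]
          rw [this, rl1_ctR, ← hMdef, inv_mul_cancel₀ hMpos.ne']
        obtain ⟨z, hz⟩ := Set.mem_iUnion.1 (htc hx1)
        obtain ⟨hzt, hzx⟩ := Set.mem_iUnion.1 hz
        have hzx : rl1 (x - z) < ε' := hzx
        have hzx' : rl1 (z - x) < ε' := by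
          have : rl1 (z - x) = rl1 (x - z) := by
            simp only [rl1, Pi.sub_apply]
            exact Finset.sum_congr rfl fun i _ => abs_sub_comm _ _
          rwa [this]
        have hfl : flr M x = y := flr_div M hMpos.ne' y
        have hXy : ξ (ctR y) = M * ξ x := by
          rw [← hhom M x hMpos, hx, smul_inv_smul₀ hMpos.ne']
        have a1 := hC (flr M z) (flr M x)
        have a2 := hC (flr M x) (flr M z)
        have a3 := l1_flr_sub M hMpos.le x z
        have a4 := l1_flr_sub M hMpos.le z x
        have a5 := hM0 M hge z hzt
        have a6 := hlip x z
        have a7 := hlip z x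
        rw [hfl] at a1 a2 a3 a4
        have a8 : |lg φ lam (flr M z) - M * ξ z| ≤ M * ε' := by
          have : lg φ lam (flr M z) - M * ξ z = M * (lg φ lam (flr M z) / M - ξ z) := by
            field_simp
          rw [this, abs_mul, abs_of_pos hMpos]
          gcongr
        have b1 : C * l1 (y - flr M z) ≤ C * (M * ε' + d) := by
          gcongr; refine a3.trans ?_; gcongr
        have b2 : C * l1 (flr M z - y) ≤ C * (M * ε' + d) := by
          gcongr; refine a4.trans ?_; gcongr
        have b3 : M * ξ x ≤ M * (ξ z + C * ε') := by
          gcongr; refine a6.trans ?_; gcongr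
        have b4 : M * ξ z ≤ M * (ξ x + C * ε') := by
          gcongr; refine a7.trans ?_; gcongr
        have b5 : ε * M = (2 * C + 1) * ε' * M := by rw [hε']; field_simp
        have h11 : 0 ≤ |lg φ lam (0 : Pt d)| + 2 * C * |M0| := by positivity
        have h12 : 0 ≤ C * d := by positivity
        rw [hXy, b5]
        have a9 := abs_le.1 a8
        rw [abs_le]
        constructor <;> nlinarith [a9.1, a9.2]

/-- The linear functional associated with `h`. -/
def hom (h : Fin d → ℝ) : Pt d →+ ℝ where
  toFun y := inr h (ctR y)
  map_zero' := by simp [inr, ctR]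
  map_add' a b := by simp [inr, ctR, mul_add, Finset.sum_add_distrib]

lemma hom_apply (h : Fin d → ℝ) (y : Pt d) : hom h y = inr h (ctR y) := rfl

lemma mem_Kset_of_frontier {ξ : (Fin d → ℝ) → ℝ} {h : Fin d → ℝ} (hh : h ∈ frontier (Kset ξ)) :
    h ∈ Kset ξ := by
  have hc : IsClosed (Kset ξ) := by
    have : Kset ξ = ⋂ x, {h | inr h x ≤ ξ x} := by ext h; simp [Kset]
    rw [this]
    refine isClosed_iInter fun x => isClosed_le ?_ continuous_const
    unfold inr
    fun_prop
  exact hc.frontier_subset hh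

lemma Lyap.abs_le {X : Pt d → ℝ} {c1 C1 : ℝ} (Ly : Lyap d φ lam X c1 C1) {H : Pt d →+ ℝ}
    (hH : ∀ y, H y ≤ X y) (y : Pt d) : |H y| ≤ C1 * l1 y := by
  rw [_root_.abs_le]
  constructor
  · have h1 := (hH (-y)).trans (Ly.upper (-y))
    rw [map_neg, l1_neg] at h1
    linarith
  · exact (hH y).trans (Ly.upper y)

lemma nrm_le_l1 (y : Pt d) : nrm (ctR y) ≤ l1 y := by
  rw [nrm, Real.sqrt_le_left (by positivity), l1_cast]
  have h := Finset.sum_sq_le_sq_sum_of_nonneg (s := Finset.univ) (f := fun i => |(y i : ℝ)|)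
    (fun i _ => abs_nonneg _)
  simpa [ctR] using h

end

end PartD

end SIRW

namespace SIRW

section PartE

variable {d : ℕ}

/-- Concatenation of skeleton blocks. -/
def flat : List (List (Pt d) × List (Pt d)) → List (Pt d)
  | [] => []
  | g :: bs => g.1 ++ (g.2 ++ flat bs)

/-- Displacement of a block. -/
def bdisp (g : List (Pt d) × List (Pt d)) : Pt d := disp g.1 + disp g.2

/-- Admissible blocks. -/
def blockOK (X : Pt d → ℝ) (K C1 : ℝ) (g : List (Pt d) × List (Pt d)) : Prop :=
  g.1 ∈ Hpaths (disp g.1) ∧ IsPath g.2 ∧ K < X (disp g.1) ∧ (∀ i < g.1.length, X (pos g.1 i) ≤ K) ∧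
    X (bdisp g) ≤ K + C1

/-- Skeleton decompositions. -/
def isSkel (X : Pt d → ℝ) (K C1 : ℝ) : List (List (Pt d) × List (Pt d)) → List (Pt d) → Prop
  | [], R => IsPath R ∧ X (disp R) ≤ K
  | g :: bs, R => blockOK X K C1 g ∧
      (∀ i < g.1.length, ∀ j ≤ (flat bs ++ R).length,
        pos g.1 i ≠ bdisp g + pos (flat bs ++ R) j) ∧ isSkel X K C1 bs R

lemma exists_last {P : ℕ → Prop} {n : ℕ} (h : ∃ k ≤ n, P k) :
    ∃ k ≤ n, P k ∧ ∀ j ≤ n, k < j → ¬ P j := by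
  classical
  have hne : ((Finset.range (n + 1)).filter P).Nonempty := by
    obtain ⟨k, hk, hP⟩ := h
    exact ⟨k, by simp [hk, hP]⟩
  have hm := Finset.max'_mem _ hne
  simp only [Finset.mem_filter, Finset.mem_range] at hm
  refine ⟨((Finset.range (n + 1)).filter P).max' hne, by omega, hm.2, fun j hj hlt hP => ?_⟩
  have := Finset.le_max' ((Finset.range (n + 1)).filter P) j
    (Finset.mem_filter.2 ⟨Finset.mem_range.2 (by omega), hP⟩)
  omega

section
variable {φ : ℕ → ℝ≥0∞} {lam : ℝ} {ψ : List (Pt d) → ℝ≥0∞} {c0 : ℝ} {A : ℝ≥0∞}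
  {X : Pt d → ℝ} {c1 C1 : ℝ}

lemma Lyap.zero (Ly : Lyap d φ lam X c1 C1) : X 0 = 0 := by
  have h1 := Ly.lower 0
  have h2 := Ly.upper 0
  simp at h1 h2
  linarith

lemma Lyap.step (Ly : Lyap d φ lam X c1 C1) {γ : List (Pt d)} (hγ : IsPath γ) {k : ℕ}
    (hk : k < γ.length) : X (pos γ (k + 1)) ≤ X (pos γ k) + C1 := by
  obtain ⟨s, hs, he⟩ := pos_succ_step hγ hk
  have := Ly.lip (pos γ k) (pos γ (k + 1))
  rw [he, add_sub_cancel_left, isStep_iff.1 hs] at this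
  rw [he]
  simpa using this

lemma exists_skel (Ly : Lyap d φ lam X c1 C1) {K : ℝ} (hK : 0 ≤ K) (n : ℕ) :
    ∀ γ : List (Pt d), IsPath γ → γ.length ≤ n → ∃ bs R, γ = flat bs ++ R ∧ isSkel X K C1 bs R := by
  induction n with
  | zero =>
    intro γ hγ hn
    have : γ = [] := List.length_eq_zero_iff.1 (by omega)
    subst this
    exact ⟨[], [], rfl, isPath_nil, by rw [disp_nil, Ly.zero]; exact hK⟩
  | succ n ih =>
    intro γ hγ hn
    by_cases hend : X (disp γ) ≤ K
    · exact ⟨[], γ, rfl, hγ, hend⟩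
    push Not at hend
    obtain ⟨s, hs, hsK, hsmin⟩ := exists_first (P := fun k => K < X (pos γ k)) (n := γ.length)
      ⟨γ.length, le_rfl, by rwa [pos_length]⟩
    obtain ⟨t, ht, htK, htmax⟩ := exists_last (P := fun k => X (pos γ k) ≤ K) (n := γ.length)
      ⟨0, Nat.zero_le _, by rw [pos_zero, Ly.zero]; exact hK⟩
    have hs0 : 0 < s := by
      rcases Nat.eq_zero_or_pos s with h | h
      · rw [h, pos_zero, Ly.zero] at hsK; linarith
      · exact h
    have htn : t < γ.length := by
      rcases ht.lt_or_eq with h | h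
      · exact h
      · rw [h, pos_length] at htK; linarith
    have hst : s ≤ t + 1 := by
      by_contra hc
      push Not at hc
      have h1 := hsmin (s - 1) (by omega)
      push Not at h1
      exact htmax (s - 1) (by omega) (by omega) h1
    have hlen : (γ.drop (t + 1)).length ≤ n := by rw [List.length_drop]; omega
    obtain ⟨bs, R, hbs, hsk⟩ := ih _ (hγ.drop (t + 1)) hlen
    have hP1 : (γ.take s).length = s := by rw [List.length_take]; omega
    have e1 : γ.take s ++ (γ.take (t + 1)).drop s = γ.take (t + 1) := by
      conv_rhs => rw [← List.take_append_drop s (γ.take (t + 1))]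
      rw [List.take_take, min_eq_left hst]
    have hbd : bdisp (γ.take s, (γ.take (t + 1)).drop s) = pos γ (t + 1) := by
      rw [bdisp, ← disp_append, e1, disp_take]
    refine ⟨(γ.take s, (γ.take (t + 1)).drop s) :: bs, R, ?_, ?_, ?_, hsk⟩
    · simp only [flat]
      rw [List.append_assoc, List.append_assoc, ← hbs, ← List.append_assoc, e1,
        List.take_append_drop]
    · refine ⟨?_, (hγ.take _).drop _, hsK, ?_, ?_⟩
      · rw [mem_Hpaths]
        refine ⟨hγ.take s, rfl, fun k hk he => ?_⟩
        simp only at hk he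
        rw [hP1] at hk
        rw [pos_take _ hk.le, disp_take] at he
        have := hsmin k hk
        rw [he] at this
        exact this hsK
      · intro i hi
        simp only at hi ⊢
        rw [hP1] at hi
        rw [pos_take _ hi.le]
        have := hsmin i hi
        push Not at this
        exact this
      · rw [hbd]
        have := Ly.step hγ htn
        linarith
    · intro i hi j hj he
      simp only at hi he
      rw [hP1] at hi
      rw [← hbs] at hj he
      rw [List.length_drop] at hj
      rw [pos_take _ hi.le, hbd, ← pos_drop] at he
      have h1 := hsmin i hi
      have h2 := htmax (t + 1 + j) (by omega) (by omega)
      rw [he] at h1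
      push Not at h1
      exact h2 h1

lemma pre_concat (γ : List (Pt d)) (e : Pt d) : pre (γ ++ [e]) = locTime γ := by
  funext x
  rw [pre_append, loc_eq_pre]
  congr 1
  simp only [pre, List.length_singleton, Finset.range_one, Finset.filter_singleton, pos_zero]
  by_cases hx : disp γ = x
  · simp [hx]
  · rw [if_neg, if_neg hx]; · simp
    intro h0; exact hx (sub_eq_zero.1 h0.symm).symm

lemma Good.pre_dec (G : Good d φ lam ψ c0 A) (f : Pt d → ℕ) (h : List (Pt d)) (a : Pt d) :
    expNegE (Phi φ (fun x => f x + pre h (x - a))) ≤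
      expNegE (Phi φ f) * (E1 φ * ψ h.dropLast) := by
  rcases List.eq_nil_or_concat h with rfl | ⟨h', e, rfl⟩ <;> try rw [List.concat_eq_append]
  · have : (fun x => f x + pre ([] : List (Pt d)) (x - a)) = f := by
      funext x; simp [pre]
    rw [this]
    calc expNegE (Phi φ f) = expNegE (Phi φ f) * 1 := (mul_one _).symm
      _ ≤ _ := by gcongr; exact G.psi_nil
  · rw [pre_concat, List.dropLast_concat]
    refine (G.dec f h' a).trans ?_
    gcongr
    calc ψ h' = 1 * ψ h' := (one_mul _).symm
      _ ≤ _ := by gcongr; exact one_le_E1 φ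

/-- Block weight. -/
def bw (φ : ℕ → ℝ≥0∞) (lam : ℝ) (ψ : List (Pt d) → ℝ≥0∞)
    (g : List (Pt d) × List (Pt d)) : ℝ≥0∞ :=
  wE φ lam g.1 * (E1 φ * E1 φ * (ψ g.2.dropLast * eL lam g.2.length))

lemma skel_weight (G : Good d φ lam ψ c0 A) {K : ℝ} (bs : List (List (Pt d) × List (Pt d)))
    (R : List (Pt d)) (h : isSkel X K C1 bs R) :
    wE φ lam (flat bs ++ R) ≤ (bs.map (bw φ lam ψ)).prod * (ψ R * eL lam R.length) := by
  induction bs with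
  | nil => simpa [flat] using G.wE_le R
  | cons g bs ih =>
    obtain ⟨h1, h2, h3⟩ := h
    have ih := ih h3
    set rest := flat bs ++ R with hrest
    have e0 : flat (g :: bs) ++ R = g.1 ++ (g.2 ++ rest) := by
      simp [flat, hrest]
    have e1 : locTime (g.1 ++ (g.2 ++ rest)) = fun x =>
        (pre g.1 x + locTime rest (x - bdisp g)) + pre g.2 (x - disp g.1) := by
      funext x
      rw [loc_append, loc_append, bdisp, sub_sub]
      ring
    rw [e0, wE_eq G.h0, e1, List.map_cons, List.prod_cons, List.length_append, List.length_append,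
      eL_add, eL_add]
    have e2 : expNegE (Phi φ (fun x => pre g.1 x + locTime rest (x - bdisp g))) =
        E1 φ * expNegE (Phi φ (locTime g.1)) * expNegE (Phi φ (locTime rest)) := by
      rw [Phi_disj G.h0, expNegE_add, G.pre_H' h1.1, Phi_shift φ (locTime rest)]
      intro x
      by_contra hc
      push Not at hc
      obtain ⟨i, hi, hi'⟩ := (pre_pos_iff g.1 x).1 (by omega)
      obtain ⟨j, hj, hj'⟩ := (loc_pos_iff rest (x - bdisp g)).1 (by omega)
      apply h2 i hi j hj
      rw [hi', hj']; abel
    calc _ ≤ expNegE (Phi φ (fun x => pre g.1 x + locTime rest (x - bdisp g))) *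
          (E1 φ * ψ g.2.dropLast) * (eL lam g.1.length * (eL lam g.2.length * eL lam rest.length)) := by
          gcongr
          exact G.pre_dec _ _ _
      _ = bw φ lam ψ g * wE φ lam rest := by
          rw [e2, bw, wE_eq G.h0, wE_eq G.h0]; ring
      _ ≤ bw φ lam ψ g * ((bs.map (bw φ lam ψ)).prod * (ψ R * eL lam R.length)) := by gcongr
      _ = _ := by ring

/-- Cost of a block. -/
def cost (H : Pt d →+ ℝ) (K C1 : ℝ) (g : List (Pt d) × List (Pt d)) : ℝ :=
  K + C1 - H (bdisp g) + g.2.length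

open scoped Classical in
/-- Tilted block weight. -/
def tw (φ : ℕ → ℝ≥0∞) (lam : ℝ) (ψ : List (Pt d) → ℝ≥0∞) (X : Pt d → ℝ) (H : Pt d →+ ℝ)
    (K C1 a s : ℝ) (g : List (Pt d) × List (Pt d)) : ℝ≥0∞ :=
  if blockOK X K C1 g then
    bw φ lam ψ g * ENNReal.ofReal (Real.exp (H (bdisp g) + a * cost H K C1 g - s)) else 0

lemma psi_nil_le (G : Good d φ lam ψ c0 A) : ψ [] ≤ A := by
  refine le_trans ?_ G.sum
  refine le_trans ?_ (ENNReal.le_tsum ([] : List (Pt d)))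
  rw [pw_of isPath_nil]
  simp [eL_zero]

lemma sum_psi (G : Good d φ lam ψ c0 A) {a : ℝ} (ha : a ≤ c0) :
    ∑' η, pw η * (ψ η * eL (lam - a) η.length) ≤ A := by
  refine le_trans (ENNReal.tsum_le_tsum fun η => ?_) G.sum
  gcongr
  exact eL_mono (by linarith) _

lemma eL_exp (l a : ℝ) (n : ℕ) : eL l n * ENNReal.ofReal (Real.exp (a * n)) = eL (l - a) n := by
  rw [eL, eL, ← ENNReal.ofReal_mul (Real.exp_nonneg _), ← Real.exp_add]
  congr 2; ring

lemma sum_hair (G : Good d φ lam ψ c0 A) {a : ℝ} (ha : a ≤ c0) :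
    ∑' h, pw h * (ψ h.dropLast * eL (lam - a) h.length) ≤
      A + (stepsF d).card * eL (lam - a) 1 * A := by
  classical
  have h1 : ∀ h : List (Pt d), pw h * (ψ h.dropLast * eL (lam - a) h.length) ≤
      (if h = [] then A else 0) + ∑ e ∈ stepsF d, ∑' η : List (Pt d),
        if h = η ++ [e] then pw η * (ψ η * eL (lam - a) η.length) * eL (lam - a) 1 else 0 := by
    intro h
    rcases List.eq_nil_or_concat h with rfl | ⟨h', e, rfl⟩ <;> try rw [List.concat_eq_append]
    · refine le_trans ?_ le_self_add
      rw [pw_of isPath_nil]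
      simpa [eL_zero] using psi_nil_le G
    · refine le_trans ?_ le_add_self
      by_cases hp : IsPath (h' ++ [e])
      · obtain ⟨hp1, hp2⟩ := isPath_append.1 hp
        have he : e ∈ stepsF d := mem_stepsF.2 (hp2 e (by simp))
        refine le_trans ?_ (Finset.single_le_sum (f := fun e' => ∑' η : List (Pt d),
          if h' ++ [e] = η ++ [e'] then pw η * (ψ η * eL (lam - a) η.length) * eL (lam - a) 1
          else 0) (fun _ _ => bot_le) he)
        refine le_trans ?_ (ENNReal.le_tsum h')
        rw [if_pos rfl, pw_of hp, pw_of hp1, List.dropLast_concat, List.length_append, eL_add]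
        apply le_of_eq
        simp only [List.length_singleton]; ring
      · simp [pw, hp]
  refine (ENNReal.tsum_le_tsum h1).trans ?_
  rw [ENNReal.tsum_add]
  gcongr
  · rw [tsum_eq_single []]
    · simp
    · intro b hb; simp [hb]
  · rw [Summable.tsum_finsetSum fun _ _ => ENNReal.summable]
    calc _ ≤ ∑ e ∈ stepsF d, eL (lam - a) 1 * A := by
          refine Finset.sum_le_sum fun e _ => ?_
          rw [ENNReal.tsum_comm]
          calc _ = ∑' η : List (Pt d), pw η * (ψ η * eL (lam - a) η.length) * eL (lam - a) 1 := by
                refine tsum_congr fun η => ?_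
                rw [tsum_eq_single (η ++ [e])]
                · simp
                · intro b hb; simp [hb]
            _ = (∑' η : List (Pt d), pw η * (ψ η * eL (lam - a) η.length)) * eL (lam - a) 1 :=
                ENNReal.tsum_mul_right
            _ ≤ A * eL (lam - a) 1 := by gcongr; exact sum_psi G ha
            _ = _ := mul_comm _ _
      _ = _ := by rw [Finset.sum_const, nsmul_eq_mul, mul_assoc]

end

end PartE

end SIRW

namespace SIRW

section PartE2

variable {d : ℕ} {φ : ℕ → ℝ≥0∞} {lam : ℝ} {ψ : List (Pt d) → ℝ≥0∞} {c0 : ℝ} {A : ℝ≥0∞}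
  {X : Pt d → ℝ} {c1 C1 : ℝ}

lemma exp_small (Q s : ℝ) (hs : 0 < s) : ∃ K0 : ℝ, ∀ K ≥ K0, Q * Real.exp (-(s * K)) ≤ 1 / 2 := by
  have h : Tendsto (fun K : ℝ => Q * Real.exp (-(s * K))) atTop (𝓝 (Q * 0)) :=
    (Real.tendsto_exp_neg_atTop_nhds_zero.comp (tendsto_id.const_mul_atTop hs)).const_mul Q
  rw [mul_zero] at h
  exact eventually_atTop.1 (h.eventually (ge_mem_nhds (by norm_num)))

lemma pow_le_exp (d : ℕ) (τ : ℝ) (hτ : 0 < τ) (x : ℝ) (hx : 0 ≤ x) :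
    x ^ d ≤ (d.factorial / τ ^ d) * Real.exp (τ * x) := by
  have h := Real.pow_div_factorial_le_exp (τ * x) (by positivity) d
  have hf : (0 : ℝ) < d.factorial := by positivity
  rw [div_le_iff₀ hf, mul_pow] at h
  rw [div_mul_eq_mul_div, le_div_iff₀ (by positivity)]
  linarith

lemma block_sphere (Ly : Lyap d φ lam X c1 C1) {K : ℝ} (hK : 0 ≤ K)
    {g : List (Pt d) × List (Pt d)} (hg : blockOK X K C1 g) : X (disp g.1) ≤ K + C1 := by
  obtain ⟨h1, h2, h3, h4, h5⟩ := hg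
  rcases Nat.eq_zero_or_pos g.1.length with h | h
  · rw [List.length_eq_zero_iff.1 h, disp_nil, Ly.zero] at h3
    linarith
  · have := Ly.step h1.1 (k := g.1.length - 1) (by omega)
    rw [Nat.sub_add_cancel h, pos_length] at this
    have := h4 (g.1.length - 1) (by omega)
    linarith

lemma chern (G : Good d φ lam ψ c0 A) (Ly : Lyap d φ lam X c1 C1) {a s1 : ℝ}
    (ha1 : a ≤ 1) (hac : a ≤ c0) (hs : 0 < s1) :
    ∃ K0 : ℝ, ∀ K ≥ K0, ∀ H : Pt d →+ ℝ, (∀ y, H y ≤ X y) →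
      ∑' g, tw φ lam ψ X H K C1 a (s1 * K) g ≤ 1 / 2 := by
  classical
  have hc1 := Ly.c1pos
  obtain ⟨B, hB⟩ := Ly.unif (s1 * c1 / 2) (by positivity)
  set A2 := A + (stepsF d).card * eL (lam - a) 1 * A with hA2
  have hA2t : A2 ≠ ⊤ := ENNReal.add_ne_top.2 ⟨G.Atop, ENNReal.mul_ne_top
    (ENNReal.mul_ne_top (by simp) (eL_ne_top _ _)) G.Atop⟩
  set Q := E1 φ * E1 φ * A2 with hQ
  have hQt : Q ≠ ⊤ := ENNReal.mul_ne_top (ENNReal.mul_ne_top G.E1_ne_top G.E1_ne_top) hA2t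
  set τ := s1 * c1 / 8 with hτ
  have hτpos : 0 < τ := by positivity
  set const := (d.factorial / τ ^ d) * Real.exp (τ * (2 * (C1 / c1 + 1) + 1) +
    (s1 * c1 / 2 * (C1 / c1 + 1) + B + C1)) * Q.toReal with hconst
  obtain ⟨K0, hK0⟩ := exp_small const (s1 / 4) (by positivity)
  refine ⟨max K0 0, fun K hK H hH => ?_⟩
  have hKK := hK0 K ((le_max_left _ _).trans hK)
  have hKpos : 0 ≤ K := (le_max_right _ _).trans hK
  have hC1 := Ly.C1one
  set r := ⌈(K + C1) / c1⌉₊ with hr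
  have hr1 : (r : ℝ) ≤ (K + C1) / c1 + 1 := (Nat.ceil_lt_add_one (by positivity)).le
  set Sph := (boxF d r).filter (fun p => K < X p ∧ l1 p ≤ r) with hSph
  set V : List (Pt d) → ℝ≥0∞ := fun P => ∑ p ∈ Sph, wH φ lam p P with hV
  set U : List (Pt d) → ℝ≥0∞ := fun h => ENNReal.ofReal (Real.exp (K + C1 - s1 * K)) *
    (E1 φ * E1 φ * (pw h * (ψ h.dropLast * eL (lam - a) h.length))) with hU
  have hpt : ∀ g, tw φ lam ψ X H K C1 a (s1 * K) g ≤ V g.1 * U g.2 := by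
    intro g
    by_cases hg : blockOK X K C1 g
    · rw [tw, if_pos hg]
      have hX := block_sphere Ly hKpos hg
      have hl : l1 (disp g.1) ≤ r := by
        have := Ly.lower (disp g.1)
        have h3 : (l1 (disp g.1) : ℝ) ≤ (K + C1) / c1 := by
          rw [le_div_iff₀ hc1]; linarith
        exact_mod_cast h3.trans (Nat.le_ceil _)
      have hmem : disp g.1 ∈ Sph :=
        Finset.mem_filter.2 ⟨mem_boxF_of hl, hg.2.2.1, hl⟩
      have hV1 : wE φ lam g.1 ≤ V g.1 := by
        rw [hV, ← wH_of hg.1]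
        exact Finset.single_le_sum (f := fun p => wH φ lam p g.1) (fun _ _ => bot_le) hmem
      have hHy : H (bdisp g) ≤ K + C1 := (hH _).trans hg.2.2.2.2
      have hexp : H (bdisp g) + a * cost H K C1 g - s1 * K ≤
          (K + C1 - s1 * K) + a * g.2.length := by
        rw [cost]
        nlinarith
      simp only [hU]
      rw [pw_of hg.2.1, one_mul, bw]
      calc _ ≤ V g.1 * (E1 φ * E1 φ * (ψ g.2.dropLast * eL lam g.2.length)) *
            ENNReal.ofReal (Real.exp ((K + C1 - s1 * K) + a * g.2.length)) := by gcongr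
        _ = V g.1 * (E1 φ * E1 φ * (ψ g.2.dropLast * (eL lam g.2.length *
            ENNReal.ofReal (Real.exp (a * g.2.length)))) *
              ENNReal.ofReal (Real.exp (K + C1 - s1 * K))) := by
            rw [Real.exp_add, ENNReal.ofReal_mul (Real.exp_nonneg _)]; ring
        _ = _ := by rw [eL_exp]; ring
    · rw [tw, if_neg hg]; exact bot_le
  refine (ENNReal.tsum_le_tsum hpt).trans ?_
  rw [tsum_prod_mul V U]
  have hVs : ∑' P, V P ≤ ((2 * r + 1) ^ d : ℕ) *
      ENNReal.ofReal (Real.exp (-K + s1 * c1 / 2 * r + B)) := by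
    rw [hV, Summable.tsum_finsetSum fun _ _ => ENNReal.summable]
    calc _ ≤ ∑ p ∈ Sph, ENNReal.ofReal (Real.exp (-K + s1 * c1 / 2 * r + B)) := by
          refine Finset.sum_le_sum fun p hp => ?_
          obtain ⟨_, hp1, hp2⟩ := Finset.mem_filter.1 hp
          rw [← HEf_eq, G.HEf_eq_exp]
          apply ENNReal.ofReal_le_ofReal
          apply Real.exp_le_exp.2
          have h1 := (abs_le.1 (hB p)).1
          have h2 : s1 * c1 / 2 * l1 p ≤ s1 * c1 / 2 * r := by gcongr
          linarith
      _ = (Sph.card : ℝ≥0∞) * ENNReal.ofReal (Real.exp (-K + s1 * c1 / 2 * r + B)) := by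
          rw [Finset.sum_const, nsmul_eq_mul]
      _ ≤ _ := by
          gcongr
          rw [← card_boxF]
          exact Finset.card_filter_le _ _
  have hUs : ∑' h, U h ≤ ENNReal.ofReal (Real.exp (K + C1 - s1 * K)) * Q := by
    rw [hU, ENNReal.tsum_mul_left, ENNReal.tsum_mul_left, hQ]
    gcongr
    exact sum_hair G hac
  refine (mul_le_mul' hVs hUs).trans ?_
  have e1 : (((2 * r + 1) ^ d : ℕ) : ℝ≥0∞) = ENNReal.ofReal ((2 * (r : ℝ) + 1) ^ d) := by
    rw [← ENNReal.ofReal_natCast]; push_cast; rfl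
  rw [e1, ← ENNReal.ofReal_toReal hQt, ← ENNReal.ofReal_mul (by positivity),
    ← ENNReal.ofReal_mul (by positivity), ← ENNReal.ofReal_mul (by positivity)]
  have e2 : (1 / 2 : ℝ≥0∞) = ENNReal.ofReal (1 / 2) := by
    rw [ENNReal.ofReal_div_of_pos (by norm_num)]; simp
  rw [e2]
  apply ENNReal.ofReal_le_ofReal
  refine le_trans ?_ hKK
  have h1 := pow_le_exp d τ hτpos (2 * (r : ℝ) + 1) (by positivity)
  calc (2 * (r : ℝ) + 1) ^ d * Real.exp (-K + s1 * c1 / 2 * r + B) *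
        (Real.exp (K + C1 - s1 * K) * Q.toReal)
      ≤ (d.factorial / τ ^ d) * Real.exp (τ * (2 * r + 1)) *
        Real.exp (-K + s1 * c1 / 2 * r + B) * (Real.exp (K + C1 - s1 * K) * Q.toReal) := by
        gcongr
    _ = (d.factorial / τ ^ d) * Real.exp (τ * (2 * r + 1) + (-K + s1 * c1 / 2 * r + B) +
        (K + C1 - s1 * K)) * Q.toReal := by
        rw [Real.exp_add (τ * (2 * r + 1) + (-K + s1 * c1 / 2 * r + B)),
          Real.exp_add (τ * (2 * r + 1))]; ring
    _ ≤ (d.factorial / τ ^ d) * Real.exp ((τ * (2 * (C1 / c1 + 1) + 1) +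
    (s1 * c1 / 2 * (C1 / c1 + 1) + B + C1)) + -(s1 / 4 * K)) * Q.toReal := by
        refine mul_le_mul_of_nonneg_right (mul_le_mul_of_nonneg_left (Real.exp_le_exp.2 ?_)
          (by positivity)) ENNReal.toReal_nonneg
        have h2 : τ * (2 * r + 1) ≤ τ * (2 * ((K + C1) / c1 + 1) + 1) := by gcongr
        have h3 : s1 * c1 / 2 * r ≤ s1 * c1 / 2 * ((K + C1) / c1 + 1) := by gcongr
        have h4 : τ * (2 * ((K + C1) / c1 + 1) + 1) = τ * (2 * (C1 / c1 + 1) + 1) + s1 / 4 * K := by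
          rw [hτ]; field_simp; ring
        have h5 : s1 * c1 / 2 * ((K + C1) / c1 + 1) = s1 * c1 / 2 * (C1 / c1 + 1) + s1 / 2 * K := by
          field_simp; ring
        linarith
    _ = const * Real.exp (-(s1 / 4 * K)) := by rw [hconst, Real.exp_add]; ring

lemma isSkel_block {K : ℝ} {bs : List (List (Pt d) × List (Pt d))}
    {R : List (Pt d)} (h : isSkel X K C1 bs R) : ∀ g ∈ bs, blockOK X K C1 g := by
  induction bs with
  | nil => simp
  | cons g bs ih =>
    intro g' hg'
    rcases List.mem_cons.1 hg' with rfl | h'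
    · exact h.1
    · exact ih h.2.2 g' h'

lemma isSkel_R {K : ℝ} {bs : List (List (Pt d) × List (Pt d))}
    {R : List (Pt d)} (h : isSkel X K C1 bs R) : IsPath R ∧ X (disp R) ≤ K := by
  induction bs with
  | nil => exact h
  | cons g bs ih => exact ih h.2.2

lemma disp_flat (bs : List (List (Pt d) × List (Pt d))) :
    disp (flat bs) = (bs.map bdisp).sum := by
  induction bs with
  | nil => simp [flat]
  | cons g bs ih =>
    rw [flat, disp_append, disp_append, ih, List.map_cons, List.sum_cons, bdisp, add_assoc]

/-- total cost -/
def tcost (H : Pt d →+ ℝ) (K C1 : ℝ) (bs : List (List (Pt d) × List (Pt d))) : ℝ :=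
  (bs.map (cost H K C1)).sum

lemma tw_prod (H : Pt d →+ ℝ) (K a s : ℝ) (bs : List (List (Pt d) × List (Pt d)))
    (h : ∀ g ∈ bs, blockOK X K C1 g) :
    (bs.map (tw φ lam ψ X H K C1 a s)).prod = (bs.map (bw φ lam ψ)).prod *
      ENNReal.ofReal (Real.exp (H (disp (flat bs)) + a * tcost H K C1 bs - s * bs.length)) := by
  induction bs with
  | nil => simp [flat, tcost]
  | cons g bs ih =>
    have ih := ih fun g' hg' => h g' (List.mem_cons_of_mem _ hg')
    have h1 := h g List.mem_cons_self
    simp only [List.map_cons, List.prod_cons, ih, List.length_cons]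
    rw [show tcost H K C1 (g :: bs) = cost H K C1 g + (bs.map (cost H K C1)).sum from by
      rw [tcost, List.map_cons, List.sum_cons]]
    rw [tw, if_pos h1]
    have e : H (disp (flat (g :: bs))) + a * (cost H K C1 g + (bs.map (cost H K C1)).sum) -
        s * ((bs.length + 1 : ℕ) : ℝ) = (H (bdisp g) + a * cost H K C1 g - s) +
        (H (disp (flat bs)) + a * tcost H K C1 bs - s * bs.length) := by
      rw [disp_flat, disp_flat, List.map_cons, List.sum_cons, map_add, tcost]; push_cast; ring
    rw [e, Real.exp_add, ENNReal.ofReal_mul (Real.exp_nonneg _)]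
    ring

lemma H_flat_le {K : ℝ} (H : Pt d →+ ℝ) (hH : ∀ y, H y ≤ X y)
    (bs : List (List (Pt d) × List (Pt d))) (h : ∀ g ∈ bs, blockOK X K C1 g) :
    H (disp (flat bs)) ≤ bs.length * (K + C1) := by
  induction bs with
  | nil => simp [flat]
  | cons g bs ih =>
    have ih := ih fun g' hg' => h g' (List.mem_cons_of_mem _ hg')
    have h1 := (hH _).trans (h g List.mem_cons_self).2.2.2.2
    rw [disp_flat, List.map_cons, List.sum_cons, map_add, ← disp_flat, List.length_cons]
    push_cast
    linarith

lemma skel_bound (G : Good d φ lam ψ c0 A) (Ly : Lyap d φ lam X c1 C1) {ν0 : ℝ} (hν : 0 < ν0) :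
    ∃ ρ : ℝ, 0 < ρ ∧ ∃ K0 : ℝ, ∀ K ≥ K0, ∃ C : ℝ, 0 < C ∧ ∀ (H : Pt d →+ ℝ) (x : Pt d),
      (∀ y, H y ≤ X y) → H x = X x → ∀ S : Set (List (Pt d)), S ⊆ Hpaths x →
      (∀ γ ∈ S, ∀ bs R, γ = flat bs ++ R → isSkel X K C1 bs R →
        ν0 * K * bs.length ≤ tcost H K C1 bs + R.length) →
      ∑' γ : S, wE φ lam (γ : List (Pt d)) ≤
        ENNReal.ofReal (C * Real.exp (-(ρ * l1 x))) * HEf φ lam x := by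
  classical
  have hc1 := Ly.c1pos
  have hC1 := Ly.C1one
  set a := min 1 c0 with ha
  have hapos : 0 < a := lt_min one_pos G.c0pos
  set s1 := a * ν0 / 2 with hs1
  have hs1pos : 0 < s1 := by positivity
  obtain ⟨K1, hK1⟩ := chern G Ly (min_le_left 1 c0) (min_le_right 1 c0) hs1pos
  obtain ⟨B, hB⟩ := Ly.unif (s1 * c1 / 4) (by positivity)
  refine ⟨s1 * c1 / 4, by positivity, max K1 C1, fun K hK => ?_⟩
  have hKK1 : K1 ≤ K := (le_max_left _ _).trans hK
  have hKC : C1 ≤ K := (le_max_right _ _).trans hK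
  have hKpos : 0 < K := by linarith
  refine ⟨Real.exp (K + s1 * K / 2 + B) * 2 * (A.toReal + 1), by positivity,
    fun H x hH hx S hS hbad => ?_⟩
  have hex : ∀ γ : List (Pt d), ∃ p : List (List (Pt d) × List (Pt d)) × List (Pt d),
      γ ∈ S → γ = flat p.1 ++ p.2 ∧ isSkel X K C1 p.1 p.2 := by
    intro γ
    by_cases h : γ ∈ S
    · obtain ⟨bs, R, h1, h2⟩ := exists_skel Ly hKpos.le _ γ (hS h).1 le_rfl
      exact ⟨(bs, R), fun _ => ⟨h1, h2⟩⟩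
    · exact ⟨([], []), fun h' => absurd h' h⟩
  choose sk hsk using hex
  set pref := Real.exp (K - X x - s1 * ((X x - K) / 2)) with hpref
  have hmain : ∑' γ : S, wE φ lam (γ : List (Pt d)) ≤
      ∑' p : List (List (Pt d) × List (Pt d)) × List (Pt d), (ENNReal.ofReal pref *
        (p.1.map (tw φ lam ψ X H K C1 a (s1 * K))).prod) *
        (pw p.2 * (ψ p.2 * eL (lam - a) p.2.length)) := by
    refine tsum_le_of_injOn S _ sk (fun γ hγ γ' hγ' h => ?_) _ fun γ hγ => ?_
    · rw [(hsk γ hγ).1, (hsk γ' hγ').1, h]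
    · obtain ⟨h1, h2⟩ := hsk γ hγ
      have h3 := hbad γ hγ _ _ h1 h2
      set bs := (sk γ).1
      set R := (sk γ).2
      have h4 := isSkel_block h2
      obtain ⟨hR1, hR2⟩ := isSkel_R h2
      have h5 := skel_weight G bs R h2
      rw [tw_prod H K a (s1 * K) bs h4, pw_of hR1, one_mul, ← eL_exp]
      conv_lhs => rw [h1]
      refine h5.trans ?_
      have h6 := H_flat_le H hH bs h4
      have h7 : H (disp (flat bs)) + H (disp R) = X x := by
        rw [← map_add, ← disp_append, ← h1, (hS hγ).2.1, hx]
      have h8 := (hH (disp R)).trans hR2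
      have hKN : (X x - K) / 2 ≤ K * bs.length := by
        have hb : (0 : ℝ) ≤ bs.length := by positivity
        nlinarith
      have hone : 1 ≤ ENNReal.ofReal pref * ENNReal.ofReal (Real.exp
          (H (disp (flat bs)) + a * tcost H K C1 bs - s1 * K * bs.length)) *
          ENNReal.ofReal (Real.exp (a * R.length)) := by
        rw [hpref, ← ENNReal.ofReal_mul (Real.exp_nonneg _), ← Real.exp_add,
          ← ENNReal.ofReal_mul (Real.exp_nonneg _), ← Real.exp_add, ENNReal.one_le_ofReal]
        apply Real.one_le_exp
        have h9 : a * (ν0 * K * bs.length) ≤ a * (tcost H K C1 bs + R.length) := by gcongr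
        have h10 : a * (ν0 * K * bs.length) = 2 * (s1 * (K * bs.length)) := by rw [hs1]; ring
        have h11 : s1 * ((X x - K) / 2) ≤ s1 * (K * bs.length) := by gcongr
        nlinarith
      calc _ = (bs.map (bw φ lam ψ)).prod * (ψ R * eL lam R.length) * 1 := (mul_one _).symm
        _ ≤ (bs.map (bw φ lam ψ)).prod * (ψ R * eL lam R.length) *
            (ENNReal.ofReal pref * ENNReal.ofReal (Real.exp
          (H (disp (flat bs)) + a * tcost H K C1 bs - s1 * K * bs.length)) *
          ENNReal.ofReal (Real.exp (a * R.length))) := mul_le_mul_right hone _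
        _ = _ := by ring
  refine hmain.trans ?_
  rw [tsum_prod_mul (fun bs : List (List (Pt d) × List (Pt d)) => ENNReal.ofReal pref *
    (bs.map (tw φ lam ψ X H K C1 a (s1 * K))).prod)
    (fun R : List (Pt d) => pw R * (ψ R * eL (lam - a) R.length)), ENNReal.tsum_mul_left]
  have hL : ∑' bs : List (List (Pt d) × List (Pt d)),
      (bs.map (tw φ lam ψ X H K C1 a (s1 * K))).prod ≤ 2 := by
    apply tsum_list_prod_le
    calc 1 + (∑' g, tw φ lam ψ X H K C1 a (s1 * K) g) * 2 ≤ 1 + 1 / 2 * 2 := by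
          gcongr; exact hK1 K hKK1 H hH
      _ = 2 := by
          rw [ENNReal.div_mul_cancel (by simp) (by simp)]; norm_num
  have hA' : A ≤ ENNReal.ofReal (A.toReal + 1) := by
    conv_lhs => rw [← ENNReal.ofReal_toReal G.Atop]
    apply ENNReal.ofReal_le_ofReal; linarith
  calc _ ≤ ENNReal.ofReal pref * 2 * ENNReal.ofReal (A.toReal + 1) := by
        gcongr
        exact (sum_psi G (min_le_right 1 c0)).trans hA'
    _ = ENNReal.ofReal (pref * 2 * (A.toReal + 1)) := by
        rw [ENNReal.ofReal_mul (by positivity), ENNReal.ofReal_mul (by positivity)]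
        simp
    _ ≤ _ := by
        rw [G.HEf_eq_exp, ← ENNReal.ofReal_mul (by positivity)]
        apply ENNReal.ofReal_le_ofReal
        have e1 : Real.exp (K + s1 * K / 2 + B) * 2 * (A.toReal + 1) *
            Real.exp (-(s1 * c1 / 4 * l1 x)) * Real.exp (-lg φ lam x) =
            Real.exp ((K + s1 * K / 2 + B) + -(s1 * c1 / 4 * l1 x) + -lg φ lam x) * 2 *
              (A.toReal + 1) := by
          rw [Real.exp_add ((K + s1 * K / 2 + B) + -(s1 * c1 / 4 * l1 x)),
            Real.exp_add (K + s1 * K / 2 + B)]; ring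
        rw [e1, hpref]
        gcongr
        have h1 := (abs_le.1 (hB x)).2
        have h2 := Ly.lower x
        have h3 : s1 / 2 * (c1 * l1 x) ≤ s1 / 2 * X x := by gcongr
        linarith

end PartE2

end SIRW

namespace SIRW

section PartF

/-- forward bad indices -/
def fbad (f : ℕ → ℝ) (t : ℝ) (N i : ℕ) : Prop :=
  ∃ j, i < j ∧ j ≤ N ∧ t * ((j : ℝ) - i) < ∑ k ∈ Finset.Ico i j, f k

/-- backward bad indices -/
def bbad (f : ℕ → ℝ) (t : ℝ) (i : ℕ) : Prop :=
  ∃ l, l < i ∧ t * ((i : ℝ) - l) < ∑ k ∈ Finset.Ico l i, f k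

open scoped Classical in
lemma bbad_card (f : ℕ → ℝ) (t : ℝ) (ht : 0 ≤ t) (hf : ∀ i, 0 ≤ f i) (i : ℕ) :
    t * ((Finset.Ioc 0 i).filter (bbad f t)).card ≤ ∑ k ∈ Finset.range i, f k := by
  induction i using Nat.strong_induction_on with
  | _ i ih =>
    rcases Nat.eq_zero_or_pos i with rfl | hi
    · simp
    by_cases hb : bbad f t i
    · obtain ⟨l, hl, hs⟩ := hb
      have h1 : ((Finset.Ioc 0 i).filter (bbad f t)) ⊆
          ((Finset.Ioc 0 l).filter (bbad f t)) ∪ Finset.Ioc l i := by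
        intro k hk
        simp only [Finset.mem_filter, Finset.mem_Ioc, Finset.mem_union] at hk ⊢
        by_cases h : k ≤ l
        · left; exact ⟨⟨hk.1.1, h⟩, hk.2⟩
        · right; omega
      have h2 := (Finset.card_le_card h1).trans (Finset.card_union_le _ _)
      rw [Nat.card_Ioc] at h2
      have h3 : (((Finset.Ioc 0 i).filter (bbad f t)).card : ℝ) ≤
          ((Finset.Ioc 0 l).filter (bbad f t)).card + ((i : ℝ) - l) := by
        rw [← Nat.cast_sub hl.le]; exact_mod_cast h2
      have h4 := ih l hl
      have h5 : ∑ k ∈ Finset.range i, f k = ∑ k ∈ Finset.range l, f k + ∑ k ∈ Finset.Ico l i, f k :=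
        (Finset.sum_range_add_sum_Ico f hl.le).symm
      nlinarith
    · have h1 : ((Finset.Ioc 0 i).filter (bbad f t)) ⊆ ((Finset.Ioc 0 (i - 1)).filter (bbad f t)) := by
        intro k hk
        simp only [Finset.mem_filter, Finset.mem_Ioc] at hk ⊢
        have : k ≠ i := by rintro rfl; exact hb hk.2
        exact ⟨by omega, hk.2⟩
      have h4 := ih (i - 1) (by omega)
      have h5 : ∑ k ∈ Finset.range (i - 1), f k ≤ ∑ k ∈ Finset.range i, f k :=
        Finset.sum_le_sum_of_subset_of_nonneg (Finset.range_mono (by omega)) fun k _ _ => hf k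
      have h6 : t * ((Finset.Ioc 0 i).filter (bbad f t)).card ≤
          t * ((Finset.Ioc 0 (i - 1)).filter (bbad f t)).card := by
        have := Finset.card_le_card h1
        gcongr
      linarith

open scoped Classical in
lemma fbad_card (f : ℕ → ℝ) (t : ℝ) (ht : 0 ≤ t) (hf : ∀ i, 0 ≤ f i) (N : ℕ) (n : ℕ) :
    ∀ i, i ≤ N → N - i ≤ n →
    t * ((Finset.Ico i N).filter (fbad f t N)).card ≤ ∑ k ∈ Finset.Ico i N, f k := by
  induction n with
  | zero =>
    intro i hi hn
    have : i = N := by omega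
    subst this; simp
  | succ n ih =>
    intro i hi hn
    rcases hi.eq_or_lt with rfl | hi'
    · simp
    by_cases hb : fbad f t N i
    · obtain ⟨j, hj, hjN, hs⟩ := hb
      have h1 : ((Finset.Ico i N).filter (fbad f t N)) ⊆
          ((Finset.Ico j N).filter (fbad f t N)) ∪ Finset.Ico i j := by
        intro k hk
        simp only [Finset.mem_filter, Finset.mem_Ico, Finset.mem_union] at hk ⊢
        by_cases h : j ≤ k
        · left; exact ⟨⟨h, hk.1.2⟩, hk.2⟩
        · right; omega
      have h2 := (Finset.card_le_card h1).trans (Finset.card_union_le _ _)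
      rw [Nat.card_Ico] at h2
      have h3 : (((Finset.Ico i N).filter (fbad f t N)).card : ℝ) ≤
          ((Finset.Ico j N).filter (fbad f t N)).card + ((j : ℝ) - i) := by
        rw [← Nat.cast_sub hj.le]; exact_mod_cast h2
      have h4 := ih j hjN (by omega)
      have h5 := Finset.sum_Ico_consecutive f hj.le hjN
      nlinarith
    · have h1 : ((Finset.Ico i N).filter (fbad f t N)) ⊆ ((Finset.Ico (i + 1) N).filter (fbad f t N)) := by
        intro k hk
        simp only [Finset.mem_filter, Finset.mem_Ico] at hk ⊢
        have : k ≠ i := by rintro rfl; exact hb hk.2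
        exact ⟨by omega, hk.2⟩
      have h4 := ih (i + 1) (by omega) (by omega)
      have h5 : ∑ k ∈ Finset.Ico (i + 1) N, f k ≤ ∑ k ∈ Finset.Ico i N, f k :=
        Finset.sum_le_sum_of_subset_of_nonneg (Finset.Ico_subset_Ico_left (by omega)) fun k _ _ => hf k
      have h6 : t * ((Finset.Ico i N).filter (fbad f t N)).card ≤
          t * ((Finset.Ico (i + 1) N).filter (fbad f t N)).card := by
        have := Finset.card_le_card h1
        gcongr
      linarith

/-- A large spaced set of good indices. -/
lemma exists_spaced (f : ℕ → ℝ) (t : ℝ) (ht : 0 < t) (hf : ∀ i, 0 ≤ f i) (N m R : ℕ) (hR : 0 < R)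
    (hsum : ∑ k ∈ Finset.range N, f k ≤ t * N / 16) (hN : 8 * (m + 1) ≤ N) :
    ∃ J : Finset ℕ, (∀ i ∈ J, m < i ∧ 2 * i ≤ N ∧ ¬ fbad f t N i ∧ ¬ bbad f t i) ∧
      (∀ i ∈ J, ∀ l ∈ J, i < l → i + R ≤ l) ∧ (N : ℝ) / (8 * R) ≤ J.card := by
  classical
  set A := Finset.Ioc m (N / 2) with hA
  set B1 := (Finset.Ico 0 N).filter (fbad f t N) with hB1
  set B2 := (Finset.Ioc 0 N).filter (bbad f t) with hB2
  set Gd := (A \ B1) \ B2 with hGd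
  have h1 : (B1.card : ℝ) ≤ N / 16 := by
    have := fbad_card f t ht.le hf N N 0 (by omega) (by omega)
    rw [Finset.range_eq_Ico] at hsum
    have h := this.trans hsum
    rw [mul_div_assoc] at h
    exact le_of_mul_le_mul_left h ht
  have h2 : (B2.card : ℝ) ≤ N / 16 := by
    have := bbad_card f t ht.le hf N
    have h := this.trans hsum
    rw [mul_div_assoc] at h
    exact le_of_mul_le_mul_left h ht
  have h3 : A.card ≤ Gd.card + B1.card + B2.card := by
    have a1 := Finset.le_card_sdiff B1 A
    have a2 := Finset.le_card_sdiff B2 (A \ B1)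
    rw [hGd]; rw [← Finset.card_sdiff_add_card_inter A B1] ; have a3 := Finset.card_sdiff_add_card_inter A B1
    have a4 := Finset.card_sdiff_add_card_inter (A \ B1) B2
    have a5 := Finset.card_le_card (Finset.inter_subset_right (s₁ := A) (s₂ := B1))
    have a6 := Finset.card_le_card (Finset.inter_subset_right (s₁ := A \ B1) (s₂ := B2))
    omega
  have h4 : A.card = N / 2 - m := Nat.card_Ioc _ _
  have h5 : (N : ℝ) ≤ 2 * A.card + 2 * m + 1 := by
    rw [h4]
    have : N ≤ 2 * (N / 2 - m) + 2 * m + 1 := by omega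
    exact_mod_cast this
  have h6 : (A.card : ℝ) ≤ Gd.card + B1.card + B2.card := by exact_mod_cast h3
  have h7 : 8 * ((m : ℝ) + 1) ≤ N := by exact_mod_cast hN
  have h8 : (N : ℝ) / 8 ≤ Gd.card := by linarith
  have hmap : ∀ a ∈ Gd, a % R ∈ Finset.range R := fun a _ =>
    Finset.mem_range.2 (Nat.mod_lt _ hR)
  obtain ⟨y, hy, hc⟩ := Finset.exists_le_card_fiber_of_nsmul_le_card_of_maps_to (b := (N : ℝ) / (8 * R)) hmap
    ⟨0, Finset.mem_range.2 hR⟩ (by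
      rw [Finset.card_range, nsmul_eq_mul]
      have : (0 : ℝ) < R := by exact_mod_cast hR
      calc (R : ℝ) * (N / (8 * R)) = N / 8 := by field_simp
        _ ≤ _ := h8)
  refine ⟨_, fun i hi => ?_, fun i hi l hl hil => ?_, hc⟩
  · simp only [Finset.mem_filter, hGd, hA, hB1, hB2, Finset.mem_sdiff, Finset.mem_Ioc,
      Finset.mem_Ico] at hi
    obtain ⟨⟨⟨a1, a2⟩, a3⟩, a4⟩ := hi
    refine ⟨by omega, by omega, fun hb => a2 ⟨by omega, hb⟩, fun hb => a3 ⟨by omega, hb⟩⟩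
  · have e1 := (Finset.mem_filter.1 hi).2
    have e2 := (Finset.mem_filter.1 hl).2
    have e3 := Nat.sub_mod_eq_zero_of_mod_eq (e2.trans e1.symm)
    have := Nat.le_of_dvd (by omega) (Nat.dvd_of_mod_eq_zero e3)
    omega

end PartF

end SIRW

namespace SIRW

section PartF2

variable {d : ℕ}

/-- Abstract skeleton data. -/
structure Sk (H : Pt d →+ ℝ) (γ : List (Pt d)) (N : ℕ) (v : ℕ → Pt d) (T : ℕ → ℕ)
    (hl f : ℕ → ℝ) (K c1 C1 : ℝ) : Prop where
  c1pos : 0 < c1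
  C1one : 1 ≤ C1
  Kpos : 0 < K
  Hb : ∀ y, |H y| ≤ C1 * l1 y
  Tle : ∀ i ≤ N, T i ≤ γ.length
  Tmono : Monotone T
  Tv : ∀ i ≤ N, pos γ (T i) = v i
  v0 : v 0 = 0
  piece : ∀ j ≤ γ.length, ∃ l ≤ N, T l ≤ j ∧ (l < N → j < T (l + 1)) ∧
    (l1 (pos γ j - v l) : ℝ) ≤ 2 * K / c1 + hl l
  Hv : ∀ i l, i ≤ l → l ≤ N → K * ((l : ℝ) - i) - ∑ k ∈ Finset.Ico i l, f k ≤ H (v l - v i)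
  dv : ∀ i l, i ≤ l → l ≤ N → (l1 (v l - v i) : ℝ) ≤ 2 * K / c1 * ((l : ℝ) - i)
  hlf : ∀ l < N, hl l ≤ f l
  f0 : ∀ l, 0 ≤ f l
  hN : hl N ≤ K / (4 * C1) * N / 16

/-- Regular points. -/
def Reg (H : Pt d →+ ℝ) (κ : ℝ) (L L' : ℕ) (γ : List (Pt d)) (u : Pt d) : Prop :=
  ∃ k1 k2, k1 ≤ k2 ∧ k2 < γ.length ∧
  (∀ j < k1, L < l1 (pos γ j - u) ∧ κ * l1 (u - pos γ j) ≤ H (u - pos γ j)) ∧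
  (∀ j, k2 < j → j ≤ γ.length → L < l1 (pos γ j - u) ∧ κ * l1 (pos γ j - u) ≤ H (pos γ j - u)) ∧
  (∀ j, k1 ≤ j → j ≤ k2 → l1 (pos γ j - u) ≤ L') ∧
  l1 (pos γ k1 - u) ≤ L ∧ l1 (pos γ k2 - u) ≤ L ∧
  κ * l1 (u - pos γ k1) ≤ H (u - pos γ k1) ∧ κ * l1 (pos γ k2 - u) ≤ H (pos γ k2 - u)

variable {H : Pt d →+ ℝ} {γ : List (Pt d)} {N : ℕ} {v : ℕ → Pt d} {T : ℕ → ℕ}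
    {hl f : ℕ → ℝ} {K c1 C1 : ℝ}

lemma Sk.tK (S : Sk H γ N v T hl f K c1 C1) : 0 < K / (4 * C1) ∧ K / (4 * C1) ≤ K / 4 ∧
    C1 * (K / (4 * C1)) = K / 4 := by
  have h1 := S.C1one
  have h2 := S.Kpos
  refine ⟨by positivity, ?_, by field_simp⟩
  gcongr; linarith

lemma Sk.fwd (S : Sk H γ N v T hl f K c1 C1) {i : ℕ} (hi : 2 * i ≤ N)
    (hg : ¬ fbad f (K / (4 * C1)) N i) {l : ℕ} (hil : i ≤ l) (hlN : l ≤ N) {y : Pt d}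
    (hy : (l1 (y - v l) : ℝ) ≤ 2 * K / c1 + hl l) :
    (l1 (y - v i) : ℝ) ≤ K * (2 / c1 + 1) * ((l : ℝ) - i + 1) ∧
    K * (((l : ℝ) - i) / 2 - (1 / 4 + 2 * C1 / c1)) ≤ H (y - v i) := by
  obtain ⟨t0, t1, t2⟩ := S.tK
  set t := K / (4 * C1) with ht
  have hc1 := S.c1pos
  have hC1 := S.C1one
  have hK := S.Kpos
  have hn : (0 : ℝ) ≤ (l : ℝ) - i := by
    have : (i : ℝ) ≤ l := by exact_mod_cast hil
    linarith
  have hsum : ∀ j, i < j → j ≤ N → ∑ k ∈ Finset.Ico i j, f k ≤ t * ((j : ℝ) - i) := by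
    intro j h1 h2
    by_contra h
    exact hg ⟨j, h1, h2, not_le.1 h⟩
  have hsum' : ∑ k ∈ Finset.Ico i l, f k ≤ t * ((l : ℝ) - i) := by
    rcases hil.eq_or_lt with rfl | h
    · simp
    · exact hsum l h hlN
  have hh : hl l ≤ t * ((l : ℝ) - i + 1) := by
    rcases hlN.eq_or_lt with rfl | h
    · have h1 := S.hN
      have h2 : (2 : ℝ) * i ≤ l := by exact_mod_cast hi
      have h3 : t * (l : ℝ) ≤ t * (2 * ((l : ℝ) - i)) := by gcongr; linarith
      nlinarith
    · have h1 := S.hlf l h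
      have h2 := hsum (l + 1) (by omega) (by omega)
      have h3 : f l ≤ ∑ k ∈ Finset.Ico i (l + 1), f k :=
        Finset.single_le_sum (fun k _ => S.f0 k) (Finset.mem_Ico.2 ⟨hil, by omega⟩)
      push_cast at h2
      linarith
  have hd := S.dv i l hil hlN
  have hHv := S.Hv i l hil hlN
  have hlt : (l1 (y - v i) : ℝ) ≤ l1 (y - v l) + l1 (v l - v i) := by
    exact_mod_cast l1_sub_le y (v l) (v i)
  have htn : t * ((l : ℝ) - i) ≤ K / 4 * ((l : ℝ) - i) := by gcongr
  constructor
  · have h5 : t * ((l : ℝ) - i + 1) ≤ K / 4 * ((l : ℝ) - i + 1) := by gcongr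
    have h6 : K * (2 / c1 + 1) * ((l : ℝ) - i + 1) = 2 * K / c1 * ((l : ℝ) - i) + 2 * K / c1 +
      K / 4 * ((l : ℝ) - i + 1) + 3 / 4 * (K * ((l : ℝ) - i + 1)) := by ring
    have h7 : 0 ≤ K * ((l : ℝ) - i + 1) := by positivity
    linarith
  · have h1 : H (y - v i) = H (v l - v i) + H (y - v l) := by rw [← map_add]; congr 1; abel
    have h2 := (abs_le.1 (S.Hb (y - v l))).1
    have h3 : C1 * (l1 (y - v l) : ℝ) ≤ C1 * (2 * K / c1 + t * ((l : ℝ) - i + 1)) := by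
      gcongr; linarith
    have h4 : C1 * (2 * K / c1 + t * ((l : ℝ) - i + 1)) =
        K * (2 * C1 / c1) + K / 4 * ((l : ℝ) - i + 1) := by rw [mul_add, ← mul_assoc, t2]; ring
    rw [h1]
    nlinarith

lemma Sk.bwd (S : Sk H γ N v T hl f K c1 C1) {i : ℕ} (hi : i ≤ N)
    (hg : ¬ bbad f (K / (4 * C1)) i) {l : ℕ} (hil : l < i) {y : Pt d}
    (hy : (l1 (y - v l) : ℝ) ≤ 2 * K / c1 + hl l) :
    (l1 (v i - y) : ℝ) ≤ K * (2 / c1 + 1) * ((i : ℝ) - l + 1) ∧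
    K * (((i : ℝ) - l) / 2 - (1 / 4 + 2 * C1 / c1)) ≤ H (v i - y) := by
  obtain ⟨t0, t1, t2⟩ := S.tK
  set t := K / (4 * C1) with ht
  have hc1 := S.c1pos
  have hC1 := S.C1one
  have hK := S.Kpos
  have hn : (0 : ℝ) ≤ (i : ℝ) - l := by
    have : (l : ℝ) ≤ i := by exact_mod_cast hil.le
    linarith
  have hsum' : ∑ k ∈ Finset.Ico l i, f k ≤ t * ((i : ℝ) - l) := by
    by_contra h
    exact hg ⟨l, hil, not_le.1 h⟩
  have hh : hl l ≤ t * ((i : ℝ) - l) := by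
    have h1 := S.hlf l (by omega)
    have h3 : f l ≤ ∑ k ∈ Finset.Ico l i, f k :=
      Finset.single_le_sum (fun k _ => S.f0 k) (Finset.mem_Ico.2 ⟨le_rfl, hil⟩)
    linarith
  have hd := S.dv l i hil.le hi
  have hHv := S.Hv l i hil.le hi
  have hlt : (l1 (v i - y) : ℝ) ≤ l1 (v i - v l) + l1 (y - v l) := by
    rw [l1_sub_comm y]
    exact_mod_cast l1_sub_le (v i) (v l) y
  have htn : t * ((i : ℝ) - l) ≤ K / 4 * ((i : ℝ) - l) := by gcongr
  constructor
  · have h6 : K * (2 / c1 + 1) * ((i : ℝ) - l + 1) = 2 * K / c1 * ((i : ℝ) - l) + 2 * K / c1 +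
      K / 4 * ((i : ℝ) - l) + 3 / 4 * (K * ((i : ℝ) - l)) + K := by ring
    have h7 : 0 ≤ K * ((i : ℝ) - l) := by positivity
    linarith
  · have h1 : H (v i - y) = H (v i - v l) - H (y - v l) := by rw [← map_sub]; congr 1; abel
    have h2 := (abs_le.1 (S.Hb (y - v l))).2
    have h3 : C1 * (l1 (y - v l) : ℝ) ≤ C1 * (2 * K / c1 + t * ((i : ℝ) - l)) := by
      gcongr; linarith
    have h4 : C1 * (2 * K / c1 + t * ((i : ℝ) - l)) =
        K * (2 * C1 / c1) + K / 4 * ((i : ℝ) - l) := by rw [mul_add, ← mul_assoc, t2]; ring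
    rw [h1]
    nlinarith

/-- numerical consequence: far implies cone -/
lemma num_cone {K E q n Hy D L : ℝ} (hK : 0 < K) (hE : 0 < E) (hL : K * E * (4 * q + 2) ≤ L)
    (hD : D ≤ K * E * (n + 1)) (hH : K * (n / 2 - q) ≤ Hy) (hLD : L ≤ D) : 1 / (4 * E) * D ≤ Hy := by
  have h1 : K * E * (4 * q + 2) ≤ K * E * (n + 1) := by linarith
  have h2 := le_of_mul_le_mul_left h1 (by positivity)
  rw [div_mul_eq_mul_div, one_mul, div_le_iff₀ (by positivity)]
  have h3 : K * ((n + 1) / 4) ≤ K * (n / 2 - q) := by gcongr; linarith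
  have h4 : K * ((n + 1) / 4) * (4 * E) ≤ Hy * (4 * E) := by gcongr; linarith
  nlinarith

/-- numerical consequence: near implies bounded index -/
lemma num_near {K E q n n' Hy D D' L L' C1 : ℝ} (hK : 0 < K) (hE : 0 < E) (hC1 : 0 < C1)
    (hL' : E * (2 * C1 * L + (2 * q + 1) * K) ≤ L') (hHD : Hy ≤ C1 * D)
    (hH : K * (n / 2 - q) ≤ Hy) (hLD : D ≤ L) (hn : n' ≤ n) (hD' : D' ≤ K * E * (n' + 1)) :
    D' ≤ L' := by
  have h0 : C1 * D ≤ C1 * L := by gcongr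
  have h1 : K * n ≤ 2 * C1 * L + 2 * q * K := by linarith
  have h2 : E * (K * n') ≤ E * (2 * C1 * L + 2 * q * K) := by gcongr; nlinarith
  nlinarith

lemma Sk.reg (hγ : IsPath γ) (S : Sk H γ N v T hl f K c1 C1) {L L' m : ℕ} {q : ℝ}
    (hq : q = 1 / 4 + 2 * C1 / c1)
    (hL : K * (2 / c1 + 1) * (4 * q + 2) ≤ L)
    (hL' : (2 / c1 + 1) * (2 * C1 * L + (2 * q + 1) * K) ≤ L')
    (hm : 2 * (C1 * L / K + q) ≤ m) {i : ℕ} (him : m < i) (hi : 2 * i ≤ N)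
    (hgf : ¬ fbad f (K / (4 * C1)) N i) (hgb : ¬ bbad f (K / (4 * C1)) i) :
    Reg H (1 / (4 * (2 / c1 + 1))) L L' γ (v i) := by
  classical
  have hc1 := S.c1pos
  have hC1 := S.C1one
  have hK := S.Kpos
  have hiN : i ≤ N := by omega
  set E := 2 / c1 + 1 with hE
  have hEpos : 0 < E := by positivity
  set u := v i with hu
  have hTi := S.Tle i hiN
  have huT := S.Tv i hiN
  -- first and last times
  have hex : ∃ k ≤ γ.length, l1 (pos γ k - u) ≤ L := ⟨T i, hTi, by rw [huT, sub_self, l1_zero]; omega⟩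
  obtain ⟨k2, hk2, hk2L, hk2l⟩ := exists_last hex
  have hex' : ∃ k, l1 (pos γ k - u) ≤ L := ⟨T i, by rw [huT, sub_self, l1_zero]; omega⟩
  obtain ⟨k1, hk1L, hk1f⟩ : ∃ k1, l1 (pos γ k1 - u) ≤ L ∧ ∀ j < k1, L < l1 (pos γ j - u) :=
    ⟨Nat.find hex', Nat.find_spec hex', fun j hj => not_le.1 (Nat.find_min hex' hj)⟩
  have hk1T : k1 ≤ T i := by
    by_contra h
    have := hk1f (T i) (not_le.1 h)
    rw [huT, sub_self, l1_zero] at this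
    omega
  have hTk2 : T i ≤ k2 := by
    by_contra h
    exact hk2l (T i) hTi (not_le.1 h) (by rw [huT, sub_self, l1_zero]; omega)
  have pf : ∀ j, T i ≤ j → j ≤ γ.length → ∃ l, i ≤ l ∧ l ≤ N ∧ T l ≤ j ∧ (l < N → j < T (l + 1)) ∧
      (l1 (pos γ j - u) : ℝ) ≤ K * E * ((l : ℝ) - i + 1) ∧
      K * (((l : ℝ) - i) / 2 - q) ≤ H (pos γ j - u) := by
    intro j hj1 hj2
    obtain ⟨l, h1, h2, h3, h4⟩ := S.piece j hj2
    have hil : i ≤ l := by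
      by_contra h
      have a1 := h3 (by omega)
      have a2 := S.Tmono (show l + 1 ≤ i by omega)
      omega
    have := S.fwd hi hgf hil h1 h4
    rw [← hq] at this
    exact ⟨l, hil, h1, h2, h3, this⟩
  have pb : ∀ j, j < T i → j ≤ γ.length → ∃ l, l < i ∧ T l ≤ j ∧ (l < N → j < T (l + 1)) ∧
      (l1 (u - pos γ j) : ℝ) ≤ K * E * ((i : ℝ) - l + 1) ∧
      K * (((i : ℝ) - l) / 2 - q) ≤ H (u - pos γ j) := by
    intro j hj1 hj2
    obtain ⟨l, h1, h2, h3, h4⟩ := S.piece j hj2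
    have hil : l < i := by
      by_contra h
      have a2 := S.Tmono (show i ≤ l by omega)
      omega
    have := S.bwd hiN hgb hil h4
    rw [← hq] at this
    exact ⟨l, hil, h2, h3, this⟩
  have hmR : 2 * (C1 * L / K + q) < i := lt_of_le_of_lt hm (by exact_mod_cast him)
  have hmK : 2 * C1 * L + 2 * q * K < K * i := by
    have : K * (2 * (C1 * L / K + q)) = 2 * C1 * L + 2 * q * K := by field_simp
    have h2 : K * (2 * (C1 * L / K + q)) < K * i := by gcongr
    linarith
  have hqpos : 0 < q := by rw [hq]; positivity
  have hcL : ∀ j, T i ≤ j → j ≤ γ.length → L ≤ l1 (pos γ j - u) →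
      1 / (4 * E) * l1 (pos γ j - u) ≤ H (pos γ j - u) := by
    intro j hj1 hj2 hLj
    obtain ⟨l, -, -, -, -, a5, a6⟩ := pf j hj1 hj2
    exact num_cone hK hEpos hL a5 a6 (by exact_mod_cast hLj)
  have hcB : ∀ j, j < T i → L ≤ l1 (u - pos γ j) →
      1 / (4 * E) * l1 (u - pos γ j) ≤ H (u - pos γ j) := by
    intro j hj1 hLj
    obtain ⟨l, -, -, -, a5, a6⟩ := pb j hj1 (by omega)
    exact num_cone hK hEpos hL a5 a6 (by exact_mod_cast hLj)
  have hk2lt : k2 < γ.length := by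
    rcases hk2.eq_or_lt with h | h
    · exfalso
      obtain ⟨l, a1, a2, a3, a4, a5, a6⟩ := pf k2 hTk2 hk2
      have hlN : l = N := by
        by_contra hne
        have b1 := a4 (by omega)
        have b2 := S.Tle (l + 1) (by omega)
        omega
      have b1 := (abs_le.1 (S.Hb (pos γ k2 - u))).2
      have b2 : C1 * (l1 (pos γ k2 - u) : ℝ) ≤ C1 * L := by gcongr
      have b3 : (i : ℝ) ≤ (l : ℝ) - i := by
        have : (2 : ℝ) * i ≤ l := by rw [hlN]; exact_mod_cast hi
        linarith
      have b4 : K * i ≤ K * ((l : ℝ) - i) := by gcongr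
      nlinarith
    · exact h
  have hk1pos : 0 < k1 := by
    rcases Nat.eq_zero_or_pos k1 with h | h
    · exfalso
      rw [h, pos_zero, ← S.v0, l1_sub_comm] at hk1L
      have b0 := S.Hv 0 i (by omega) hiN
      have b1 := (abs_le.1 (S.Hb (u - v 0))).2
      have b2 : C1 * (l1 (u - v 0) : ℝ) ≤ C1 * L := by gcongr
      have b3 : ∑ k ∈ Finset.Ico 0 i, f k ≤ K / (4 * C1) * ((i : ℝ) - (0 : ℕ)) := by
        by_contra h
        exact hgb ⟨0, by omega, not_le.1 h⟩
      have b4 : K / (4 * C1) * ((i : ℝ) - (0 : ℕ)) ≤ K / 4 * ((i : ℝ) - (0 : ℕ)) := by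
        have := S.tK.2.1
        gcongr
        simp
      push_cast at *
      nlinarith [mul_pos hqpos hK, show (0:ℝ) ≤ C1 * L by positivity]
    · exact h
  refine ⟨k1, k2, hk1T.trans hTk2, hk2lt, fun j hj => ⟨hk1f j hj, hcB j (by omega) ?_⟩,
    fun j hj hj2 => ?_, fun j hj1 hj2 => ?_, hk1L, hk2L, ?_, ?_⟩
  · rw [l1_sub_comm]; exact (hk1f j hj).le
  · have h1 := not_le.1 (hk2l j hj2 hj)
    exact ⟨h1, hcL j (by omega) hj2 h1.le⟩
  · by_cases hT : T i ≤ j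
    · obtain ⟨l, a1, a2, a3, a4, a5, a6⟩ := pf j hT (by omega)
      obtain ⟨l', b1, b2, b3, b4, b5, b6⟩ := pf k2 hTk2 hk2
      have hll : l ≤ l' := by
        by_contra h
        have c1 := b4 (by omega)
        have c2 := S.Tmono (show l' + 1 ≤ l by omega)
        omega
      have hll' : (l : ℝ) ≤ l' := by exact_mod_cast hll
      have := num_near hK hEpos (by linarith) hL' (abs_le.1 (S.Hb (pos γ k2 - u))).2 b6
        (by exact_mod_cast hk2L) (by linarith : (l : ℝ) - i ≤ (l' : ℝ) - i) a5
      exact_mod_cast this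
    · obtain ⟨l, a1, a3, a4, a5, a6⟩ := pb j (by omega) (by omega)
      obtain ⟨l', b1, b3, b4, b5, b6⟩ := pb k1 (by omega) (by omega)
      have hll : l' ≤ l := by
        by_contra h
        have c1 := a4 (by omega)
        have c2 := S.Tmono (show l + 1 ≤ l' by omega)
        omega
      have hll' : (l' : ℝ) ≤ l := by exact_mod_cast hll
      have := num_near hK hEpos (by linarith) hL' (abs_le.1 (S.Hb (u - pos γ k1))).2 b6
        (by rw [l1_sub_comm]; exact_mod_cast hk1L) (by linarith : (i : ℝ) - l ≤ (i : ℝ) - l') a5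
      rw [l1_sub_comm]
      exact_mod_cast this
  · rcases hk1T.eq_or_lt with h | h
    · rw [h, huT, sub_self, l1_zero, map_zero]; simp
    · refine hcB k1 h ?_
      obtain ⟨s, hs, he⟩ := pos_succ_step hγ (k := k1 - 1) (by omega)
      have h1 := hk1f (k1 - 1) (by omega)
      rw [Nat.sub_add_cancel hk1pos] at he
      have h2 := l1_sub_le (pos γ (k1 - 1)) (pos γ k1) u
      have h3 : l1 (pos γ (k1 - 1) - pos γ k1) = 1 := by
        rw [he, l1_sub_comm, add_sub_cancel_left, ← isStep_iff]; exact hs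
      rw [l1_sub_comm u]; omega
  · refine hcL k2 hTk2 hk2 ?_
    obtain ⟨s, hs, he⟩ := pos_succ_step hγ hk2lt
    have h1 := not_le.1 (hk2l (k2 + 1) (by omega) (by omega))
    have h2 := l1_sub_le (pos γ (k2 + 1)) (pos γ k2) u
    have h3 : l1 (pos γ (k2 + 1) - pos γ k2) = 1 := by
      rw [he, add_sub_cancel_left, ← isStep_iff]; exact hs
    omega

lemma Sk.sep (S : Sk H γ N v T hl f K c1 C1) {i l : ℕ} (hl : i < l) (hlN : l ≤ N)
    (hg : ¬ fbad f (K / (4 * C1)) N i) :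
    3 / 4 * K * ((l : ℝ) - i) ≤ H (v l - v i) ∧
    2 * (1 / (4 * (2 / c1 + 1))) * l1 (v l - v i) ≤ H (v l - v i) := by
  obtain ⟨t0, t1, t2⟩ := S.tK
  have hc1 := S.c1pos
  have hK := S.Kpos
  have h1 := S.Hv i l hl.le hlN
  have hn : (0 : ℝ) ≤ (l : ℝ) - i := by
    have : (i : ℝ) ≤ l := by exact_mod_cast hl.le
    linarith
  have h2 : ∑ k ∈ Finset.Ico i l, f k ≤ K / (4 * C1) * ((l : ℝ) - i) := by
    by_contra h
    exact hg ⟨l, hl, hlN, not_le.1 h⟩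
  have h3 : K / (4 * C1) * ((l : ℝ) - i) ≤ K / 4 * ((l : ℝ) - i) := by gcongr
  have h4 : 3 / 4 * K * ((l : ℝ) - i) ≤ H (v l - v i) := by nlinarith
  refine ⟨h4, le_trans ?_ h4⟩
  have h5 := S.dv i l hl.le hlN
  have e : 2 * (1 / (4 * (2 / c1 + 1))) = c1 / (2 * (2 + c1)) := by field_simp; ring
  rw [e]
  calc c1 / (2 * (2 + c1)) * (l1 (v l - v i) : ℝ)
      ≤ c1 / (2 * (2 + c1)) * (2 * K / c1 * ((l : ℝ) - i)) := by gcongr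
    _ = 1 / (2 + c1) * K * ((l : ℝ) - i) := by field_simp
    _ ≤ 3 / 4 * K * ((l : ℝ) - i) := by
      have : 1 / (2 + c1) ≤ 3 / 4 := by
        rw [div_le_div_iff₀ (by positivity) (by norm_num)]
        linarith
      exact mul_le_mul_of_nonneg_right (mul_le_mul_of_nonneg_right this hK.le) hn

end PartF2

end SIRW

namespace SIRW

section PartF3

variable {d : ℕ}

lemma flat_append (as bs : List (List (Pt d) × List (Pt d))) :
    flat (as ++ bs) = flat as ++ flat bs := by
  induction as with
  | nil => simp [flat]
  | cons g as ih => simp [flat, ih]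

/-- skeleton vertices -/
def sv (bs : List (List (Pt d) × List (Pt d))) (i : ℕ) : Pt d := disp (flat (bs.take i))

/-- skeleton times -/
def sT (bs : List (List (Pt d) × List (Pt d))) (i : ℕ) : ℕ := (flat (bs.take i)).length

/-- skeleton blocks -/
def gb (bs : List (List (Pt d) × List (Pt d))) (i : ℕ) : List (Pt d) × List (Pt d) :=
  bs.getD i ([], [])

lemma gb_mem {bs : List (List (Pt d) × List (Pt d))} {i : ℕ} (hi : i < bs.length) :
    gb bs i ∈ bs := by
  rw [gb, List.getD_eq_getElem _ _ hi]; exact List.getElem_mem hi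

lemma take_succ_gb {bs : List (List (Pt d) × List (Pt d))} {i : ℕ} (hi : i < bs.length) :
    bs.take (i + 1) = bs.take i ++ [gb bs i] := by
  rw [gb, List.getD_eq_getElem _ _ hi, List.take_append_getElem]

lemma sv_succ {bs : List (List (Pt d) × List (Pt d))} {i : ℕ} (hi : i < bs.length) :
    sv bs (i + 1) = sv bs i + bdisp (gb bs i) := by
  rw [sv, take_succ_gb hi, flat_append, disp_append, sv]
  simp [flat, bdisp, disp_append]

lemma sT_succ {bs : List (List (Pt d) × List (Pt d))} {i : ℕ} (hi : i < bs.length) :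
    sT bs (i + 1) = sT bs i + ((gb bs i).1.length + (gb bs i).2.length) := by
  rw [sT, take_succ_gb hi, flat_append, sT]
  simp [flat]

lemma flat_split (bs : List (List (Pt d) × List (Pt d))) (i : ℕ) :
    flat bs = flat (bs.take i) ++ flat (bs.drop i) := by
  rw [← flat_append, List.take_append_drop]

lemma drop_gb {bs : List (List (Pt d) × List (Pt d))} {i : ℕ} (hi : i < bs.length) :
    bs.drop i = gb bs i :: bs.drop (i + 1) := by
  rw [gb, List.getD_eq_getElem _ _ hi]; exact List.drop_eq_getElem_cons hi

lemma sT_mono (bs : List (List (Pt d) × List (Pt d))) : Monotone (sT bs) := by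
  refine monotone_nat_of_le_succ fun i => ?_
  by_cases hi : i < bs.length
  · rw [sT_succ hi]; omega
  · rw [sT, sT, List.take_of_length_le (by omega), List.take_of_length_le (by omega)]

lemma sT_le (bs : List (List (Pt d) × List (Pt d))) (i : ℕ) : sT bs i ≤ (flat bs).length := by
  rw [flat_split bs i, sT, List.length_append]; omega

variable {φ : ℕ → ℝ≥0∞} {lam : ℝ} {X : Pt d → ℝ} {c1 C1 : ℝ}

/-- hair lengths -/
def hlen (bs : List (List (Pt d) × List (Pt d))) (R : List (Pt d)) (i : ℕ) : ℝ :=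
  if i < bs.length then ((gb bs i).2.length : ℝ) else R.length

/-- block costs -/
def fcost (H : Pt d →+ ℝ) (K C1 : ℝ) (bs : List (List (Pt d) × List (Pt d))) (i : ℕ) : ℝ :=
  if i < bs.length then cost H K C1 (gb bs i) else 0

lemma tcost_eq (H : Pt d →+ ℝ) (K C1 : ℝ) (bs : List (List (Pt d) × List (Pt d))) :
    ∑ k ∈ Finset.range bs.length, fcost H K C1 bs k = tcost H K C1 bs := by
  have : ∀ i ≤ bs.length, ∑ k ∈ Finset.range i, fcost H K C1 bs k = tcost H K C1 (bs.take i) := by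
    intro i
    induction i with
    | zero => simp [tcost]
    | succ i ih =>
      intro hi
      rw [Finset.sum_range_succ, ih (by omega), take_succ_gb (by omega), fcost, if_pos (by omega)]
      simp [tcost]
  rw [this _ le_rfl, List.take_length]

lemma l1_of_X (Ly : Lyap d φ lam X c1 C1) {y : Pt d} {B : ℝ} (h : X y ≤ B) :
    (l1 y : ℝ) ≤ B / c1 := by
  rw [le_div_iff₀ Ly.c1pos]
  have := Ly.lower y
  linarith

lemma pos_app3 (α β γ : List (Pt d)) {j : ℕ} (hj : α.length ≤ j) :
    pos (α ++ β ++ γ) j = disp α + pos (β ++ γ) (j - α.length) := by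
  obtain ⟨k, rfl⟩ := Nat.exists_eq_add_of_le hj
  rw [List.append_assoc, pos_append_right, Nat.add_sub_cancel_left]

lemma sk_of_skel (Ly : Lyap d φ lam X c1 C1) {K : ℝ} (hKC : C1 ≤ K) {H : Pt d →+ ℝ}
    (hH : ∀ y, H y ≤ X y) {bs : List (List (Pt d) × List (Pt d))} {R : List (Pt d)}
    (hs : isSkel X K C1 bs R)
    (hR : (R.length : ℝ) ≤ K / (4 * C1) * bs.length / 16) :
    Sk H (flat bs ++ R) bs.length (sv bs) (sT bs) (hlen bs R) (fcost H K C1 bs) K c1 C1 := by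
  have hc1 := Ly.c1pos
  have hC1 := Ly.C1one
  have hb := isSkel_block hs
  have hKpos : 0 < K := by linarith
  have hD : (K + C1) / c1 ≤ 2 * K / c1 := by gcongr; linarith
  refine ⟨hc1, hC1, hKpos, Ly.abs_le hH, fun i _ => ?_, sT_mono bs, fun i hi => ?_, ?_,
    fun j hj => ?_, fun i l hil => ?_, fun i l hil => ?_, fun l hl => ?_, fun l => ?_, ?_⟩
  · rw [List.length_append]; have := sT_le bs i; omega
  · rw [pos_append_left _ _ (sT_le bs i), flat_split bs i, pos_append_left _ _ (by rw [sT]), sT,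
      pos_length, sv]
  · simp [sv, flat]
  · obtain ⟨l, hl, hTl, hlast⟩ := exists_last (P := fun i => sT bs i ≤ j) (n := bs.length)
      ⟨0, by omega, by simp [sT, flat]⟩
    refine ⟨l, hl, hTl, fun h => not_le.1 (hlast (l + 1) (by omega) (by omega)), ?_⟩
    have e : pos (flat bs ++ R) j - sv bs l = pos (flat (bs.drop l) ++ R) (j - sT bs l) := by
      rw [flat_split bs l, pos_app3 _ _ _ hTl, sv, add_sub_cancel_left, sT]
    rw [e, hlen]
    split_ifs with h
    · have hjl := not_le.1 (hlast (l + 1) (by omega) (by omega))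
      rw [sT_succ h] at hjl
      have hg := hb _ (gb_mem h)
      rw [drop_gb h, flat]
      set g := gb bs l
      set i := j - sT bs l with hi
      by_cases hi1 : i < g.1.length
      · rw [List.append_assoc, pos_append_left _ _ hi1.le]
        have h1 := l1_of_X Ly (hg.2.2.2.1 i hi1)
        have h2 : K / c1 ≤ 2 * K / c1 := by gcongr; linarith
        have : (0 : ℝ) ≤ g.2.length := by positivity
        linarith
      · have h3 : i = g.1.length + (i - g.1.length) := by omega
        rw [List.append_assoc, h3, pos_append_right, List.append_assoc,
          pos_append_left _ _ (by omega)]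
        have h1 := l1_of_X Ly (block_sphere Ly hKpos.le hg)
        have h2 : (l1 (disp g.1 + pos g.2 (i - g.1.length)) : ℝ) ≤ l1 (disp g.1) + g.2.length := by
          have a1 := l1_add (disp g.1) (pos g.2 (i - g.1.length))
          have a2 := l1_pos hg.2.1 (i - g.1.length)
          have : l1 (disp g.1 + pos g.2 (i - g.1.length)) ≤ l1 (disp g.1) + g.2.length := by omega
          exact_mod_cast this
        linarith
    · have hlN : l = bs.length := by omega
      rw [List.drop_of_length_le (by omega), flat, List.nil_append]
      have h1 : l1 (pos R (j - sT bs l)) ≤ R.length := by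
        by_cases h2 : j - sT bs l ≤ R.length
        · exact (l1_pos (isSkel_R hs).1 _).trans h2
        · rw [pos_of_length_le _ (by omega)]; exact l1_disp (isSkel_R hs).1
      have h2 : (l1 (pos R (j - sT bs l)) : ℝ) ≤ R.length := by exact_mod_cast h1
      have : 0 ≤ 2 * K / c1 := by positivity
      linarith
  · induction l, hil using Nat.le_induction with
    | base => intro _; simp
    | succ l hil ih =>
      intro hl
      have ih := ih (by omega)
      rw [Finset.sum_Ico_succ_top hil, fcost, if_pos (by omega), sv_succ (by omega),
        show sv bs l + bdisp (gb bs l) - sv bs i = (sv bs l - sv bs i) + bdisp (gb bs l) by abel,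
        map_add, cost]
      push_cast
      have : (0 : ℝ) ≤ (gb bs l).2.length := by positivity
      nlinarith
  · induction l, hil using Nat.le_induction with
    | base => intro _; simp
    | succ l hil ih =>
      intro hl
      have ih := ih (by omega)
      have h1 := l1_of_X Ly (hb _ (gb_mem (show l < bs.length by omega))).2.2.2.2
      rw [sv_succ (by omega),
        show sv bs l + bdisp (gb bs l) - sv bs i = (sv bs l - sv bs i) + bdisp (gb bs l) by abel]
      have h2 : (l1 (sv bs l - sv bs i + bdisp (gb bs l)) : ℝ) ≤ l1 (sv bs l - sv bs i) +
        l1 (bdisp (gb bs l)) := by exact_mod_cast l1_add _ _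
      push_cast
      nlinarith
  · rw [hlen, if_pos hl, fcost, if_pos hl, cost]
    have := (hH _).trans (hb _ (gb_mem hl)).2.2.2.2
    linarith
  · rw [fcost]
    split_ifs with h
    · rw [cost]
      have := (hH _).trans (hb _ (gb_mem h)).2.2.2.2
      have : (0 : ℝ) ≤ (gb bs l).2.length := by positivity
      linarith
    · exact le_rfl
  · rw [hlen, if_neg (by omega)]; exact hR

/-- The set `U` is a good family of regular points. -/
def Fam (H : Pt d →+ ℝ) (κ : ℝ) (L L' S : ℕ) (γ : List (Pt d)) (U : Finset (Pt d)) : Prop :=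
  (∀ u ∈ U, Reg H κ L L' γ u) ∧ ∀ u ∈ U, ∀ u' ∈ U, u ≠ u' → S < l1 (u - u') ∧
    (2 * κ * l1 (u - u') ≤ H (u - u') ∨ 2 * κ * l1 (u' - u) ≤ H (u' - u))

lemma regular_set (Ly : Lyap d φ lam X c1 C1) {K : ℝ} (hKC : C1 ≤ K) :
    ∃ L L' : ℕ, L ≤ L' ∧ ∀ S : ℕ, ∃ c2 R0 : ℝ, 0 < c2 ∧ ∀ (H : Pt d →+ ℝ) (x : Pt d),
      (∀ y, H y ≤ X y) → H x = X x → R0 ≤ l1 x → ∀ bs R, IsPath (flat bs ++ R) →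
      disp (flat bs ++ R) = x → isSkel X K C1 bs R →
      tcost H K C1 bs + R.length < 1 / (64 * C1) * K * bs.length →
      ∃ U : Finset (Pt d), c2 * l1 x ≤ U.card ∧
        Fam H (1 / (4 * (2 / c1 + 1))) L L' S (flat bs ++ R) U := by
  classical
  have hc1 := Ly.c1pos
  have hC1 := Ly.C1one
  have hKpos : 0 < K := by linarith
  set q := 1 / 4 + 2 * C1 / c1 with hq
  obtain ⟨L, hL⟩ := exists_nat_ge (K * (2 / c1 + 1) * (4 * q + 2))
  obtain ⟨L', hL'⟩ := exists_nat_ge ((2 / c1 + 1) * (2 * C1 * L + (2 * q + 1) * K))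
  obtain ⟨m, hm⟩ := exists_nat_ge (2 * (C1 * L / K + q))
  have hLL : L ≤ L' := by
    have h1 : (1 : ℝ) ≤ 2 / c1 + 1 := by have : 0 < 2 / c1 := by positivity
                                         linarith
    have h2 : (L : ℝ) ≤ 2 * C1 * L + (2 * q + 1) * K := by
      have hq0 : 0 < q := by rw [hq]; positivity
      have : 0 ≤ (2 * q + 1) * K := by positivity
      nlinarith [show (0 : ℝ) ≤ L by positivity]
    have h3 : (L : ℝ) ≤ L' := by nlinarith [show (0 : ℝ) ≤ L by positivity]
    exact_mod_cast h3
  refine ⟨L, L', hLL, fun S => ?_⟩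
  obtain ⟨Rs, hRs⟩ := exists_nat_gt ((4 * C1 * S + 4 * C1) / (3 * K))
  have hRs0 : 0 < Rs := by
    have : (0 : ℝ) < Rs := lt_of_le_of_lt (by positivity) hRs
    exact_mod_cast this
  have hRsR : (0 : ℝ) < Rs := by exact_mod_cast hRs0
  refine ⟨c1 / (4 * K) / (8 * Rs), (K + 2 * K * (8 * (m + 1))) / c1 + 2 * K / c1, by positivity,
    fun H x hH hx hxR bs R hp hdx hs hc => ?_⟩
  set N := bs.length with hN
  have hXl := Ly.lower x
  have hxR' : K + 2 * K * (8 * (m + 1)) + 2 * K ≤ c1 * l1 x := by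
    rw [← add_div, div_le_iff₀ hc1] at hxR; linarith
  have hHf := H_flat_le H hH bs (isSkel_block hs)
  have hHR := (hH (disp R)).trans (isSkel_R hs).2
  have hNx : c1 * l1 x ≤ K + 2 * K * N := by
    have h1 : H x = H (disp (flat bs)) + H (disp R) := by rw [← map_add, ← disp_append, hdx]
    have h2 : (N : ℝ) * (K + C1) ≤ N * (K + K) := by gcongr
    linarith
  have hN8 : 8 * (m + 1) ≤ N := by
    have : 2 * K * (8 * (m + 1)) ≤ 2 * K * N := by linarith
    have := le_of_mul_le_mul_left this (by positivity)
    exact_mod_cast this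
  have hcN : c1 / (4 * K) * l1 x ≤ N := by
    rw [div_mul_eq_mul_div, div_le_iff₀ (by positivity)]
    nlinarith
  have hcost0 : 0 ≤ tcost H K C1 bs := by
    rw [tcost]
    apply List.sum_nonneg
    intro y hy
    obtain ⟨g, hg, rfl⟩ := List.mem_map.1 hy
    have := (hH _).trans (isSkel_block hs g hg).2.2.2.2
    rw [cost]
    have : (0 : ℝ) ≤ g.2.length := by positivity
    linarith
  have et : K / (4 * C1) * N / 16 = 1 / (64 * C1) * K * N := by field_simp; ring
  have hSk := sk_of_skel Ly hKC hH hs (by rw [et]; linarith)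
  have hR0 : (0 : ℝ) ≤ R.length := by positivity
  obtain ⟨J, hJ1, hJ2, hJ3⟩ := exists_spaced (fcost H K C1 bs) (K / (4 * C1)) hSk.tK.1 hSk.f0 N m
    Rs hRs0 (by rw [tcost_eq, et]; linarith) hN8
  have hsep : ∀ i ∈ J, ∀ l ∈ J, i < l → S < l1 (sv bs l - sv bs i) ∧
      2 * (1 / (4 * (2 / c1 + 1))) * l1 (sv bs l - sv bs i) ≤ H (sv bs l - sv bs i) := by
    intro i hi l hl hil
    have h1 := hSk.sep hil (by have := (hJ1 l hl).2.1; omega) (hJ1 i hi).2.2.1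
    refine ⟨?_, h1.2⟩
    have h2 : (Rs : ℝ) ≤ (l : ℝ) - i := by
      have : (i : ℝ) + Rs ≤ l := by exact_mod_cast hJ2 i hi l hl hil
      linarith
    have h3 := (abs_le.1 (hSk.Hb (sv bs l - sv bs i))).2
    rw [div_lt_iff₀ (by positivity)] at hRs
    have h4 : 3 / 4 * K * Rs ≤ 3 / 4 * K * ((l : ℝ) - i) := by gcongr
    have h5 : C1 * (S : ℝ) < C1 * l1 (sv bs l - sv bs i) := by linarith
    have := lt_of_mul_lt_mul_left h5 (by linarith)
    exact_mod_cast this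
  have hinj : Set.InjOn (sv bs) J := by
    intro i hi l hl h
    rcases lt_trichotomy i l with h' | h' | h'
    · have := (hsep i hi l hl h').1
      rw [h, sub_self, l1_zero] at this; omega
    · exact h'
    · have := (hsep l hl i hi h').1
      rw [h, sub_self, l1_zero] at this; omega
  refine ⟨J.image (sv bs), ?_, ?_, ?_⟩
  · rw [Finset.card_image_of_injOn hinj]
    refine le_trans ?_ hJ3
    rw [div_mul_eq_mul_div]
    gcongr
  · intro u hu
    obtain ⟨i, hi, rfl⟩ := Finset.mem_image.1 hu
    obtain ⟨a1, a2, a3, a4⟩ := hJ1 i hi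
    exact hSk.reg hp hq hL hL' hm a1 a2 a3 a4
  · intro u hu u' hu' hne
    obtain ⟨i, hi, rfl⟩ := Finset.mem_image.1 hu
    obtain ⟨l, hl, rfl⟩ := Finset.mem_image.1 hu'
    rcases lt_trichotomy i l with h' | h' | h'
    · have := hsep i hi l hl h'
      exact ⟨by rw [l1_sub_comm]; exact this.1, Or.inr this.2⟩
    · exact absurd (by rw [h']) hne
    · have := hsep l hl i hi h'
      exact ⟨this.1, Or.inl this.2⟩

end PartF3

end SIRW

namespace SIRW

section PartG

variable {d : ℕ}

lemma sum_sgs (b : Pt d) : ∑ i, (b i).natAbs • sgs b i = b := by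
  funext j
  rw [Finset.sum_apply, Finset.sum_eq_single j]
  · simp only [sgs, Pi.smul_apply, Pi.single_eq_same, nsmul_eq_mul]
    rw [mul_comm]; exact Int.sign_mul_natAbs (b j)
  · intro i _ hi
    simp [sgs, Pi.single_eq_of_ne (Ne.symm hi)]
  · simp

lemma exists_good_dir (H : Pt d →+ ℝ) {κ : ℝ} {n : ℕ} {b : Pt d} (hb : l1 b = n + 1)
    (hκ : κ * l1 b ≤ H b) : ∃ i, b i ≠ 0 ∧ κ * n ≤ H (b - sgs b i) := by
  by_contra hc
  push Not at hc
  have h1 : ∑ i, ((b i).natAbs : ℝ) * H (sgs b i) = H b := by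
    conv_rhs => rw [← sum_sgs b]
    rw [map_sum]
    exact Finset.sum_congr rfl fun i _ => by rw [map_nsmul, nsmul_eq_mul]
  have h2 : ∑ i, ((b i).natAbs : ℝ) = l1 b := by rw [l1]; push_cast; rfl
  obtain ⟨i0, hi0⟩ := exists_ne_of_l1 (y := b) (by omega)
  have h3 : ∑ i, ((b i).natAbs : ℝ) * (H b - κ * n) < ∑ i, ((b i).natAbs : ℝ) * H (sgs b i) := by
    refine Finset.sum_lt_sum (fun i _ => ?_) ⟨i0, Finset.mem_univ _, ?_⟩
    · by_cases hi : b i = 0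
      · simp [hi]
      · have := hc i hi
        rw [map_sub] at this
        exact mul_le_mul_of_nonneg_left (by linarith) (Nat.cast_nonneg _)
    · have := hc i0 hi0
      rw [map_sub] at this
      have h5 : (0 : ℝ) < ((b i0).natAbs : ℝ) := by
        exact_mod_cast Int.natAbs_pos.2 hi0
      exact mul_lt_mul_of_pos_left (by linarith) h5
  rw [h1, ← Finset.sum_mul, h2, hb] at h3
  rw [hb] at hκ
  push_cast at h3 hκ
  have hn : (0 : ℝ) ≤ n := Nat.cast_nonneg n
  nlinarith

lemma sorted_path (H : Pt d →+ ℝ) (κ : ℝ) (n : ℕ) : ∀ b : Pt d, l1 b = n → κ * l1 b ≤ H b →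
    ∃ σ : List (Pt d), IsPath σ ∧ σ.length = n ∧ disp σ = b ∧
      ∀ k ≤ n, l1 (pos σ k) = k ∧ κ * k ≤ H (pos σ k) := by
  induction n with
  | zero =>
    intro b hb _
    refine ⟨[], isPath_nil, rfl, ?_, ?_⟩
    · rw [l1_eq_zero.1 hb]; simp
    · intro k hk
      obtain rfl : k = 0 := by omega
      simp [l1_zero]
  | succ n ih =>
    intro b hb hκ
    obtain ⟨i, hi, hH⟩ := exists_good_dir H hb hκ
    have h1 := l1_sub_sgs hi
    have h2 : l1 (b - sgs b i) = n := by omega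
    obtain ⟨σ, p1, p2, p3, p4⟩ := ih (b - sgs b i) h2 (by rw [h2]; exact hH)
    have hd : disp (σ ++ [sgs b i]) = b := by rw [disp_append, p3]; simp [disp]
    refine ⟨σ ++ [sgs b i], isPath_append.2 ⟨p1, isPath_cons.2 ⟨sgs_step hi, isPath_nil⟩⟩,
      by simp [p2], hd, ?_⟩
    intro k hk
    rcases Nat.lt_or_ge n k with h | h
    · obtain rfl : k = n + 1 := by omega
      rw [pos_of_length_le _ (by simp [p2]), hd]
      refine ⟨hb, ?_⟩
      rw [hb] at hκ
      exact hκ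
    · rw [pos_append_left _ _ (by omega)]
      exact p4 k h

lemma pos_reverse (σ : List (Pt d)) {k : ℕ} (hk : k ≤ σ.length) :
    disp σ - pos σ.reverse k = pos σ (σ.length - k) := by
  have h1 : pos σ.reverse k = disp (σ.drop (σ.length - k)) := by
    rw [pos, List.take_reverse, List.sum_reverse, disp]
  have h2 : disp σ = pos σ (σ.length - k) + disp (σ.drop (σ.length - k)) := by
    rw [← disp_take, ← disp_append, List.take_append_drop]
  rw [h1, h2]; abel

lemma connector (H : Pt d →+ ℝ) {κ : ℝ} (a b : Pt d) (ha : κ * l1 a ≤ H a) (hb : κ * l1 b ≤ H b) :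
    ∃ σ : List (Pt d), IsPath σ ∧ σ.length = l1 a + l1 b ∧ disp σ = a + b ∧ pos σ (l1 a) = a ∧
      (∀ k ≤ l1 a, l1 (a - pos σ k) = l1 a - k ∧ κ * l1 (a - pos σ k) ≤ H (a - pos σ k)) ∧
      (∀ k ≤ l1 b, l1 (pos σ (l1 a + k) - a) = k ∧
        κ * l1 (pos σ (l1 a + k) - a) ≤ H (pos σ (l1 a + k) - a)) := by
  obtain ⟨σ, p1, p2, p3, p4⟩ := sorted_path H κ _ a rfl ha
  obtain ⟨τ, q1, q2, q3, q4⟩ := sorted_path H κ _ b rfl hb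
  have hl : σ.reverse.length = l1 a := by simp [p2]
  have hdr : disp σ.reverse = a := by rw [disp, List.sum_reverse, ← p3, disp]
  refine ⟨σ.reverse ++ τ, isPath_append.2 ⟨fun s hs => p1 s (List.mem_reverse.1 hs), q1⟩,
    by simp [p2, q2], by rw [disp_append, hdr, q3], ?_, ?_, ?_⟩
  · rw [pos_append_left _ _ hl.ge, ← hl, pos_length, hdr]
  · intro k hk
    rw [pos_append_left _ _ (by omega)]
    have h := pos_reverse σ (k := k) (by omega)
    rw [p3, p2] at h
    obtain ⟨r1, r2⟩ := p4 (l1 a - k) (by omega)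
    rw [h]
    refine ⟨r1, ?_⟩
    rw [r1]; exact r2
  · intro k hk
    have h : pos (σ.reverse ++ τ) (l1 a + k) - a = pos τ k := by
      rw [← hl, pos_append_right, hdr]; abel
    rw [h]
    obtain ⟨r1, r2⟩ := q4 k hk
    refine ⟨r1, ?_⟩
    rw [r1]; exact r2

/-- Result of local surgery: `α ++ η ++ β` is replaced by `α ++ σ ++ β`. -/
structure Surg (H : Pt d →+ ℝ) (κ : ℝ) (L L' : ℕ) (u : Pt d) (α η β σ : List (Pt d)) (s : ℕ) :
    Prop where
  κpos : 0 < κ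
  hα : IsPath α
  hη : IsPath η
  hβ : IsPath β
  hσ : IsPath σ
  hd : disp σ = disp η
  sL : s ≤ L
  sl : s ≤ σ.length
  ls : σ.length ≤ s + L
  hu : disp α + pos σ s = u
  c1 : ∀ k ≤ s, l1 (u - (disp α + pos σ k)) = s - k ∧
    κ * l1 (u - (disp α + pos σ k)) ≤ H (u - (disp α + pos σ k))
  c2 : ∀ k, s + k ≤ σ.length → l1 (disp α + pos σ (s + k) - u) = k ∧
    κ * l1 (disp α + pos σ (s + k) - u) ≤ H (disp α + pos σ (s + k) - u)
  bef : ∀ j < α.length, L < l1 (pos α j - u) ∧ κ * l1 (u - pos α j) ≤ H (u - pos α j)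
  aft : ∀ j, 0 < j → j ≤ β.length → L < l1 (disp α + disp σ + pos β j - u) ∧
    κ * l1 (disp α + disp σ + pos β j - u) ≤ H (disp α + disp σ + pos β j - u)
  mid : ∀ j ≤ η.length, l1 (disp α + pos η j - u) ≤ L'
  LL : L ≤ L'
  bne : 0 < β.length

lemma surg_exists {H : Pt d →+ ℝ} {κ : ℝ} {L L' : ℕ} {γ : List (Pt d)} {u : Pt d} (hκ : 0 < κ)
    (hL : L ≤ L') (hγ : IsPath γ) (h : Reg H κ L L' γ u) :
    ∃ α η β σ s, γ = α ++ (η ++ β) ∧ Surg H κ L L' u α η β σ s := by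
  obtain ⟨k1, k2, h12, hk2, r1, r2, r3, r4, r5, r6, r7⟩ := h
  obtain ⟨σ, p1, p2, p3, p4, p5, p6⟩ := connector H (κ := κ) (u - pos γ k1) (pos γ k2 - u) r6 r7
  have e1 : (γ.take k1).length = k1 := by simp; omega
  have e2 : ((γ.drop k1).take (k2 - k1)).length = k2 - k1 := by simp; omega
  have e3 : disp ((γ.drop k1).take (k2 - k1)) = pos γ k2 - pos γ k1 := by
    rw [disp_take]
    have := pos_drop γ k1 (k2 - k1)
    rw [show k1 + (k2 - k1) = k2 by omega] at this
    rw [this]; abel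
  have e4 : disp σ = pos γ k2 - pos γ k1 := by rw [p3]; abel
  have e5 : disp (γ.take k1) = pos γ k1 := disp_take γ k1
  have hLs : l1 (u - pos γ k1) ≤ L := by rw [l1_sub_comm]; exact r4
  refine ⟨γ.take k1, (γ.drop k1).take (k2 - k1), γ.drop k2, σ, l1 (u - pos γ k1), ?_, hκ,
    hγ.take _, (hγ.drop _).take _, hγ.drop _, p1, by rw [e3, e4], hLs, by omega, by omega, ?_, ?_,
    ?_, ?_, ?_, ?_, hL, ?_⟩
  · have : γ.drop k2 = (γ.drop k1).drop (k2 - k1) := by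
      rw [List.drop_drop]; congr 1; omega
    rw [this, List.take_append_drop, List.take_append_drop]
  · rw [p4, e5]; abel
  · intro k hk
    have := p5 k hk
    rw [e5, show u - (pos γ k1 + pos σ k) = u - pos γ k1 - pos σ k by abel]
    exact this
  · intro k hk
    have := p6 k (by omega)
    rw [e5, show ∀ z, pos γ k1 + z - u = z - (u - pos γ k1) by intro z; abel]
    exact this
  · intro j hj
    rw [e1] at hj
    rw [pos_take _ hj.le]
    exact r1 j hj
  · intro j hj0 hj
    have h1 : disp (γ.take k1) + disp σ + pos (γ.drop k2) j = pos γ (k2 + j) := by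
      rw [pos_drop, e4, e5]; abel
    rw [h1]
    rw [List.length_drop] at hj
    exact r2 (k2 + j) (by omega) (by omega)
  · intro j hj
    rw [e2] at hj
    rw [pos_take _ hj, e5, ← pos_drop]
    exact r3 _ (by omega) (by omega)
  · rw [List.length_drop]; omega

end PartG

end SIRW

namespace SIRW

section PartG2

variable {d : ℕ}

variable {H : Pt d →+ ℝ} {κ : ℝ} {L L' : ℕ} {u : Pt d} {α η β σ : List (Pt d)} {s : ℕ}

/-- Three-piece local time. -/
lemma loc_three (α η β : List (Pt d)) (v : Pt d) : locTime (α ++ (η ++ β)) v =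
    (pre α v + pst β (v - disp α - disp η)) + locTime η (v - disp α) := by
  rw [loc_append, loc_append']; ring

lemma three_cases (α η β : List (Pt d)) {j : ℕ} (hj : j ≤ (α ++ (η ++ β)).length) :
    (j < α.length ∧ pos (α ++ (η ++ β)) j = pos α j) ∨
    (∃ i ≤ η.length, j = α.length + i ∧ pos (α ++ (η ++ β)) j = disp α + pos η i) ∨
    (∃ i, 0 < i ∧ i ≤ β.length ∧ j = α.length + η.length + i ∧
      pos (α ++ (η ++ β)) j = disp α + disp η + pos β i) := by
  simp only [List.length_append] at hj
  by_cases h1 : j < α.length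
  · exact Or.inl ⟨h1, pos_append_left _ _ h1.le⟩
  by_cases h2 : j ≤ α.length + η.length
  · refine Or.inr (Or.inl ⟨j - α.length, by omega, by omega, ?_⟩)
    obtain ⟨i, rfl⟩ : ∃ i, j = α.length + i := ⟨j - α.length, by omega⟩
    rw [pos_append_right, pos_append_left _ _ (by omega), Nat.add_sub_cancel_left]
  · obtain ⟨i, rfl⟩ : ∃ i, j = α.length + (η.length + i) :=
      ⟨j - α.length - η.length, by omega⟩
    refine Or.inr (Or.inr ⟨i, by omega, by omega, by omega, ?_⟩)
    rw [pos_append_right, pos_append_right]; abel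

lemma pos_three_mid (α η β : List (Pt d)) {i : ℕ} (hi : i ≤ η.length) :
    pos (α ++ (η ++ β)) (α.length + i) = disp α + pos η i := by
  rw [pos_append_right, pos_append_left _ _ hi]

lemma pos_three_end (α η β : List (Pt d)) (i : ℕ) :
    pos (α ++ (η ++ β)) (α.length + η.length + i) = disp α + disp η + pos β i := by
  rw [add_assoc, pos_append_right, pos_append_right]; abel

namespace Surg

lemma near (T : Surg H κ L L' u α η β σ s) {k : ℕ} (hk : k ≤ σ.length) :
    l1 (disp α + pos σ k - u) ≤ L := by
  rcases le_total k s with h | h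
  · rw [l1_sub_comm, (T.c1 k h).1]
    have := T.sL; omega
  · obtain ⟨j, rfl⟩ := Nat.exists_eq_add_of_le h
    rw [(T.c2 j hk).1]
    have := T.ls; omega

lemma inj (T : Surg H κ L L' u α η β σ s) {j k : ℕ} (hj : j ≤ σ.length) (hk : k ≤ σ.length)
    (h : pos σ j = pos σ k) : j = k := by
  have key : ∀ a b, a ≤ s → s + b ≤ σ.length → pos σ a = pos σ (s + b) → a = s + b := by
    intro a b ha hb he
    obtain ⟨p1, p2⟩ := T.c1 a ha
    obtain ⟨q1, q2⟩ := T.c2 b hb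
    rw [← he] at q1 q2
    rw [l1_sub_comm] at q1
    have e : H (disp α + pos σ a - u) = - H (u - (disp α + pos σ a)) := by
      rw [← map_neg]; congr 1; abel
    rw [l1_sub_comm, p1] at q2
    rw [p1] at p2 q1
    have h3 : κ * ((s - a : ℕ) : ℝ) ≤ 0 := by linarith
    have h4 : ((s - a : ℕ) : ℝ) ≤ 0 := by
      by_contra hc
      push Not at hc
      have := mul_pos T.κpos hc
      linarith
    have h5 : s - a = 0 := by exact_mod_cast le_antisymm h4 (Nat.cast_nonneg _)
    omega
  rcases le_total j s with h1 | h1 <;> rcases le_total k s with h2 | h2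
  · have p := (T.c1 j h1).1
    have q := (T.c1 k h2).1
    rw [h] at p; omega
  · obtain ⟨b, rfl⟩ := Nat.exists_eq_add_of_le h2
    exact key _ _ h1 hk h
  · obtain ⟨b, rfl⟩ := Nat.exists_eq_add_of_le h1
    exact (key _ _ h2 hj h.symm).symm
  · obtain ⟨a, rfl⟩ := Nat.exists_eq_add_of_le h1
    obtain ⟨b, rfl⟩ := Nat.exists_eq_add_of_le h2
    have p := (T.c2 a hj).1
    have q := (T.c2 b hk).1
    rw [h] at p; omega

lemma loc_le_one (T : Surg H κ L L' u α η β σ s) (v : Pt d) : locTime σ v ≤ 1 := by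
  rw [locTime, Finset.card_le_one]
  intro a ha b hb
  simp only [Finset.mem_filter, Finset.mem_range] at ha hb
  exact T.inj (by omega) (by omega) (ha.2.trans hb.2.symm)

lemma locσ_zero (T : Surg H κ L L' u α η β σ s) {v : Pt d} (hv : L < l1 (v - u)) :
    locTime σ (v - disp α) = 0 := by
  by_contra hc
  obtain ⟨k, hk, he⟩ := (loc_pos_iff _ _).1 (Nat.pos_of_ne_zero hc)
  have := T.near hk
  rw [he, show disp α + (v - disp α) - u = v - u by abel] at this
  omega

lemma locη_zero (T : Surg H κ L L' u α η β σ s) {v : Pt d} (hv : L' < l1 (v - u)) :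
    locTime η (v - disp α) = 0 := by
  by_contra hc
  obtain ⟨k, hk, he⟩ := (loc_pos_iff _ _).1 (Nat.pos_of_ne_zero hc)
  have := T.mid k hk
  rw [he, show disp α + (v - disp α) - u = v - u by abel] at this
  omega

lemma out_zero (T : Surg H κ L L' u α η β σ s) {v : Pt d} (hv : l1 (v - u) ≤ L) :
    pre α v + pst β (v - disp α - disp σ) = 0 := by
  by_contra hc
  have : 0 < pre α v ∨ 0 < pst β (v - disp α - disp σ) := by omega
  rcases this with h | h
  · obtain ⟨k, hk, he⟩ := (pre_pos_iff _ _).1 h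
    have := (T.bef k hk).1
    rw [he] at this; omega
  · obtain ⟨k, hk, he⟩ := (pst_pos_iff _ _).1 h
    have := (T.aft (k + 1) (by omega) hk).1
    rw [he, show disp α + disp σ + (v - disp α - disp σ) - u = v - u by abel] at this
    omega

lemma loc_agree (T : Surg H κ L L' u α η β σ s) {v : Pt d} (hv : L' < l1 (v - u)) :
    locTime (α ++ (σ ++ β)) v = locTime (α ++ (η ++ β)) v := by
  rw [loc_three, loc_three, T.locη_zero hv, T.locσ_zero (lt_of_le_of_lt T.LL hv), T.hd]

lemma loc_u (T : Surg H κ L L' u α η β σ s) : locTime (α ++ (σ ++ β)) u = 1 := by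
  rw [loc_three, T.out_zero (by simp [l1_zero]), zero_add]
  refine le_antisymm (T.loc_le_one _) ?_
  refine (loc_pos_iff _ _).2 ⟨s, T.sl, ?_⟩
  rw [← T.hu]; abel

lemma mem_H (T : Surg H κ L L' u α η β σ s) {x : Pt d} (h : α ++ (η ++ β) ∈ Hpaths x) :
    α ++ (σ ++ β) ∈ Hpaths x := by
  obtain ⟨h1, h2, h3⟩ := h
  have hdx : disp α + disp σ + disp β = x := by
    rw [← h2, disp_append, disp_append, T.hd]; abel
  refine ⟨isPath_append.2 ⟨T.hα, isPath_append.2 ⟨T.hσ, T.hβ⟩⟩, ?_, ?_⟩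
  · rw [disp_append, disp_append, ← hdx]; abel
  · have hb := T.bne
    have hx := (T.aft β.length hb le_rfl).1
    rw [pos_length, hdx] at hx
    rw [loc_three, T.locσ_zero hx]
    rw [loc_three, ← T.hd] at h3
    have : 0 < pst β (x - disp α - disp σ) := by
      refine (pst_pos_iff _ _).2 ⟨β.length - 1, by omega, ?_⟩
      rw [show β.length - 1 + 1 = β.length by omega, pos_length, ← hdx]; abel
    omega

end Surg

/-- `p` is a once-visited vertex whose `κ`-double-cone contains the path. -/
def ConeV (H : Pt d →+ ℝ) (κ : ℝ) (γ : List (Pt d)) (p : Pt d) : Prop :=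
  locTime γ p = 1 ∧ ∀ v, 0 < locTime γ v →
    κ * l1 (v - p) ≤ H (v - p) ∨ κ * l1 (p - v) ≤ H (p - v)

namespace Surg

lemma coneV (T : Surg H κ L L' u α η β σ s) : ConeV H κ (α ++ (σ ++ β)) u := by
  refine ⟨T.loc_u, fun v hv => ?_⟩
  obtain ⟨j, hj, rfl⟩ := (loc_pos_iff _ _).1 hv
  rcases three_cases α σ β hj with ⟨h1, h2⟩ | ⟨i, hi, _, h2⟩ | ⟨i, hi0, hi, _, h2⟩
  · rw [h2]; exact Or.inr (T.bef j h1).2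
  · rw [h2]
    rcases le_total i s with h | h
    · exact Or.inr (T.c1 i h).2
    · obtain ⟨k, rfl⟩ := Nat.exists_eq_add_of_le h
      exact Or.inl (T.c2 k hi).2
  · rw [h2]; exact Or.inl (T.aft i hi0 hi).2

end Surg

section reg

variable {C1 : ℝ} {S : ℕ} {u' : Pt d}

lemma far_cone (hκ : 0 < κ) (hC : ∀ y, |H y| ≤ C1 * l1 y) (hC0 : 0 ≤ C1)
    (hS2 : (C1 + κ) * L ≤ κ * S) {w : Pt d} (hw : S < l1 w) (hH : 2 * κ * l1 w ≤ H w) {y : Pt d}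
    (hy : l1 y ≤ L) : κ * l1 (w + y) ≤ H (w + y) := by
  have h1 : (l1 (w + y) : ℝ) ≤ l1 w + l1 y := by exact_mod_cast l1_add w y
  have h2 := (abs_le.1 (hC y)).1
  have h3 : (l1 y : ℝ) ≤ L := by exact_mod_cast hy
  have h4 : (S : ℝ) < l1 w := by exact_mod_cast hw
  rw [map_add]
  have h5 : C1 * l1 y ≤ C1 * L := mul_le_mul_of_nonneg_left h3 hC0
  have h6 : κ * l1 y ≤ κ * L := mul_le_mul_of_nonneg_left h3 hκ.le
  have h7 : κ * l1 (w + y) ≤ κ * (l1 w + l1 y) := mul_le_mul_of_nonneg_left h1 hκ.le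
  have h8 : κ * S ≤ κ * l1 w := mul_le_mul_of_nonneg_left h4.le hκ.le
  linarith

lemma far_sign (hκ : 0 < κ) (hC : ∀ y, |H y| ≤ C1 * l1 y) (hC0 : 0 ≤ C1)
    (hS2 : (C1 + κ) * L ≤ κ * S) {w : Pt d} (hw : S < l1 w) {y : Pt d}
    (hy : l1 y ≤ L) (hH : κ * l1 (w + y) ≤ H (w + y)) : 0 < H w := by
  have h1 : (l1 w : ℝ) ≤ l1 (w + y) + l1 y := by
    have := l1_add (w + y) (-y)
    rw [l1_neg, add_neg_cancel_right] at this
    exact_mod_cast this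
  have h2 := (abs_le.1 (hC y)).2
  have h3 : (l1 y : ℝ) ≤ L := by exact_mod_cast hy
  have h4 : (S : ℝ) < l1 w := by exact_mod_cast hw
  rw [map_add] at hH
  have h5 : C1 * l1 y ≤ C1 * L := mul_le_mul_of_nonneg_left h3 hC0
  have h6 : κ * l1 y ≤ κ * L := mul_le_mul_of_nonneg_left h3 hκ.le
  have h7 : κ * l1 w ≤ κ * (l1 (w + y) + l1 y) := mul_le_mul_of_nonneg_left h1 hκ.le
  have h8 : κ * S < κ * l1 w := mul_lt_mul_of_pos_left h4 hκ
  linarith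

lemma far_far (hS : 2 * L ≤ S) {w y : Pt d} (hw : S < l1 w) (hy : l1 y ≤ L) : L < l1 (w + y) := by
  have := l1_add (w + y) (-y)
  rw [l1_neg, add_neg_cancel_right] at this
  omega

lemma Surg.reg (T : Surg H κ L L' u α η β σ s) (hC : ∀ y, |H y| ≤ C1 * l1 y) (hC0 : 0 ≤ C1)
    (hS1 : 2 * L' ≤ S) (hS2 : (C1 + κ) * L ≤ κ * S) (hw : S < l1 (u - u'))
    (hH : 2 * κ * l1 (u - u') ≤ H (u - u') ∨ 2 * κ * l1 (u' - u) ≤ H (u' - u))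
    (hR : Reg H κ L L' (α ++ (η ++ β)) u') : Reg H κ L L' (α ++ (σ ++ β)) u' := by
  have hκ := T.κpos
  have hLL := T.LL
  have hS3 : 2 * L ≤ S := by omega
  have hw' : S < l1 (u' - u) := by rw [l1_sub_comm]; exact hw
  obtain ⟨k1, k2, h12, hk2, r1, r2, r3, r4, r5, r6, r7⟩ := hR
  simp only [List.length_append] at hk2
  have hneg : H (u - u') = - H (u' - u) := by rw [← map_neg]; congr 1; abel
  have hl : ∀ w : Pt d, 0 ≤ 2 * κ * l1 w := fun w => by positivity
  -- separation
  have hsep : k2 < α.length ∨ α.length + η.length < k1 := by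
    by_contra hc
    push Not at hc
    obtain ⟨j, hj1, hj2, hj3, hj4⟩ : ∃ j, k1 ≤ j ∧ j ≤ k2 ∧ α.length ≤ j ∧
        j ≤ α.length + η.length := ⟨max k1 α.length, by omega, by omega, by omega, by omega⟩
    have h1 := r3 j hj1 hj2
    obtain ⟨i, rfl⟩ := Nat.exists_eq_add_of_le hj3
    rw [pos_three_mid _ _ _ (by omega)] at h1
    have h2 := T.mid i (by omega)
    have h3 := l1_sub_le u (disp α + pos η i) u'
    rw [l1_sub_comm u (disp α + pos η i)] at h3
    omega
  rcases hsep with hs | hs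
  · -- u' before u
    have hpl : ∀ j ≤ k2, ∀ ζ : List (Pt d), pos (α ++ ζ) j = pos α j :=
      fun j hj ζ => pos_append_left _ _ (by omega)
    have hsg : 0 < H (u - u') := by
      have h1 := (r2 α.length hs (by simp)).2
      have h2 : pos (α ++ (η ++ β)) α.length = disp α := by
        rw [pos_append_left _ _ le_rfl, pos_length]
      rw [h2] at h1
      have h3 : l1 (disp α - u) ≤ L := by simpa using T.near (k := 0) (Nat.zero_le _)
      refine far_sign hκ hC hC0 hS2 hw h3 ?_
      rw [show u - u' + (disp α - u) = disp α - u' by abel]; exact h1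
    have hH' : 2 * κ * l1 (u - u') ≤ H (u - u') := by
      rcases hH with h | h
      · exact h
      · have := hl (u' - u); linarith
    refine ⟨k1, k2, h12, by simp only [List.length_append]; omega, ?_, ?_, ?_, ?_, ?_, ?_, ?_⟩
    · intro j hj
      have := r1 j hj
      rw [hpl j (by omega)] at this ⊢
      exact this
    · intro j hj1 hj2
      rcases three_cases α σ β hj2 with ⟨h1, h2⟩ | ⟨i, hi, _, h2⟩ | ⟨i, hi0, hi, _, h2⟩
      · have := r2 j hj1 (by simp only [List.length_append]; omega)
        rw [pos_append_left _ _ h1.le] at this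
        rw [h2]; exact this
      · rw [h2]
        have h3 := T.near hi
        have e : disp α + pos σ i - u' = (u - u') + (disp α + pos σ i - u) := by abel
        rw [e]
        exact ⟨far_far hS3 hw h3, far_cone hκ hC hC0 hS2 hw hH' h3⟩
      · have := r2 (α.length + η.length + i) (by omega) (by simp only [List.length_append]; omega)
        rw [pos_three_end, ← T.hd] at this
        rw [h2]; exact this
    · intro j hj1 hj2
      have := r3 j hj1 hj2
      rw [hpl j (by omega)] at this ⊢
      exact this
    · rw [hpl k1 h12] at r4 ⊢; exact r4
    · rw [hpl k2 le_rfl] at r5 ⊢; exact r5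
    · rw [hpl k1 h12] at r6 ⊢; exact r6
    · rw [hpl k2 le_rfl] at r7 ⊢; exact r7
  · -- u before u'
    obtain ⟨a, ha⟩ : ∃ a, k1 = α.length + η.length + a := ⟨k1 - α.length - η.length, by omega⟩
    obtain ⟨b, hb⟩ : ∃ b, k2 = α.length + η.length + b := ⟨k2 - α.length - η.length, by omega⟩
    subst ha hb
    have hpe : ∀ j, pos (α ++ (σ ++ β)) (α.length + σ.length + j) =
        pos (α ++ (η ++ β)) (α.length + η.length + j) := by
      intro j; rw [pos_three_end, pos_three_end, T.hd]
    have hsg : 0 < H (u' - u) := by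
      have h1 := (r1 (α.length + η.length) (by omega)).2
      have h2 : pos (α ++ (η ++ β)) (α.length + η.length) = disp α + disp σ := by
        have := pos_three_end α η β 0
        simp only [add_zero, pos_zero] at this
        rw [this, T.hd]
      rw [h2] at h1
      have h3 : l1 (u - (disp α + disp σ)) ≤ L := by
        have := T.near (k := σ.length) le_rfl
        rw [l1_sub_comm]; simpa using this
      refine far_sign hκ hC hC0 hS2 hw' h3 ?_
      rw [show u' - u + (u - (disp α + disp σ)) = u' - (disp α + disp σ) by abel]; exact h1
    have hH' : 2 * κ * l1 (u' - u) ≤ H (u' - u) := by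
      rcases hH with h | h
      · have := hl (u - u'); linarith
      · exact h
    refine ⟨α.length + σ.length + a, α.length + σ.length + b, by omega,
      by simp only [List.length_append]; omega, ?_, ?_, ?_, ?_, ?_, ?_, ?_⟩
    · intro j hj
      rcases three_cases α σ β (j := j) (by simp only [List.length_append]; omega) with
        ⟨h1, h2⟩ | ⟨i, hi, _, h2⟩ | ⟨i, hi0, hi, hji, h2⟩
      · have := r1 j (by omega)
        rw [pos_append_left _ _ h1.le] at this
        rw [h2]; exact this
      · rw [h2]
        have h3 := T.near hi
        have h3' : l1 (u - (disp α + pos σ i)) ≤ L := by rw [l1_sub_comm]; exact h3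
        have e : u' - (disp α + pos σ i) = (u' - u) + (u - (disp α + pos σ i)) := by abel
        rw [l1_sub_comm (disp α + pos σ i) u', e]
        exact ⟨far_far hS3 hw' h3', far_cone hκ hC hC0 hS2 hw' hH' h3'⟩
      · have := r1 (α.length + η.length + i) (by omega)
        rw [hji, hpe]; exact this
    · intro j hj1 hj2
      obtain ⟨i, rfl⟩ : ∃ i, j = α.length + σ.length + i := ⟨j - α.length - σ.length, by omega⟩
      simp only [List.length_append] at hj2
      rw [hpe]
      exact r2 _ (by omega) (by simp only [List.length_append]; omega)
    · intro j hj1 hj2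
      obtain ⟨i, rfl⟩ : ∃ i, j = α.length + σ.length + i := ⟨j - α.length - σ.length, by omega⟩
      rw [hpe]
      exact r3 _ (by omega) (by omega)
    · rw [hpe]; exact r4
    · rw [hpe]; exact r5
    · rw [hpe]; exact r6
    · rw [hpe]; exact r7

end reg

section weight

variable {φ : ℕ → ℝ≥0∞} {lam : ℝ} {ψ : List (Pt d) → ℝ≥0∞} {c0 : ℝ} {A : ℝ≥0∞}

/-- surgery constant -/
def CLs (φ : ℕ → ℝ≥0∞) (lam : ℝ) (L : ℕ) : ℝ≥0∞ :=
  (expNegE (((2 * L + 1 : ℕ) : ℝ≥0∞) * φ 1) * eL |lam| (2 * L))⁻¹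

lemma Good.CLs_ne_top (G : Good d φ lam ψ c0 A) (L : ℕ) : CLs φ lam L ≠ ⊤ := by
  refine ENNReal.inv_ne_top.2 (mul_ne_zero (expNegE_ne_zero ?_) (eL_ne_zero _ _))
  exact ENNReal.mul_ne_top (ENNReal.natCast_ne_top _) G.fin1

lemma Good.CLs_one (G : Good d φ lam ψ c0 A) (hl : σ.length ≤ 2 * L)
    (hone : ∀ v, locTime σ v ≤ 1) :
    1 ≤ CLs φ lam L * (expNegE (Phi φ (locTime σ)) * eL lam σ.length) := by
  have h1 : Phi φ (locTime σ) ≤ ((2 * L + 1 : ℕ) : ℝ≥0∞) * φ 1 := by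
    rw [← PotE_eq G.h0, PotE]
    calc ∑ x ∈ visited σ, φ (locTime σ x) ≤ ∑ x ∈ visited σ, φ 1 :=
          Finset.sum_le_sum fun x _ => G.mono (hone x)
      _ = ((visited σ).card : ℝ≥0∞) * φ 1 := by simp
      _ ≤ _ := by
          gcongr
          refine Finset.card_image_le.trans ?_
          simp only [Finset.card_range]; omega
  have h2 : eL |lam| (2 * L) ≤ eL lam σ.length := by
    unfold eL
    refine ENNReal.ofReal_le_ofReal (Real.exp_le_exp.2 (neg_le_neg ?_))
    calc lam * σ.length ≤ |lam| * σ.length := by gcongr; exact le_abs_self _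
      _ ≤ _ := by gcongr
  have hne : expNegE (((2 * L + 1 : ℕ) : ℝ≥0∞) * φ 1) * eL |lam| (2 * L) ≠ 0 :=
    mul_ne_zero (expNegE_ne_zero (ENNReal.mul_ne_top (ENNReal.natCast_ne_top _) G.fin1))
      (eL_ne_zero _ _)
  calc (1 : ℝ≥0∞) = CLs φ lam L *
        (expNegE (((2 * L + 1 : ℕ) : ℝ≥0∞) * φ 1) * eL |lam| (2 * L)) := by
        rw [CLs, ENNReal.inv_mul_cancel hne
          (ENNReal.mul_ne_top (expNegE_ne_top _) (eL_ne_top _ _))]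
    _ ≤ _ := by
        gcongr
        exact expNegE_anti h1

lemma Surg.CLs_one (G : Good d φ lam ψ c0 A) (T : Surg H κ L L' u α η β σ s) :
    1 ≤ CLs φ lam L * (expNegE (Phi φ (locTime σ)) * eL lam σ.length) :=
  G.CLs_one (by have := T.ls; have := T.sL; omega) T.loc_le_one

lemma Surg.weight (G : Good d φ lam ψ c0 A) (T : Surg H κ L L' u α η β σ s) :
    wE φ lam (α ++ (η ++ β)) ≤
      CLs φ lam L * (ψ η * eL lam η.length) * wE φ lam (α ++ (σ ++ β)) := by
  set f : Pt d → ℕ := fun v => pre α v + pst β (v - disp α - disp η) with hf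
  have h1 : expNegE (Phi φ (locTime (α ++ (η ++ β)))) ≤ expNegE (Phi φ f) * ψ η := by
    have := G.dec f η (disp α)
    have e : locTime (α ++ (η ++ β)) = fun x => f x + locTime η (x - disp α) := by
      funext v; rw [loc_three]
    rw [e]; exact this
  have h2 : Phi φ (locTime (α ++ (σ ++ β))) = Phi φ f + Phi φ (locTime σ) := by
    have e : locTime (α ++ (σ ++ β)) = fun x => f x + locTime σ (x - disp α) := by
      funext v; rw [loc_three, T.hd]
    rw [e, Phi_disj G.h0, Phi_shift]
    intro v
    by_cases hv : l1 (v - u) ≤ L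
    · left
      have := T.out_zero hv
      rw [T.hd] at this
      exact this
    · right; exact T.locσ_zero (by omega)
  have h3 := T.CLs_one G
  rw [wE_eq G.h0, wE_eq G.h0, h2, expNegE_add]
  simp only [List.length_append, eL_add]
  calc expNegE (Phi φ (locTime (α ++ (η ++ β)))) * (eL lam α.length *
        (eL lam η.length * eL lam β.length))
      ≤ (expNegE (Phi φ f) * ψ η) * (eL lam α.length *
        (eL lam η.length * eL lam β.length)) * 1 := by rw [mul_one]; gcongr
    _ ≤ (expNegE (Phi φ f) * ψ η) * (eL lam α.length *
        (eL lam η.length * eL lam β.length)) *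
        (CLs φ lam L * (expNegE (Phi φ (locTime σ)) * eL lam σ.length)) := by gcongr
    _ = _ := by ring

end weight

end PartG2

end SIRW

namespace SIRW

section PartG3

variable {d : ℕ}

variable {H : Pt d →+ ℝ} {κ : ℝ} {L L' S : ℕ}

/-- Paths that are obtained by at most `m` surgeries. -/
def Om (H : Pt d →+ ℝ) (κ : ℝ) (L L' S : ℕ) (x : Pt d) (M : ℕ) (P : List (Pt d) → Prop) (m : ℕ) :
    Set (List (Pt d)) :=
  {γ | γ ∈ Hpaths x ∧ ∃ (V U : Finset (Pt d)) (γ0 : List (Pt d)), V.card ≤ m ∧ M ≤ U.card + m ∧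
    Fam H κ L L' S γ U ∧ (∀ u ∈ U, ∀ v ∈ V, S < l1 (u - v)) ∧ (∀ v ∈ V, 0 < locTime γ v) ∧ P γ0 ∧
    ∀ w, (∀ v ∈ V, L' < l1 (w - v)) → locTime γ w = locTime γ0 w}

variable {x : Pt d} {M : ℕ} {P : List (Pt d) → Prop} {m : ℕ} {C1 : ℝ}

/-- `u` can be used for surgery. -/
def Rl (H : Pt d →+ ℝ) (κ : ℝ) (L L' S : ℕ) (x : Pt d) (M : ℕ) (P : List (Pt d) → Prop) (m : ℕ)
    (γ : List (Pt d)) (u : Pt d) : Prop :=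
  ∃ α η β σ s, γ = α ++ (η ++ β) ∧ Surg H κ L L' u α η β σ s ∧
    α ++ (σ ++ β) ∈ Om H κ L L' S x M P (m + 1)

lemma om_step (hκ : 0 < κ) (hL : L ≤ L') (hC : ∀ y, |H y| ≤ C1 * l1 y) (hC0 : 0 ≤ C1)
    (hS1 : 2 * L' ≤ S) (hS2 : (C1 + κ) * L ≤ κ * S) {γ : List (Pt d)}
    (hγ : γ ∈ Om H κ L L' S x M P m) :
    ∃ U : Finset (Pt d), M ≤ U.card + m ∧ ∀ u ∈ U, Rl H κ L L' S x M P m γ u := by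
  classical
  obtain ⟨hH, V, U, γ0, v1, v2, ⟨f1, f2⟩, v3, v4, v5, v6⟩ := hγ
  refine ⟨U, v2, fun u hu => ?_⟩
  obtain ⟨α, η, β, σ, s, rfl, T⟩ := surg_exists hκ hL hH.1 (f1 u hu)
  refine ⟨α, η, β, σ, s, rfl, T, T.mem_H hH, insert u V, U.erase u, γ0, ?_, ?_, ⟨?_, ?_⟩, ?_, ?_,
    v5, ?_⟩
  · exact (Finset.card_insert_le _ _).trans (by omega)
  · rw [Finset.card_erase_of_mem hu]; omega
  · intro u' hu'
    obtain ⟨h1, h2⟩ := Finset.mem_erase.1 hu'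
    obtain ⟨h3, h4⟩ := f2 u hu u' h2 (Ne.symm h1)
    exact T.reg hC hC0 hS1 hS2 h3 h4 (f1 u' h2)
  · intro a ha b hb hab
    exact f2 a (Finset.mem_of_mem_erase ha) b (Finset.mem_of_mem_erase hb) hab
  · intro a ha b hb
    obtain ⟨h1, h2⟩ := Finset.mem_erase.1 ha
    rcases Finset.mem_insert.1 hb with rfl | hb
    · exact (f2 a h2 b hu h1).1
    · exact v3 a h2 b hb
  · intro v hv
    rcases Finset.mem_insert.1 hv with rfl | hv
    · rw [T.loc_u]; exact Nat.one_pos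
    · have := v3 u hu v hv
      rw [l1_sub_comm] at this
      rw [T.loc_agree (by omega)]
      exact v4 v hv
  · intro w hw
    rw [T.loc_agree (hw u (Finset.mem_insert_self _ _))]
    exact v6 w fun v hv => hw v (Finset.mem_insert_of_mem hv)

lemma om_count (hκ : 0 < κ) (hC : ∀ y, |H y| ≤ C1 * l1 y) (hC0 : 0 ≤ C1) {R : ℕ} (hR1 : L' ≤ R)
    (hR2 : (C1 + κ / 2) * L' ≤ κ / 2 * R) {n0 : ℕ}
    (hP : ∀ γ0, P γ0 → ∀ T : Finset (Pt d), (∀ p ∈ T, ConeV H (κ / 2) γ0 p) → T.card ≤ n0)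
    {γ : List (Pt d)} (hγ : γ ∈ Om H κ L L' S x M P m) (T : Finset (Pt d))
    (hT : ∀ p ∈ T, ConeV H κ γ p) : T.card ≤ n0 + m * (2 * R + 1) ^ d := by
  classical
  obtain ⟨hH, V, U, γ0, v1, v2, -, v3, v4, v5, v6⟩ := hγ
  obtain ⟨Q, hQ⟩ : ∃ Q : Pt d → Prop, ∀ p, Q p ↔ ∀ v ∈ V, R < l1 (p - v) := ⟨_, fun _ => Iff.rfl⟩
  have h1 : (T.filter fun p => Q p).card ≤ n0 := by
    refine hP γ0 v5 _ fun p hp => ?_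
    obtain ⟨hp1, hp2⟩ := Finset.mem_filter.1 hp
    rw [hQ] at hp2
    obtain ⟨c1, c2⟩ := hT p hp1
    refine ⟨?_, fun w hw => ?_⟩
    · rw [← v6 p fun v hv => lt_of_le_of_lt hR1 (hp2 v hv)]; exact c1
    · by_cases hf : ∀ v ∈ V, L' < l1 (w - v)
      · rw [← v6 w hf] at hw
        rcases c2 w hw with h | h
        · left
          have : 0 ≤ κ * l1 (w - p) := by positivity
          linarith
        · right
          have : 0 ≤ κ * l1 (p - w) := by positivity
          linarith
      · push Not at hf
        obtain ⟨v, hv, hvw⟩ := hf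
        have hpv := hp2 v hv
        rcases c2 v (v4 v hv) with h | h
        · left
          rw [show w - p = (v - p) + (w - v) by abel]
          refine far_cone (half_pos hκ) hC hC0 hR2 (by rw [l1_sub_comm]; exact hpv) ?_ hvw
          rw [show 2 * (κ / 2) = κ by ring]; exact h
        · right
          rw [show p - w = (p - v) + (v - w) by abel]
          refine far_cone (half_pos hκ) hC hC0 hR2 hpv ?_ (by rw [l1_sub_comm]; exact hvw)
          rw [show 2 * (κ / 2) = κ by ring]; exact h
  have h2 : (T.filter fun p => ¬ Q p).card ≤ m * (2 * R + 1) ^ d := by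
    have hsub : (T.filter fun p => ¬ Q p) ⊆
        V.biUnion fun v => (boxF d R).image fun y => y + v := by
      intro p hp
      have hp2 := (Finset.mem_filter.1 hp).2
      rw [hQ] at hp2
      push Not at hp2
      obtain ⟨v, hv, hpv⟩ := hp2
      exact Finset.mem_biUnion.2 ⟨v, hv, Finset.mem_image.2 ⟨p - v, mem_boxF_of hpv, by abel⟩⟩
    refine (Finset.card_le_card hsub).trans ((Finset.card_biUnion_le_card_mul _ _
      ((2 * R + 1) ^ d) fun v _ => ?_).trans (Nat.mul_le_mul_right _ v1))
    refine Finset.card_image_le.trans (le_of_eq ?_)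
    exact card_boxF _ _
  have h3 := Finset.card_filter_add_card_filter_not (s := T) fun p => Q p
  omega

lemma loc_one_unique {γ : List (Pt d)} {p : Pt d} (h : locTime γ p = 1) {j k : ℕ}
    (hj : j ≤ γ.length) (hk : k ≤ γ.length) (h1 : pos γ j = p) (h2 : pos γ k = p) : j = k := by
  have := Finset.card_le_one.1 (le_of_eq h)
  refine this j ?_ k ?_ <;> simp [*] <;> omega

lemma tsum_ind_le (Q : Pt d → Prop) (N : ℕ) (hQ : ∀ T : Finset (Pt d), (∀ p ∈ T, Q p) → T.card ≤ N) :
    (∑' u : Pt d, open scoped Classical in if Q u then (1 : ℝ≥0∞) else 0) ≤ N := by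
  classical
  rw [ENNReal.tsum_eq_iSup_sum]
  refine iSup_le fun T => ?_
  rw [← Finset.sum_filter]
  simp only [Finset.sum_const, nsmul_eq_mul, mul_one]
  exact_mod_cast hQ _ fun p hp => (Finset.mem_filter.1 hp).2

lemma tsum_nat_le (L : ℕ) : (∑' t : ℕ, if t ≤ L then (1 : ℝ≥0∞) else 0) = (L + 1 : ℕ) := by
  rw [tsum_eq_sum (s := Finset.range (L + 1))]
  · rw [← Finset.sum_filter, Finset.filter_true_of_mem]
    · simp
    · intro t ht; have := Finset.mem_range.1 ht; omega
  · intro t ht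
    rw [if_neg]; intro h; exact ht (Finset.mem_range.2 (by omega))

section ineq

variable {φ : ℕ → ℝ≥0∞} {lam : ℝ} {ψ : List (Pt d) → ℝ≥0∞} {c0 : ℝ} {A : ℝ≥0∞}

/-- Multiplicity constant. -/
def CB (φ : ℕ → ℝ≥0∞) (lam : ℝ) (A : ℝ≥0∞) (L : ℕ) : ℝ≥0∞ :=
  (L + 1 : ℕ) * ((L + 1 : ℕ) * (CLs φ lam L * A))

lemma Good.CB_ne_top (G : Good d φ lam ψ c0 A) (L : ℕ) : CB φ lam A L ≠ ⊤ :=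
  ENNReal.mul_ne_top (ENNReal.natCast_ne_top _) (ENNReal.mul_ne_top (ENNReal.natCast_ne_top _)
    (ENNReal.mul_ne_top (G.CLs_ne_top L) G.Atop))

lemma om_ineq (G : Good d φ lam ψ c0 A) (hκ : 0 < κ) (hL : L ≤ L') (hC : ∀ y, |H y| ≤ C1 * l1 y)
    (hC0 : 0 ≤ C1) (hS1 : 2 * L' ≤ S) (hS2 : (C1 + κ) * L ≤ κ * S) {N : ℕ}
    (hN : ∀ γ ∈ Om H κ L L' S x M P (m + 1), ∀ T : Finset (Pt d),
      (∀ p ∈ T, ConeV H κ γ p) → T.card ≤ N) :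
    ((M - m : ℕ) : ℝ≥0∞) * ∑' γ : Om H κ L L' S x M P m, wE φ lam (γ : List (Pt d)) ≤
      N * CB φ lam A L * ∑' γ : Om H κ L L' S x M P (m + 1), wE φ lam (γ : List (Pt d)) := by
  classical
  set T : Set (List (Pt d) × Pt d) :=
    {p | p.1 ∈ Om H κ L L' S x M P m ∧ Rl H κ L L' S x M P m p.1 p.2} with hTdef
  -- step 1
  have step1 : ((M - m : ℕ) : ℝ≥0∞) * ∑' γ : Om H κ L L' S x M P m, wE φ lam (γ : List (Pt d)) ≤
      ∑' p : T, wE φ lam (p : List (Pt d) × Pt d).1 := by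
    rw [tsum_subtype (Om H κ L L' S x M P m) (wE φ lam), ← ENNReal.tsum_mul_left,
      tsum_subtype T (fun p => wE φ lam p.1),
      ENNReal.tsum_prod' (f := T.indicator fun p => wE φ lam p.1)]
    refine ENNReal.tsum_le_tsum fun γ => ?_
    by_cases hγ : γ ∈ Om H κ L L' S x M P m
    · rw [Set.indicator_of_mem hγ]
      obtain ⟨U, hU1, hU2⟩ := om_step hκ hL hC hC0 hS1 hS2 hγ
      calc ((M - m : ℕ) : ℝ≥0∞) * wE φ lam γ ≤ (U.card : ℝ≥0∞) * wE φ lam γ := by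
            gcongr; omega
        _ = ∑ u ∈ U, wE φ lam γ := by simp
        _ = ∑ u ∈ U, T.indicator (fun p => wE φ lam p.1) (γ, u) := by
            refine Finset.sum_congr rfl fun u hu => ?_
            rw [Set.indicator_of_mem (show (γ, u) ∈ T from ⟨hγ, hU2 u hu⟩)]
        _ ≤ _ := ENNReal.sum_le_tsum (f := fun u => T.indicator (fun p => wE φ lam p.1) (γ, u)) U
    · rw [Set.indicator_of_notMem hγ, mul_zero]; exact zero_le
  -- step 2
  have hex : ∀ p : List (Pt d) × Pt d, ∃ q : List (Pt d) × (Pt d × (ℕ × (ℕ × List (Pt d)))),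
      p ∈ T → q.2.1 = p.2 ∧ ∃ α β σ, p.1 = α ++ (q.2.2.2.2 ++ β) ∧
        Surg H κ L L' q.2.1 α q.2.2.2.2 β σ q.2.2.1 ∧ q.1 = α ++ (σ ++ β) ∧
        σ.length = q.2.2.1 + q.2.2.2.1 ∧ q.1 ∈ Om H κ L L' S x M P (m + 1) := by
    intro p
    by_cases hp : p ∈ T
    · obtain ⟨hp1, α, η, β, σ, s, h1, h2, h3⟩ := hp
      refine ⟨(α ++ (σ ++ β), p.2, s, σ.length - s, η), fun _ => ⟨rfl, α, β, σ, h1, h2, rfl, ?_, h3⟩⟩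
      have := h2.sl
      simp only; omega
    · exact ⟨([], 0, 0, 0, []), fun h => absurd h hp⟩
  choose g hg using hex
  set F : List (Pt d) → ℝ≥0∞ := (Om H κ L L' S x M P (m + 1)).indicator (wE φ lam) with hF
  set k : List (Pt d) → ℝ≥0∞ := fun η => CLs φ lam L * (pw η * (ψ η * eL lam η.length)) with hk
  set it : ℕ → ℝ≥0∞ := fun t => if t ≤ L then 1 else 0 with hit
  set Gc : List (Pt d) → Pt d → ℝ≥0∞ := fun γ u => if ConeV H κ γ u then 1 else 0 with hGc
  have step2 : ∑' p : T, wE φ lam (p : List (Pt d) × Pt d).1 ≤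
      ∑' q : List (Pt d) × (Pt d × (ℕ × (ℕ × List (Pt d)))),
        F q.1 * (Gc q.1 q.2.1 * (it q.2.2.1 * (it q.2.2.2.1 * k q.2.2.2.2))) := by
    refine tsum_le_of_injOn T (fun p => wE φ lam p.1) g ?_
      (fun q => F q.1 * (Gc q.1 q.2.1 * (it q.2.2.1 * (it q.2.2.2.1 * k q.2.2.2.2)))) ?_
    · rintro p hp p' hp' he
      obtain ⟨e1, α, β, σ, e2, e3, e4, e5, e6⟩ := hg p hp
      obtain ⟨e1', α', β', σ', e2', e3', e4', e5', e6'⟩ := hg p' hp'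
      rw [← he] at e1' e2' e3' e4' e5'
      have hu1 : pos (g p).1 (α.length + (g p).2.2.1) = (g p).2.1 := by
        rw [e4, pos_three_mid _ _ _ (by omega)]; exact e3.hu
      have hu2 : pos (g p).1 (α'.length + (g p).2.2.1) = (g p).2.1 := by
        rw [e4', pos_three_mid _ _ _ (by omega)]; exact e3'.hu
      have hone : locTime (g p).1 (g p).2.1 = 1 := by rw [e4]; exact e3.loc_u
      have hlen := loc_one_unique hone (by rw [e4]; simp only [List.length_append]; omega)
        (by rw [e4']; simp only [List.length_append]; omega) hu1 hu2
      have heq : α ++ (σ ++ β) = α' ++ (σ' ++ β') := by rw [← e4, e4']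
      obtain ⟨a1, a2⟩ := List.append_inj heq (by omega)
      obtain ⟨a3, a4⟩ := List.append_inj a2 (by omega)
      refine Prod.ext ?_ (e1.symm.trans e1')
      rw [e2, e2', a1, a4]
    · rintro p hp
      obtain ⟨e1, α, β, σ, e2, e3, e4, e5, e6⟩ := hg p hp
      have hc : ConeV H κ (g p).1 (g p).2.1 := by rw [e4]; exact e3.coneV
      have hs := e3.sL
      have ht := e3.ls
      simp only [hF, hGc, hit, hk]
      rw [Set.indicator_of_mem e6, if_pos hc, if_pos hs, if_pos (by omega), one_mul, one_mul, one_mul,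
        pw_of e3.hη, one_mul, e4, e2, mul_comm (wE φ lam _)]
      exact e3.weight G
  -- step 3
  have hGcN : ∀ γ ∈ Om H κ L L' S x M P (m + 1), ∑' u, Gc γ u ≤ N := fun γ hγ =>
    tsum_ind_le (fun u => ConeV H κ γ u) N (hN γ hγ)
  have hksum : ∑' η, k η ≤ CLs φ lam L * A := by
    simp only [hk]
    rw [ENNReal.tsum_mul_left]
    gcongr
    exact G.sum'
  have step3 : ∑' q : List (Pt d) × (Pt d × (ℕ × (ℕ × List (Pt d)))),
        F q.1 * (Gc q.1 q.2.1 * (it q.2.2.1 * (it q.2.2.2.1 * k q.2.2.2.2))) ≤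
      N * CB φ lam A L * ∑' γ, F γ := by
    rw [ENNReal.tsum_prod (f := fun γ (r : Pt d × (ℕ × (ℕ × List (Pt d)))) => F γ * (Gc γ r.1 * (it r.2.1 * (it r.2.2.1 * k r.2.2.2)))),
      ← ENNReal.tsum_mul_left]
    refine ENNReal.tsum_le_tsum fun γ => ?_
    rw [ENNReal.tsum_mul_left]
    by_cases hγ : γ ∈ Om H κ L L' S x M P (m + 1)
    · rw [mul_comm]
      gcongr
      rw [tsum_prod_mul (f := Gc γ) (g := fun r : ℕ × (ℕ × List (Pt d)) => it r.1 * (it r.2.1 * k r.2.2)),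
        tsum_prod_mul (f := it) (g := fun r : ℕ × List (Pt d) => it r.1 * k r.2),
        tsum_prod_mul (f := it) (g := k), CB]
      have hi : ∑' t, it t = (L + 1 : ℕ) := tsum_nat_le L
      rw [hi]
      gcongr
      exact hGcN γ hγ
    · rw [show F γ = 0 from Set.indicator_of_notMem hγ _]; simp
  calc _ ≤ _ := step1
    _ ≤ _ := step2
    _ ≤ _ := step3
    _ = _ := by rw [hF, ← tsum_subtype (Om H κ L L' S x M P (m + 1)) (wE φ lam)]

lemma om_iter (G : Good d φ lam ψ c0 A) (hκ : 0 < κ) (hL : L ≤ L') (hC : ∀ y, |H y| ≤ C1 * l1 y)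
    (hC0 : 0 ≤ C1) (hS1 : 2 * L' ≤ S) (hS2 : (C1 + κ) * L ≤ κ * S)
    {R : ℕ} (hR1 : L' ≤ R) (hR2 : (C1 + κ / 2) * L' ≤ κ / 2 * R) {n0 : ℕ}
    (hP : ∀ γ0, P γ0 → ∀ T : Finset (Pt d), (∀ p ∈ T, ConeV H (κ / 2) γ0 p) → T.card ≤ n0)
    {k : ℕ} (hkM : k < M)
    (hk : ((n0 + k * (2 * R + 1) ^ d : ℕ) : ℝ) * (CB φ lam A L).toReal * Real.exp 1 ≤ (M - k : ℕ)) :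
    ∑' γ : Om H κ L L' S x M P 0, wE φ lam (γ : List (Pt d)) ≤
      ENNReal.ofReal (Real.exp (-k)) * HEf φ lam x := by
  have hk' : ((n0 + k * (2 * R + 1) ^ d : ℕ) : ℝ≥0∞) * CB φ lam A L ≤
      ((M - k : ℕ) : ℝ≥0∞) * ENNReal.ofReal (Real.exp (-1)) := by
    rw [← ENNReal.ofReal_toReal (G.CB_ne_top L), ← ENNReal.ofReal_natCast, ← ENNReal.ofReal_natCast,
      ← ENNReal.ofReal_mul (by positivity), ← ENNReal.ofReal_mul (by positivity)]
    refine ENNReal.ofReal_le_ofReal ?_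
    rw [Real.exp_neg, ← div_eq_mul_inv, le_div_iff₀ (Real.exp_pos _)]
    exact hk
  have hMk : ((M - k : ℕ) : ℝ≥0∞) ≠ 0 := by
    rw [Ne, Nat.cast_eq_zero]; omega
  have hstep : ∀ m < k, ∑' γ : Om H κ L L' S x M P m, wE φ lam (γ : List (Pt d)) ≤
      ENNReal.ofReal (Real.exp (-1)) *
        ∑' γ : Om H κ L L' S x M P (m + 1), wE φ lam (γ : List (Pt d)) := by
    intro m hm
    have h1 := om_ineq (N := n0 + k * (2 * R + 1) ^ d) G hκ hL hC hC0 hS1 hS2 (x := x) (M := M) (P := P) (m := m)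
      (fun γ hγ T hT => (om_count hκ hC hC0 hR1 hR2 hP hγ T hT).trans (by gcongr; omega))
    rw [← ENNReal.mul_le_mul_iff_right hMk (ENNReal.natCast_ne_top _), ← mul_assoc]
    calc _ ≤ ((M - m : ℕ) : ℝ≥0∞) * ∑' γ : Om H κ L L' S x M P m, wE φ lam (γ : List (Pt d)) := by
          gcongr
      _ ≤ _ := h1
      _ ≤ _ := by gcongr
  have hind : ∀ m ≤ k, ∑' γ : Om H κ L L' S x M P 0, wE φ lam (γ : List (Pt d)) ≤
      ENNReal.ofReal (Real.exp (-m)) *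
        ∑' γ : Om H κ L L' S x M P m, wE φ lam (γ : List (Pt d)) := by
    intro m
    induction m with
    | zero => intro _; simp
    | succ m ih =>
      intro hm
      refine (ih (by omega)).trans ?_
      calc _ ≤ ENNReal.ofReal (Real.exp (-m)) * (ENNReal.ofReal (Real.exp (-1)) *
            ∑' γ : Om H κ L L' S x M P (m + 1), wE φ lam (γ : List (Pt d))) := by
            gcongr; exact hstep m (by omega)
        _ = _ := by
            rw [← mul_assoc, ← ENNReal.ofReal_mul (Real.exp_pos _).le, ← Real.exp_add]
            congr 3; push_cast; ring
  refine (hind k le_rfl).trans ?_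
  gcongr
  exact ENNReal.tsum_mono_subtype (wE φ lam) (fun γ hγ => hγ.1)

end ineq

end PartG3

end SIRW

namespace SIRW

section PartH

variable {d : ℕ}

variable {φ : ℕ → ℝ≥0∞} {lam : ℝ} {ψ : List (Pt d) → ℝ≥0∞} {c0 : ℝ} {A : ℝ≥0∞}
  {ξ : (Fin d → ℝ) → ℝ} {c1 C1 δ : ℝ}

lemma cone_of_coneV (Ly : Lyap d φ lam (fun y => ξ (ctR y)) c1 C1) {h : Fin d → ℝ} {κ : ℝ}
    (hδ : 0 < 1 - 3 * δ) (hκ : (1 - 3 * δ) * C1 < κ) {γ : List (Pt d)} {p : Pt d}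
    (hp : ConeV (hom h) κ γ p) : ∃ k ≤ γ.length, pos γ k = p ∧ IsConePt ξ h δ γ k := by
  obtain ⟨h1, h2⟩ := hp
  obtain ⟨k, hk, rfl⟩ := (loc_pos_iff γ p).1 (by omega)
  refine ⟨k, hk, rfl, hk, fun j hj hjk => ?_⟩
  have hne : pos γ j ≠ pos γ k := fun he => hjk (loc_one_unique h1 hj hk he rfl)
  have key : ∀ y : Pt d, y ≠ 0 → κ * l1 y ≤ hom h y → y ∈ Ygt ξ h (3 * δ) := by
    intro y hy hy2
    have hl : (0 : ℝ) < l1 y := by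
      have : l1 y ≠ 0 := fun h0 => hy (l1_eq_zero.1 h0)
      exact_mod_cast Nat.pos_of_ne_zero this
    have hu : ξ (ctR y) ≤ C1 * l1 y := Ly.upper y
    rw [hom_apply] at hy2
    simp only [Ygt, Set.mem_setOf_eq]
    have h3 : (1 - 3 * δ) * ξ (ctR y) ≤ (1 - 3 * δ) * (C1 * l1 y) :=
      mul_le_mul_of_nonneg_left hu hδ.le
    have h4 : (1 - 3 * δ) * C1 * l1 y < κ * l1 y := mul_lt_mul_of_pos_right hκ hl
    nlinarith
  rcases h2 (pos γ j) ((loc_pos_iff _ _).2 ⟨j, hj, rfl⟩) with h | h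
  · exact Or.inl (key _ (sub_ne_zero.2 hne) h)
  · exact Or.inr (key _ (sub_ne_zero.2 (Ne.symm hne)) h)

lemma card_le_coneCount (Ly : Lyap d φ lam (fun y => ξ (ctR y)) c1 C1) {h : Fin d → ℝ} {κ : ℝ}
    (hδ : 0 < 1 - 3 * δ) (hκ : (1 - 3 * δ) * C1 < κ) {γ : List (Pt d)} (T : Finset (Pt d))
    (hT : ∀ p ∈ T, ConeV (hom h) κ γ p) : T.card ≤ coneCount ξ h δ γ := by
  classical
  rw [coneCount]
  refine le_trans (Finset.card_le_card ?_) (Finset.card_image_le (f := pos γ))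
  intro p hp
  obtain ⟨k, hk, h1, h2⟩ := cone_of_coneV Ly hδ hκ (hT p hp)
  refine Finset.mem_image.2 ⟨k, Finset.mem_filter.2 ⟨Finset.mem_range.2 (by omega), h2⟩, h1⟩

lemma small_case (G : Good d φ lam ψ c0 A) (Ly : Lyap d φ lam (fun y => ξ (ctR y)) c1 C1)
    (hδ : 0 < 1 - 3 * δ) (hκ : (1 - 3 * δ) * C1 < c1) (R1 : ℕ) :
    ∃ ν : ℝ, 0 < ν ∧ ∀ (x : Pt d) (h : Fin d → ℝ), l1 x ≤ R1 → inr h (ctR x) = ξ (ctR x) →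
      ∑' γ : {γ | γ ∈ Hpaths x ∧ coneCount ξ h δ γ = 0}, wE φ lam (γ : List (Pt d)) ≤
        ENNReal.ofReal (Real.exp (-(ν * l1 x))) * HEf φ lam x := by
  set Q := (CLs φ lam R1 * A).toReal + 1 with hQ
  have hQ1 : 1 ≤ Q := by have : 0 ≤ (CLs φ lam R1 * A).toReal := ENNReal.toReal_nonneg
                         linarith
  have hQtop : CLs φ lam R1 * A ≠ ⊤ := ENNReal.mul_ne_top (G.CLs_ne_top _) G.Atop
  refine ⟨1 / (Q * (R1 + 1)), by positivity, fun x h hx hh => ?_⟩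
  have hHx : c1 * l1 x ≤ hom h x := by rw [hom_apply, hh]; exact Ly.lower x
  obtain ⟨σ, p1, p2, p3, p4⟩ := sorted_path (hom h) c1 _ x rfl hHx
  have hinj : ∀ j ≤ σ.length, ∀ k ≤ σ.length, pos σ j = pos σ k → j = k := by
    intro j hj k hk he
    rw [← (p4 j (by omega)).1, ← (p4 k (by omega)).1, he]
  have hone : ∀ v, locTime σ v ≤ 1 := by
    intro v
    rw [locTime, Finset.card_le_one]
    intro a ha b hb
    simp only [Finset.mem_filter, Finset.mem_range] at ha hb
    exact hinj a (by omega) b (by omega) (ha.2.trans hb.2.symm)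
  have hσH : σ ∈ Hpaths x := by
    refine mem_Hpaths.2 ⟨p1, p3, fun k hk he => ?_⟩
    have := (p4 k (by omega)).1
    rw [he] at this
    omega
  have hcone : ConeV (hom h) c1 σ 0 := by
    refine ⟨le_antisymm (hone 0) ((loc_pos_iff _ _).2 ⟨0, Nat.zero_le _, pos_zero _⟩), fun v hv => ?_⟩
    obtain ⟨k, hk, rfl⟩ := (loc_pos_iff _ _).1 hv
    left
    obtain ⟨q1, q2⟩ := p4 k (by omega)
    rw [sub_zero, q1]; exact q2
  have hcc : 1 ≤ coneCount ξ h δ σ := by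
    have := card_le_coneCount Ly hδ hκ (γ := σ) {0} (by simpa using hcone)
    simpa using this
  set w := wE φ lam σ with hw
  set hh := HEf φ lam x with hhdef
  have hCL : 1 ≤ CLs φ lam R1 * w := by
    rw [hw, wE_eq G.h0]
    exact G.CLs_one (by omega) hone
  have hhA : hh ≤ A := by
    refine (G.HEf_le x).trans ?_
    have : eL c0 (l1 x) ≤ 1 := by
      rw [eL, ← ENNReal.ofReal_one]
      refine ENNReal.ofReal_le_ofReal (Real.exp_le_one_iff.2 ?_)
      have := G.c0pos
      have : 0 ≤ c0 * l1 x := by positivity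
      linarith
    calc eL c0 (l1 x) * A ≤ 1 * A := by gcongr
      _ = A := one_mul _
  have hhw : hh ≤ CLs φ lam R1 * A * w := by
    calc hh ≤ A * 1 := by rw [mul_one]; exact hhA
      _ ≤ A * (CLs φ lam R1 * w) := by gcongr
      _ = _ := by ring
  have hsum : (∑' γ : {γ | γ ∈ Hpaths x ∧ coneCount ξ h δ γ = 0}, wE φ lam (γ : List (Pt d))) + w
      ≤ hh := by
    rw [hhdef, HEf_eq, tsum_subtype, hw]
    have e : wE φ lam σ = ∑' γ, ({σ} : Set (List (Pt d))).indicator (wE φ lam) γ := by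
      rw [← tsum_subtype, tsum_singleton]
    rw [e, ← ENNReal.tsum_add]
    refine ENNReal.tsum_le_tsum fun γ => ?_
    by_cases hγ : γ = σ
    · subst hγ
      rw [Set.indicator_of_notMem, Set.indicator_of_mem (Set.mem_singleton _), wH_of hσH, zero_add]
      rintro ⟨_, h0⟩; omega
    · rw [Set.indicator_of_notMem (s := {σ}) (by simpa using hγ), add_zero]
      by_cases hγ2 : γ ∈ {γ | γ ∈ Hpaths x ∧ coneCount ξ h δ γ = 0}
      · rw [Set.indicator_of_mem hγ2, wH_of hγ2.1]
      · rw [Set.indicator_of_notMem hγ2]; exact zero_le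
  set b := ∑' γ : {γ | γ ∈ Hpaths x ∧ coneCount ξ h δ γ = 0}, wE φ lam (γ : List (Pt d)) with hb
  have hht : hh ≠ ⊤ := G.HEf_ne_top x
  have hbt : b ≠ ⊤ := ne_top_of_le_ne_top hht (le_trans le_self_add hsum)
  have hwt : w ≠ ⊤ := ne_top_of_le_ne_top hht (le_trans le_add_self hsum)
  have r1 : b.toReal + w.toReal ≤ hh.toReal := by
    rw [← ENNReal.toReal_add hbt hwt]; exact ENNReal.toReal_mono hht hsum
  have r2 : hh.toReal ≤ Q * w.toReal := by
    have := ENNReal.toReal_mono (ENNReal.mul_ne_top hQtop hwt) hhw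
    rw [ENNReal.toReal_mul] at this
    have h0 : 0 ≤ w.toReal := ENNReal.toReal_nonneg
    rw [hQ]; linarith
  have r3 : b.toReal ≤ Real.exp (-(1 / (Q * (R1 + 1)) * l1 x)) * hh.toReal := by
    have h1 := Real.add_one_le_exp (-(1 / (Q * (R1 + 1)) * l1 x))
    have h2 : 1 / (Q * ((R1 : ℝ) + 1)) * l1 x ≤ 1 / Q := by
      have h3 : (l1 x : ℝ) ≤ R1 + 1 := by
        have : (l1 x : ℝ) ≤ R1 := by exact_mod_cast hx
        linarith
      rw [div_mul_eq_mul_div, one_mul, div_le_div_iff₀ (by positivity) (by positivity)]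
      nlinarith
    have h4 : hh.toReal / Q ≤ w.toReal := by
      rw [div_le_iff₀ (by linarith)]; linarith
    have h5 : 0 ≤ hh.toReal := ENNReal.toReal_nonneg
    have h6 : (1 - 1 / Q) * hh.toReal ≤ Real.exp (-(1 / (Q * (R1 + 1)) * l1 x)) * hh.toReal :=
      mul_le_mul_of_nonneg_right (by linarith) h5
    have h7 : (1 - 1 / Q) * hh.toReal = hh.toReal - hh.toReal / Q := by ring
    linarith
  rw [← ENNReal.ofReal_toReal hbt, ← ENNReal.ofReal_toReal hht,
    ← ENNReal.ofReal_mul (Real.exp_nonneg _)]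
  exact ENNReal.ofReal_le_ofReal r3

lemma final_exp {C ρ p ν l n0 : ℝ} (hC : 0 < C) (hl : 0 ≤ l) (hνρ : 2 * ν ≤ ρ)
    (hνp : 2 * ν ≤ p) (hν0 : 0 < ν) (hn : p * l < n0 + 1)
    (hlog : Real.log (C + Real.exp 1) / ν ≤ l) :
    C * Real.exp (-(ρ * l)) + Real.exp (-n0) ≤ Real.exp (-(ν * l)) := by
  have hD0 : 0 < C + Real.exp 1 := by positivity
  have a1 := mul_le_mul_of_nonneg_right hνρ hl
  have a2 := mul_le_mul_of_nonneg_right hνp hl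
  have h1 : Real.exp (-(ρ * l)) ≤ Real.exp (-(2 * ν * l)) := by
    apply Real.exp_le_exp.2
    linarith
  have h2 : Real.exp (-n0) ≤ Real.exp 1 * Real.exp (-(2 * ν * l)) := by
    rw [← Real.exp_add]
    apply Real.exp_le_exp.2
    linarith
  have h3 : C + Real.exp 1 ≤ Real.exp (ν * l) := by
    rw [div_le_iff₀ hν0] at hlog
    rw [← Real.log_le_iff_le_exp hD0]
    linarith
  have h4 : Real.exp (-(ν * l)) = Real.exp (ν * l) * Real.exp (-(2 * ν * l)) := by
    rw [← Real.exp_add]; congr 1; ring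
  rw [h4]
  have h5 := mul_le_mul_of_nonneg_left h1 hC.le
  have h6 := mul_le_mul_of_nonneg_right h3 (Real.exp_nonneg (-(2 * ν * l)))
  rw [add_mul] at h6
  linarith

set_option maxHeartbeats 1000000 in
lemma large_case (G : Good d φ lam ψ c0 A) (Ly : Lyap d φ lam (fun y => ξ (ctR y)) c1 C1)
    (hδ : 0 < 1 - 3 * δ) (hκδ : (1 - 3 * δ) * C1 < 1 / (4 * (2 / c1 + 1)) / 2) :
    ∃ p ν R1 : ℝ, 0 < p ∧ 0 < ν ∧ ∀ (x : Pt d) (h : Fin d → ℝ), R1 ≤ l1 x → 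
      h ∈ Kset ξ → inr h (ctR x) = ξ (ctR x) →
      ∑' γ : {γ | γ ∈ Hpaths x ∧ (coneCount ξ h δ γ : ℝ) < p * l1 x}, wE φ lam (γ : List (Pt d)) ≤
        ENNReal.ofReal (Real.exp (-(ν * l1 x))) * HEf φ lam x := by
  classical
  have hc1 := Ly.c1pos
  have hC1 := Ly.C1one
  set κ := 1 / (4 * (2 / c1 + 1)) with hκdef
  have hκ : 0 < κ := by positivity
  obtain ⟨ρ, hρ, K0, hK0⟩ := skel_bound G Ly (ν0 := 1 / (64 * C1)) (by positivity)
  set K := max K0 C1 with hK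
  obtain ⟨C, hC, hskel⟩ := hK0 K (le_max_left _ _)
  have hKC : C1 ≤ K := le_max_right _ _
  obtain ⟨L, L', hLL, hreg⟩ := regular_set Ly hKC
  obtain ⟨S0, hS0⟩ := exists_nat_ge ((C1 + κ) * L / κ)
  set S := max S0 (2 * L') with hS
  have hS1 : 2 * L' ≤ S := le_max_right _ _
  have hS2 : (C1 + κ) * L ≤ κ * S := by
    rw [div_le_iff₀ hκ] at hS0
    have : (S0 : ℝ) ≤ S := by exact_mod_cast le_max_left S0 (2 * L')
    nlinarith
  obtain ⟨S3, hS3⟩ := exists_nat_ge ((C1 + κ / 2) * L' / (κ / 2))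
  set R := max S3 L' with hR
  have hR1 : L' ≤ R := le_max_right _ _
  have hR2 : (C1 + κ / 2) * L' ≤ κ / 2 * R := by
    rw [div_le_iff₀ (half_pos hκ)] at hS3
    have : (S3 : ℝ) ≤ R := by exact_mod_cast le_max_left S3 L'
    nlinarith
  obtain ⟨c2, R0, hc2, hR0⟩ := hreg S
  set B := (CB φ lam A L).toReal * Real.exp 1 with hB
  have hB0 : 0 ≤ B := mul_nonneg ENNReal.toReal_nonneg (Real.exp_nonneg _)
  set C6 : ℕ := (2 * R + 1) ^ d with hC6
  set p := c2 / (2 + (1 + C6) * B) with hp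
  have hden : 0 < 2 + (1 + (C6 : ℝ)) * B := by positivity
  have hp0 : 0 < p := div_pos hc2 hden
  have hpe : p * (2 + (1 + C6) * B) = c2 := by rw [hp]; field_simp
  set ν := min ρ p / 2 with hν
  have hν0 : 0 < ν := half_pos (lt_min hρ hp0)
  have hνρ : 2 * ν ≤ ρ := by rw [hν]; have := min_le_left ρ p; linarith
  have hνp : 2 * ν ≤ p := by rw [hν]; have := min_le_right ρ p; linarith
  set D := C + Real.exp 1 with hD
  have hD0 : 0 < D := by positivity
  refine ⟨p, ν, max 1 (max R0 (Real.log D / ν)), hp0, hν0, fun x h hx hh hdual => ?_⟩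
  have hx1 : (1 : ℝ) ≤ l1 x := (le_max_left _ _).trans hx
  have hx2 : R0 ≤ l1 x := (le_max_left _ _).trans ((le_max_right _ _).trans hx)
  have hx3 : Real.log D / ν ≤ l1 x := (le_max_right _ _).trans ((le_max_right _ _).trans hx)
  have hHle : ∀ y, hom h y ≤ ξ (ctR y) := fun y => by rw [hom_apply]; exact hh _
  have hHx : hom h x = ξ (ctR x) := hdual
  have hHabs : ∀ y, |hom h y| ≤ C1 * l1 y := Ly.abs_le hHle
  set W : Set (List (Pt d)) := {γ | γ ∈ Hpaths x ∧ (coneCount ξ h δ γ : ℝ) < p * l1 x} with hW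
  set n0 := ⌊p * l1 x⌋₊ with hn0
  set M := ⌈c2 * l1 x⌉₊ with hM
  set P : List (Pt d) → Prop := fun γ0 => coneCount ξ h δ γ0 ≤ n0 with hP
  set Bd : Set (List (Pt d)) := {γ | γ ∈ Hpaths x ∧ ∀ bs R, γ = flat bs ++ R →
    isSkel (fun y => ξ (ctR y)) K C1 bs R →
    1 / (64 * C1) * K * bs.length ≤ tcost (hom h) K C1 bs + R.length} with hBd
  have hsub : W ⊆ Bd ∪ Om (hom h) κ L L' S x M P 0 := by
    rintro γ ⟨hγ, hcc⟩
    by_cases hb : γ ∈ Bd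
    · exact Or.inl hb
    right
    have : ∃ bs R, γ = flat bs ++ R ∧ isSkel (fun y => ξ (ctR y)) K C1 bs R ∧
        tcost (hom h) K C1 bs + R.length < 1 / (64 * C1) * K * bs.length := by
      by_contra hc
      push Not at hc
      exact hb ⟨hγ, hc⟩
    obtain ⟨bs, R', rfl, hsk, hlt⟩ := this
    obtain ⟨U, hU1, hU2⟩ := hR0 (hom h) x hHle hHx hx2 bs R' hγ.1 hγ.2.1 hsk hlt
    refine ⟨hγ, ∅, U, flat bs ++ R', by simp, ?_, hU2, by simp, by simp, ?_, fun w _ => rfl⟩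
    · rw [add_zero]; exact Nat.ceil_le.2 hU1
    · exact Nat.le_floor hcc.le
  have hbad := hskel (hom h) x hHle hHx Bd (fun γ hγ => hγ.1) (fun γ hγ => hγ.2)
  have hkp : (n0 : ℝ) ≤ p * l1 x := Nat.floor_le (by positivity)
  have hMc : c2 * l1 x ≤ M := Nat.le_ceil _
  have hpc : p * l1 x + p * l1 x + (1 + C6) * B * (p * l1 x) = c2 * l1 x := by rw [← hpe]; ring
  have hpl : 0 < p * l1 x := by positivity
  have hnn : 0 ≤ (1 + (C6 : ℝ)) * B * (p * l1 x) := by positivity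
  have hkM : n0 < M := by
    have : (n0 : ℝ) < M := by linarith
    exact_mod_cast this
  have hom0 := om_iter G hκ hLL hHabs (by linarith) hS1 hS2 hR1 hR2 (x := x) (M := M) (P := P)
    (n0 := n0) (k := n0)
    (fun γ0 h0 T hT => (card_le_coneCount Ly hδ hκδ T hT).trans h0) hkM (by
      rw [Nat.cast_sub hkM.le, mul_assoc, ← hB]
      push_cast
      have e : ((2 * (R : ℝ) + 1) ^ d) = C6 := by rw [hC6]; push_cast; rfl
      rw [e]
      have h1 : ((n0 : ℝ) + n0 * C6) * B ≤ (1 + C6) * B * (p * l1 x) := by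
        have : 0 ≤ (1 + (C6 : ℝ)) * B := by positivity
        calc ((n0 : ℝ) + n0 * C6) * B = (1 + C6) * B * n0 := by ring
          _ ≤ _ := mul_le_mul_of_nonneg_left hkp this
      linarith)
  calc ∑' γ : W, wE φ lam (γ : List (Pt d))
      ≤ ∑' γ : (Bd ∪ Om (hom h) κ L L' S x M P 0 : Set _), wE φ lam (γ : List (Pt d)) :=
        ENNReal.tsum_mono_subtype (wE φ lam) hsub
    _ ≤ ∑' γ : Bd, wE φ lam (γ : List (Pt d)) +
        ∑' γ : Om (hom h) κ L L' S x M P 0, wE φ lam (γ : List (Pt d)) :=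
        ENNReal.tsum_union_le (wE φ lam) _ _
    _ ≤ ENNReal.ofReal (C * Real.exp (-(ρ * l1 x))) * HEf φ lam x +
        ENNReal.ofReal (Real.exp (-n0)) * HEf φ lam x := add_le_add hbad hom0
    _ = ENNReal.ofReal (C * Real.exp (-(ρ * l1 x)) + Real.exp (-n0)) * HEf φ lam x := by
        rw [ENNReal.ofReal_add (by positivity) (by positivity), add_mul]
    _ ≤ _ := mul_le_mul' (ENNReal.ofReal_le_ofReal
        (final_exp hC (by linarith) hνρ hνp hν0 (Nat.lt_floor_add_one _) hx3)) le_rfl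

end PartH

end SIRW

open SIRW

/-- cone points of paths: there are `δ ∈ (0,1/3)` and constants `c, ν > 0`
(depending only on `d`, `δ`, `λ`) such that, uniformly in `x ∈ ℤ^d` and `h ∈ ∂K_λ` dual to
`x`, the `P_λ^x`-probability that `γ` has fewer than `c‖x‖` `(h,δ)`-cone points is at most
`e^{-ν‖x‖}` (stated in the multiplied-out form). -/
theorem stmt12 (d : ℕ) (hd : 1 ≤ d) (φ : ℕ → ℝ≥0∞)
    (hN0 : φ 0 = 0) (hNmono : Monotone φ)
    (hcase : (∀ l m : ℕ, φ l + φ m ≤ φ (l + m)) ∨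
      ((∀ l m : ℕ, φ (l + m) ≤ φ l + φ m) ∧ SLE φ))
    (lam0 : ℝ)
    (hlam0 : Filter.Tendsto (fun n : ℕ => Real.log (ZE d φ n).toReal / n) Filter.atTop
      (nhds lam0))
    (lam : ℝ) (hlam : lam0 < lam)
    (ξ : (Fin d → ℝ) → ℝ)
    (hξ : ∀ x : Fin d → ℝ,
      Filter.Tendsto (fun M : ℝ => -Real.log (HEf φ lam (flr M x)).toReal / M)
        Filter.atTop (nhds (ξ x))) :
    ∃ δ : ℝ, 0 < δ ∧ δ < 1 / 3 ∧ ∃ c ν : ℝ, 0 < c ∧ 0 < ν ∧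
      ∀ (x : Pt d) (h : Fin d → ℝ),
        h ∈ frontier (Kset ξ) → inr h (ctR x) = ξ (ctR x) →
        (∑' γ : {γ : List (Pt d) // γ ∈ Hpaths x ∧
            (coneCount ξ h δ γ : ℝ) < c * nrm (ctR x)}, wE φ lam (γ : List (Pt d)))
          ≤ ENNReal.ofReal (Real.exp (-ν * nrm (ctR x))) * HEf φ lam x := by
  by_cases h1 : φ 1 = ⊤
  · refine ⟨1 / 6, by norm_num, by norm_num, 1, 1, one_pos, one_pos, fun x h _ _ => ?_⟩
    have hw : ∀ γ : List (Pt d), wE φ lam γ = 0 := by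
      intro γ
      have h0 : (0 : Pt d) ∈ visited γ := by
        unfold visited
        exact Finset.mem_image.2 ⟨0, by simp, by simp [pos]⟩
      have h2 : 1 ≤ locTime γ 0 := by
        unfold locTime
        exact Finset.card_pos.2 ⟨0, Finset.mem_filter.2 ⟨by simp, by simp [pos]⟩⟩
      have h3 : PotE φ γ = ⊤ := by
        unfold PotE
        rw [ENNReal.sum_eq_top]
        exact ⟨0, h0, top_le_iff.1 (h1 ▸ hNmono h2)⟩
      simp [wE, expNegE, h3]
    simp [hw]
  obtain ⟨ψ, c0, A, G⟩ := good_exists hd φ hN0 hNmono hcase h1 lam0 hlam0 lam hlam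
  obtain ⟨c1, C1, Ly⟩ := lyap_exists G ξ hξ
  have hc1 := Ly.c1pos
  have hC1 := Ly.C1one
  obtain ⟨κ, hκ⟩ : ∃ κ, κ = 1 / (4 * (2 / c1 + 1)) / 2 := ⟨_, rfl⟩
  have hκ0 : 0 < κ := by rw [hκ]; positivity
  have hC1' : 0 < C1 := by linarith
  obtain ⟨m, hm⟩ : ∃ m, m = min c1 κ := ⟨_, rfl⟩
  have hm0 : 0 < m := by rw [hm]; exact lt_min hc1 hκ0
  obtain ⟨θ, hθ⟩ : ∃ θ, θ = min (1 / 2) (m / (2 * C1)) := ⟨_, rfl⟩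
  have hθ0 : 0 < θ := by rw [hθ]; exact lt_min (by norm_num) (by positivity)
  have hθ1 : θ ≤ 1 / 2 := by rw [hθ]; exact min_le_left _ _
  have hθ2 : θ * C1 < m := by
    have : θ ≤ m / (2 * C1) := by rw [hθ]; exact min_le_right _ _
    rw [le_div_iff₀ (by positivity)] at this
    linarith
  obtain ⟨δ, hδ⟩ : ∃ δ, δ = (1 - θ) / 3 := ⟨_, rfl⟩
  have hδθ : 1 - 3 * δ = θ := by rw [hδ]; ring
  have hδ0 : 0 < 1 - 3 * δ := by rw [hδθ]; exact hθ0
  have hs : (1 - 3 * δ) * C1 < c1 := by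
    rw [hδθ]; exact hθ2.trans_le (hm ▸ min_le_left _ _)
  have hb : (1 - 3 * δ) * C1 < 1 / (4 * (2 / c1 + 1)) / 2 := by
    rw [hδθ, ← hκ]; exact hθ2.trans_le (hm ▸ min_le_right _ _)
  obtain ⟨p, ν1, R1, hp, hν1, hlarge⟩ := large_case (δ := δ) G Ly hδ0 hb
  obtain ⟨N, hN⟩ := exists_nat_ge R1
  obtain ⟨ν2, hν2, hsmall⟩ := small_case (δ := δ) G Ly hδ0 hs N
  refine ⟨δ, by linarith, by linarith, min p (1 / (N + 1)), min ν1 ν2,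
    lt_min hp (by positivity), lt_min hν1 hν2, fun x h hh hdual => ?_⟩
  have hK := mem_Kset_of_frontier hh
  have hle := nrm_le_l1 x
  have hn0 : 0 ≤ nrm (ctR x) := Real.sqrt_nonneg _
  have hl0 : (0 : ℝ) ≤ l1 x := Nat.cast_nonneg _
  have hexp : ∀ ν', min ν1 ν2 ≤ ν' → ENNReal.ofReal (Real.exp (-(ν' * l1 x))) * HEf φ lam x ≤
      ENNReal.ofReal (Real.exp (-min ν1 ν2 * nrm (ctR x))) * HEf φ lam x := by
    intro ν' hν'
    refine mul_le_mul' (ENNReal.ofReal_le_ofReal (Real.exp_le_exp.2 ?_)) le_rfl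
    have hmn : 0 < min ν1 ν2 := lt_min hν1 hν2
    have := mul_le_mul hν' hle hn0 (hmn.le.trans hν')
    rw [neg_mul]
    exact neg_le_neg this
  rcases le_total N (l1 x) with hNx | hNx
  · have hR : R1 ≤ l1 x := hN.trans (by exact_mod_cast hNx)
    refine le_trans ?_ ((hlarge x h hR hK hdual).trans (hexp ν1 (min_le_left _ _)))
    refine ENNReal.tsum_mono_subtype (wE φ lam)
      (s := {γ | γ ∈ Hpaths x ∧ (coneCount ξ h δ γ : ℝ) < min p (1 / (N + 1)) * nrm (ctR x)}) ?_
    rintro γ ⟨hγ, hc⟩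
    exact ⟨hγ, hc.trans_le (mul_le_mul (min_le_left _ _) hle hn0 hp.le)⟩
  · refine le_trans ?_ ((hsmall x h hNx hdual).trans (hexp ν2 (min_le_right _ _)))
    refine ENNReal.tsum_mono_subtype (wE φ lam)
      (s := {γ | γ ∈ Hpaths x ∧ (coneCount ξ h δ γ : ℝ) < min p (1 / (N + 1)) * nrm (ctR x)}) ?_
    rintro γ ⟨hγ, hc⟩
    refine ⟨hγ, ?_⟩
    have h2 : (coneCount ξ h δ γ : ℝ) < 1 / (N + 1) * l1 x :=
      hc.trans_le (mul_le_mul (min_le_right _ _) hle hn0 (by positivity))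
    have h3 : (l1 x : ℝ) ≤ N := by exact_mod_cast hNx
    have h4 : 1 / ((N : ℝ) + 1) * l1 x ≤ 1 := by
      rw [one_div_mul_eq_div, div_le_one (by positivity)]
      linarith
    have h5 : (coneCount ξ h δ γ : ℝ) < 1 := h2.trans_le h4
    have h6 : coneCount ξ h δ γ < 1 := by exact_mod_cast h5
    omega
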